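/- Let Ω ⊂ ℝ³ be a compact convex region of unit volume with nonempty interior and k ≥ 1 an integer. Then the probability that ρ(χ_n; δ ≥ k+1) = ρ(χ_n; κ ≥ k+1) converges to 1 as n → ∞. -/

import Mathlib

open MeasureTheory Metric Real Filter Topology

/-- `btail p m k` is the probability that a binomial variable with parameters `m`, `p` is `< k`. -/
noncomputable def btail (p : ℝ) : ℕ → ℕ → ℝ
  | _, 0 => 0
  | 0, _ + 1 => 1
  | m + 1, k + 1 => p * btail p m k + (1 - p) * btail p m (k + 1)

@[simp] lemma btail_zero_right (p : ℝ) (m : ℕ) : btail p m 0 = 0 := by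
  cases m <;> rfl

@[simp] lemma btail_zero_left (p : ℝ) (k : ℕ) : btail p 0 (k + 1) = 1 := rfl

lemma btail_succ (p : ℝ) (m k : ℕ) :
    btail p (m + 1) (k + 1) = p * btail p m k + (1 - p) * btail p m (k + 1) := rfl

lemma btail_nonneg {p : ℝ} (h0 : 0 ≤ p) (h1 : p ≤ 1) (m k : ℕ) : 0 ≤ btail p m k := by
  induction m generalizing k with
  | zero => cases k <;> simp
  | succ m ih =>
    cases k with
    | zero => simp
    | succ k =>
      rw [btail_succ]
      have := ih k
      have := ih (k + 1)
      have : 0 ≤ 1 - p := by linarith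
      positivity

lemma btail_le_one {p : ℝ} (h0 : 0 ≤ p) (h1 : p ≤ 1) (m k : ℕ) : btail p m k ≤ 1 := by
  induction m generalizing k with
  | zero => cases k <;> simp
  | succ m ih =>
    cases k with
    | zero => simp
    | succ k =>
      rw [btail_succ]
      nlinarith [ih k, ih (k + 1)]

lemma btail_le_succ {p : ℝ} (h0 : 0 ≤ p) (h1 : p ≤ 1) (m k : ℕ) :
    btail p m k ≤ btail p m (k + 1) := by
  induction m generalizing k with
  | zero => cases k <;> simp
  | succ m ih =>
    cases k with
    | zero => simpa using btail_nonneg h0 h1 _ _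
    | succ k =>
      rw [btail_succ, btail_succ]
      nlinarith [ih k, ih (k + 1)]

lemma btail_add_le_mul {p q : ℝ} (hp : 0 ≤ p) (hq : 0 ≤ q) (h1 : p + q ≤ 1) (m k : ℕ) :
    btail (p + q) m k ≤ btail p m k * btail q m k := by
  induction m generalizing k with
  | zero => cases k <;> simp
  | succ m ih =>
    cases k with
    | zero => simp
    | succ k =>
      simp only [btail_succ]
      have i1 := ih k
      have i2 := ih (k + 1)
      have a0 := btail_nonneg hp (by linarith) m k
      have b0 := btail_nonneg hq (by linarith) m k
      have a1 := btail_le_succ hp (by linarith) m k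
      have b1 := btail_le_succ hq (by linarith) m k
      set a := btail p m k
      set b := btail q m k
      set a' := btail p m (k + 1)
      set b' := btail q m (k + 1)
      have e1 : (p + q) * btail (p + q) m k ≤ (p + q) * (a * b) := by gcongr
      have e2 : (1 - (p + q)) * btail (p + q) m (k + 1) ≤ (1 - (p + q)) * (a' * b') :=
        mul_le_mul_of_nonneg_left i2 (by linarith)
      have e3 : 0 ≤ p * (1 - q) * (a * (b' - b)) :=
        mul_nonneg (mul_nonneg hp (by linarith)) (mul_nonneg a0 (by linarith))
      have e4 : 0 ≤ q * (1 - p) * (b * (a' - a)) :=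
        mul_nonneg (mul_nonneg hq (by linarith)) (mul_nonneg b0 (by linarith))
      have e5 : a * b ≤ a' * b' := mul_le_mul a1 b1 b0 (by linarith)
      have e6 : 0 ≤ p * q * (a' * b' - a * b) :=
        mul_nonneg (mul_nonneg hp hq) (by linarith)
      nlinarith

lemma btail_anti {p q : ℝ} (hp : 0 ≤ p) (hpq : p ≤ q) (h1 : q ≤ 1) (m k : ℕ) :
    btail q m k ≤ btail p m k := by
  have h := btail_add_le_mul hp (sub_nonneg.2 hpq) (by linarith) m k
  rw [add_sub_cancel] at h
  exact h.trans (mul_le_of_le_one_right (btail_nonneg hp (by linarith) _ _)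
    (btail_le_one (by linarith) (by linarith) _ _))

lemma btail_le_pow {p : ℝ} (h0 : 0 ≤ p) (h1 : p ≤ 1) (m k : ℕ) :
    btail p m k ≤ 2 ^ k * (1 - p / 2) ^ m := by
  induction m generalizing k with
  | zero =>
    cases k with
    | zero => simp
    | succ k => simpa using one_le_pow₀ (by norm_num : (1 : ℝ) ≤ 2)
  | succ m ih =>
    cases k with
    | zero =>
      have : 0 ≤ 1 - p / 2 := by linarith
      simp only [btail_zero_right]; positivity
    | succ k =>
      rw [btail_succ]
      have e1 := mul_le_mul_of_nonneg_left (ih k) h0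
      have e2 := mul_le_mul_of_nonneg_left (ih (k + 1)) (by linarith : 0 ≤ 1 - p)
      calc _ ≤ _ := add_le_add e1 e2
        _ = _ := by ring

lemma btail_le_exp {p : ℝ} (h0 : 0 ≤ p) (h1 : p ≤ 1) (m k : ℕ) :
    btail p m k ≤ 2 ^ k * Real.exp (-(m * p / 2)) := by
  refine (btail_le_pow h0 h1 m k).trans ?_
  gcongr
  calc (1 - p / 2) ^ m ≤ (Real.exp (-(p / 2))) ^ m := by
        gcongr
        · linarith
        · linarith [Real.add_one_le_exp (-(p / 2))]
    _ = _ := by rw [← Real.exp_nat_mul]; ring_nf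

lemma pow_mul_btail_le {p q s : ℝ} (hp : 0 ≤ p) (hq : 0 ≤ q) (h1 : p + q ≤ 1) (hs0 : 0 ≤ s)
    (hs1 : s ≤ 1) (hs : (1 - p) * s ≤ 1 - p - q) (m k : ℕ) :
    s ^ m * btail p m k ≤ btail (p + q) m k := by
  induction m generalizing k with
  | zero => cases k <;> simp
  | succ m ih =>
    cases k with
    | zero => simp
    | succ k =>
      simp only [btail_succ]
      have i1 := ih k
      have i2 := ih (k + 1)
      have a0 : 0 ≤ s ^ m * btail p m k :=
        mul_nonneg (pow_nonneg hs0 _) (btail_nonneg hp (by linarith) m k)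
      have a1 : 0 ≤ s ^ m * btail p m (k + 1) :=
        mul_nonneg (pow_nonneg hs0 _) (btail_nonneg hp (by linarith) m (k + 1))
      have e1 : p * s * (s ^ m * btail p m k) ≤ (p + q) * btail (p + q) m k :=
        mul_le_mul (by nlinarith) i1 a0 (by linarith)
      have e2 : (1 - p) * s * (s ^ m * btail p m (k + 1)) ≤
          (1 - (p + q)) * btail (p + q) m (k + 1) :=
        mul_le_mul (by linarith) i2 a1 (by linarith)
      calc _ = p * s * (s ^ m * btail p m k) + (1 - p) * s * (s ^ m * btail p m (k + 1)) := by ring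
        _ ≤ _ := add_le_add e1 e2

lemma one_sub_mul_btail_le {p : ℝ} (h0 : 0 ≤ p) (h1 : p ≤ 1) (m k : ℕ) :
    (1 - p) * btail p m k ≤ btail p (m + 1) k := by
  cases k with
  | zero => simp
  | succ k =>
    rw [btail_succ]
    have := mul_nonneg h0 (btail_nonneg h0 h1 m k)
    linarith

lemma pow_le_btail {p : ℝ} (h0 : 0 ≤ p) (h1 : p ≤ 1) (m k : ℕ) :
    (1 - p) ^ m ≤ btail p m (k + 1) := by
  induction m with
  | zero => simp
  | succ m ih =>
    refine le_trans ?_ (one_sub_mul_btail_le h0 h1 m (k + 1))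
    rw [pow_succ']
    exact mul_le_mul_of_nonneg_left ih (by linarith)

lemma continuous_btail (m k : ℕ) : Continuous fun p => btail p m k := by
  induction m generalizing k with
  | zero => cases k <;> simp <;> exact continuous_const
  | succ m ih =>
    cases k with
    | zero => simpa using continuous_const
    | succ k =>
      simp only [btail_succ]
      have := ih k
      have := ih (k + 1)
      fun_prop

lemma btail_zero_prob (m k : ℕ) : btail 0 m (k + 1) = 1 := by
  induction m with
  | zero => rfl
  | succ m ih => simp [btail_succ, ih]

section Sampling

variable {E : Type*}

open Classical in
/-- Number of sample points lying in `D`. -/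
noncomputable def cnt {m : ℕ} (D : Set E) (X : Fin m → E) : ℕ :=
  (Finset.univ.filter fun i => X i ∈ D).card

open Classical in
lemma cnt_insertNth_zero {m : ℕ} (D : Set E) (x : E) (Y : Fin m → E) :
    cnt D ((0 : Fin (m + 1)).insertNth x Y : Fin (m + 1) → E) =
      (if x ∈ D then 1 else 0) + cnt D Y := by
  unfold cnt
  rw [Finset.card_filter, Finset.card_filter, Fin.sum_univ_succ]
  simp

lemma cnt_mono {m : ℕ} {D D' : Set E} (h : D ⊆ D') (X : Fin m → E) : cnt D X ≤ cnt D' X := by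
  classical
  unfold cnt
  exact Finset.card_le_card (Finset.monotone_filter_right _ fun i _ hi => h hi)

variable [MeasurableSpace E]

open Classical in
lemma measurable_cnt_fun {m : ℕ} {α : Type*} [MeasurableSpace α] {S : Set (α × E)}
    (hS : MeasurableSet S) : Measurable fun z : α × (Fin m → E) => cnt {y | (z.1, y) ∈ S} z.2 := by
  unfold cnt
  simp only [Finset.card_filter]
  refine Finset.measurable_sum _ fun i _ => ?_
  refine Measurable.ite ?_ measurable_const measurable_const
  exact (show Measurable fun z : α × (Fin m → E) => (z.1, z.2 i) by fun_prop) hS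

lemma measurable_cnt {m : ℕ} {D : Set E} (hD : MeasurableSet D) :
    Measurable fun X : Fin m → E => cnt D X := by
  have := measurable_cnt_fun (m := m) (α := Unit) (S := Prod.snd ⁻¹' D) (measurable_snd hD)
  exact this.comp (measurable_const.prodMk measurable_id : Measurable fun X => ((), X))

variable (μ : Measure E) [IsProbabilityMeasure μ]

lemma pi_succ_apply {m : ℕ} (i : Fin (m + 1)) {S : Set (Fin (m + 1) → E)} (hS : MeasurableSet S) :
    (Measure.pi fun _ : Fin (m + 1) => μ) S =
      ∫⁻ x, (Measure.pi fun _ : Fin m => μ) {Y | (i.insertNth x Y : Fin (m + 1) → E) ∈ S} ∂μ := by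
  have h := (measurePreserving_piFinSuccAbove (fun _ : Fin (m + 1) => μ) i).symm
  rw [← h.measure_preimage hS.nullMeasurableSet, Measure.prod_apply
    ((MeasurableEquiv.measurable _) hS)]
  rfl

lemma pi_cnt_inter_le {D₁ D₂ : Set E} (h₁ : MeasurableSet D₁) (h₂ : MeasurableSet D₂)
    (hd : Disjoint D₁ D₂) (m k l : ℕ) :
    (Measure.pi fun _ : Fin m => μ) {X | cnt D₁ X < k ∧ cnt D₂ X < l} ≤
      ENNReal.ofReal (btail (μ.real D₁) m k * btail (μ.real D₂) m l) := by
  classical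
  set p := μ.real D₁
  set q := μ.real D₂
  have hp : 0 ≤ p := measureReal_nonneg
  have hq : 0 ≤ q := measureReal_nonneg
  have hpq : p + q ≤ 1 := by
    rw [← measureReal_union hd h₂]; exact measureReal_le_one
  induction m generalizing k l with
  | zero =>
    cases k with
    | zero => simp
    | succ k =>
      cases l with
      | zero => simp
      | succ l => simpa using prob_le_one
  | succ m ih =>
    cases k with
    | zero => simp
    | succ k =>
      cases l with
      | zero => simp
      | succ l =>
        have hS : MeasurableSet {X : Fin (m + 1) → E | cnt D₁ X < k + 1 ∧ cnt D₂ X < l + 1} :=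
          (measurableSet_lt (measurable_cnt h₁) measurable_const).inter
            (measurableSet_lt (measurable_cnt h₂) measurable_const)
        rw [pi_succ_apply μ 0 hS]
        set F : ℕ → ℕ → ℝ := fun k l => btail p m k * btail q m l
        have hF : ∀ k l, 0 ≤ F k l := fun k l =>
          mul_nonneg (btail_nonneg hp (by linarith) _ _) (btail_nonneg hq (by linarith) _ _)
        have key : ∀ x, (Measure.pi fun _ : Fin m => μ)
            {Y | ((0 : Fin (m + 1)).insertNth x Y : Fin (m + 1) → E) ∈
              {X : Fin (m + 1) → E | cnt D₁ X < k + 1 ∧ cnt D₂ X < l + 1}} ≤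
            D₁.indicator (fun _ => ENNReal.ofReal (F k (l + 1))) x +
            D₂.indicator (fun _ => ENNReal.ofReal (F (k + 1) l)) x +
            (D₁ ∪ D₂)ᶜ.indicator (fun _ => ENNReal.ofReal (F (k + 1) (l + 1))) x := by
          intro x
          simp only [Set.mem_ofPred_eq, cnt_insertNth_zero]
          by_cases hx1 : x ∈ D₁
          · have hx2 : x ∉ D₂ := fun h => hd.le_bot ⟨hx1, h⟩
            simpa [hx1, hx2, add_comm 1] using ih k (l + 1)
          · by_cases hx2 : x ∈ D₂
            · simpa [hx1, hx2, add_comm 1] using ih (k + 1) l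
            · simpa [hx1, hx2] using ih (k + 1) (l + 1)
        refine (lintegral_mono key).trans ?_
        rw [lintegral_add_right _ (measurable_const.indicator (h₁.union h₂).compl),
          lintegral_add_right _ (measurable_const.indicator h₂),
          lintegral_indicator_const h₁, lintegral_indicator_const h₂,
          lintegral_indicator_const (h₁.union h₂).compl]
        have e1 : μ D₁ = ENNReal.ofReal p := by simp [p]
        have e2 : μ D₂ = ENNReal.ofReal q := by simp [q]
        have e3 : μ (D₁ ∪ D₂)ᶜ = ENNReal.ofReal (1 - p - q) := by
          rw [← ofReal_measureReal, probReal_compl_eq_one_sub (h₁.union h₂),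
            measureReal_union hd h₂]
          congr 1; simp only [p, q]; ring
        rw [e1, e2, e3, ← ENNReal.ofReal_mul (hF _ _), ← ENNReal.ofReal_mul (hF _ _),
          ← ENNReal.ofReal_mul (hF _ _),
          ← ENNReal.ofReal_add (mul_nonneg (hF _ _) hp) (mul_nonneg (hF _ _) hq),
          ← ENNReal.ofReal_add (add_nonneg (mul_nonneg (hF _ _) hp) (mul_nonneg (hF _ _) hq))
            (mul_nonneg (hF _ _) (by linarith))]
        apply ENNReal.ofReal_le_ofReal
        simp only [btail_succ, F]
        have a1 := btail_le_succ hp (by linarith) m k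
        have b1 := btail_le_succ hq (by linarith) m l
        nlinarith [mul_nonneg (mul_nonneg hp hq) (mul_nonneg (sub_nonneg.2 a1) (sub_nonneg.2 b1))]

lemma pi_cnt_lt {D : Set E} (hD : MeasurableSet D) (m k : ℕ) :
    (Measure.pi fun _ : Fin m => μ) {X | cnt D X < k} =
      ENNReal.ofReal (btail (μ.real D) m k) := by
  classical
  set p := μ.real D
  have hp : 0 ≤ p := measureReal_nonneg
  have hp1 : p ≤ 1 := measureReal_le_one
  induction m generalizing k with
  | zero =>
    cases k with
    | zero => simp
    | succ k => simp [cnt]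
  | succ m ih =>
    cases k with
    | zero => simp
    | succ k =>
      rw [pi_succ_apply μ 0 (measurableSet_lt (measurable_cnt hD) measurable_const)]
      have key : ∀ x, (Measure.pi fun _ : Fin m => μ)
          {Y | ((0 : Fin (m + 1)).insertNth x Y : Fin (m + 1) → E) ∈
            {X : Fin (m + 1) → E | cnt D X < k + 1}} =
          D.indicator (fun _ => ENNReal.ofReal (btail p m k)) x +
          Dᶜ.indicator (fun _ => ENNReal.ofReal (btail p m (k + 1))) x := by
        intro x
        simp only [Set.mem_ofPred_eq, cnt_insertNth_zero]
        by_cases hx : x ∈ D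
        · simpa [hx, add_comm 1] using ih k
        · simpa [hx] using ih (k + 1)
      rw [lintegral_congr key, lintegral_add_right _ (measurable_const.indicator hD.compl),
        lintegral_indicator_const hD, lintegral_indicator_const hD.compl]
      have e1 : μ D = ENNReal.ofReal p := by simp [p]
      have e3 : μ Dᶜ = ENNReal.ofReal (1 - p) := by
        rw [← ofReal_measureReal, probReal_compl_eq_one_sub hD]
      have f1 := btail_nonneg hp hp1 m k
      have f2 := btail_nonneg hp hp1 m (k + 1)
      rw [e1, e3, ← ENNReal.ofReal_mul f1, ← ENNReal.ofReal_mul f2, btail_succ,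
        ← ENNReal.ofReal_add (mul_nonneg f1 hp) (mul_nonneg f2 (by linarith))]
      congr 1; ring

lemma measurable_removeNth {m : ℕ} (i : Fin (m + 1)) :
    Measurable fun X : Fin (m + 1) → E => i.removeNth X :=
  measurable_pi_lambda _ fun _ => measurable_pi_apply _

lemma measurableSet_cnt_removeNth {m : ℕ} (i : Fin (m + 1)) (k : ℕ) {S : Set (E × E)}
    (hS : MeasurableSet S) :
    MeasurableSet {X : Fin (m + 1) → E | cnt {y | (X i, y) ∈ S} (i.removeNth X) < k} := by
  have h1 : Measurable fun X : Fin (m + 1) → E => cnt {y | (X i, y) ∈ S} (i.removeNth X) :=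
    (measurable_cnt_fun hS).comp
      ((measurable_pi_apply i).prodMk (measurable_removeNth i))
  exact measurableSet_lt h1 measurable_const

lemma pi_mem_cnt_lt {m : ℕ} (i : Fin (m + 1)) (k : ℕ) {Θ : Set E} (hΘ : MeasurableSet Θ)
    {S : Set (E × E)} (hS : MeasurableSet S) :
    (Measure.pi fun _ : Fin (m + 1) => μ)
        {X | X i ∈ Θ ∧ cnt {y | (X i, y) ∈ S} (i.removeNth X) < k} =
      ∫⁻ x in Θ, ENNReal.ofReal (btail (μ.real {y | (x, y) ∈ S}) m k) ∂μ := by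
  rw [← lintegral_indicator hΘ]
  refine (pi_succ_apply μ i
    (S := {X | X i ∈ Θ ∧ cnt {y | (X i, y) ∈ S} (i.removeNth X) < k})
    (((measurable_pi_apply i) hΘ).inter (measurableSet_cnt_removeNth i k hS))).trans ?_
  refine lintegral_congr fun x => ?_
  by_cases hx : x ∈ Θ
  · have := pi_cnt_lt μ (D := {y | (x, y) ∈ S}) (measurable_prodMk_left (x := x) hS) m k
    simpa [hx] using this
  · simp [hx]

lemma pi_pair_cnt_le {m : ℕ} (i : Fin (m + 2)) (j : Fin (m + 1)) (k l : ℕ) {R : Set (E × E)}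
    (hR : MeasurableSet R) {S₁ S₂ : Set ((E × E) × E)} (h₁ : MeasurableSet S₁)
    (h₂ : MeasurableSet S₂)
    (hd : ∀ x y, (x, y) ∈ R → Disjoint {z | ((x, y), z) ∈ S₁} {z | ((x, y), z) ∈ S₂}) :
    (Measure.pi fun _ : Fin (m + 2) => μ)
        {X | (X i, i.removeNth X j) ∈ R ∧
          cnt {z | ((X i, i.removeNth X j), z) ∈ S₁} (j.removeNth (i.removeNth X)) < k ∧
          cnt {z | ((X i, i.removeNth X j), z) ∈ S₂} (j.removeNth (i.removeNth X)) < l} ≤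
      ∫⁻ x, ∫⁻ y, R.indicator (fun w => ENNReal.ofReal (btail (μ.real {z | (w, z) ∈ S₁}) m k *
        btail (μ.real {z | (w, z) ∈ S₂}) m l)) (x, y) ∂μ ∂μ := by
  have hS : MeasurableSet {w : (E × E) × (Fin m → E) | w.1 ∈ R ∧
      cnt {z | (w.1, z) ∈ S₁} w.2 < k ∧ cnt {z | (w.1, z) ∈ S₂} w.2 < l} :=
    (measurable_fst hR).inter
      ((measurableSet_lt (measurable_cnt_fun h₁) measurable_const).inter
        (measurableSet_lt (measurable_cnt_fun h₂) measurable_const))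
  have hm : Measurable fun X : Fin (m + 2) → E =>
      ((X i, i.removeNth X j), j.removeNth (i.removeNth X)) :=
    ((measurable_pi_apply i).prodMk ((measurable_pi_apply j).comp (measurable_removeNth i))).prodMk
      ((measurable_removeNth j).comp (measurable_removeNth i))
  have hm' : ∀ x : E, Measurable fun Y : Fin (m + 1) → E => ((x, Y j), j.removeNth Y) := fun x =>
    (measurable_const.prodMk (measurable_pi_apply j)).prodMk (measurable_removeNth j)
  refine (pi_succ_apply μ i (hm hS)).trans_le (lintegral_mono fun x => ?_)
  have e : {Y : Fin (m + 1) → E | (i.insertNth x Y : Fin (m + 2) → E) ∈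
      (fun X : Fin (m + 2) → E => ((X i, i.removeNth X j), j.removeNth (i.removeNth X))) ⁻¹'
      {w : (E × E) × (Fin m → E) | w.1 ∈ R ∧
      cnt {z | (w.1, z) ∈ S₁} w.2 < k ∧ cnt {z | (w.1, z) ∈ S₂} w.2 < l}} =
      (fun Y : Fin (m + 1) → E => ((x, Y j), j.removeNth Y)) ⁻¹'
      {w : (E × E) × (Fin m → E) | w.1 ∈ R ∧
      cnt {z | (w.1, z) ∈ S₁} w.2 < k ∧ cnt {z | (w.1, z) ∈ S₂} w.2 < l} := by
    ext Y; simp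
  rw [e]
  refine (pi_succ_apply μ j (hm' x hS)).trans_le (lintegral_mono fun y => ?_)
  by_cases hxy : (x, y) ∈ R
  · have := pi_cnt_inter_le μ (D₁ := {z | ((x, y), z) ∈ S₁}) (D₂ := {z | ((x, y), z) ∈ S₂})
      (measurable_prodMk_left (x := (x, y)) h₁) (measurable_prodMk_left (x := (x, y)) h₂) (hd x y hxy) m k l
    simpa [hxy] using this
  · simp [hxy]

lemma pi_inter_compl_le {Ω' ι : Type*} [MeasurableSpace Ω'] [Fintype ι] (P : Measure Ω')
    [IsProbabilityMeasure P] {A : ι → Set Ω'} (hA : ∀ i, MeasurableSet (A i)) {T B : ℝ}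
    (hT : 0 < T) (hsum : ∑ i, P.real (A i) = T)
    (hB : ∑ i, ∑ j, P.real (A i ∩ A j) ≤ B) :
    P.real (⋂ i, (A i)ᶜ) ≤ (B - T ^ 2) / T ^ 2 := by
  have hint : ∀ s : Set Ω', MeasurableSet s → Integrable (s.indicator fun _ => (1 : ℝ)) P :=
    fun s hs => (integrable_const 1).indicator hs
  set N : Ω' → ℝ := fun w => ∑ i, (A i).indicator (fun _ => (1 : ℝ)) w
  have hN2 : ∀ w, (N w - T) ^ 2 = (∑ i, ∑ j, (A i ∩ A j).indicator (fun _ => (1 : ℝ)) w) -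
      2 * T * N w + T ^ 2 := by
    intro w
    have : N w * N w = ∑ i, ∑ j, (A i ∩ A j).indicator (fun _ => (1 : ℝ)) w := by
      simp only [N, Finset.sum_mul_sum]
      refine Finset.sum_congr rfl fun i _ => Finset.sum_congr rfl fun j _ => ?_
      by_cases hi : w ∈ A i <;> by_cases hj : w ∈ A j <;> simp [hi, hj]
    rw [← this]; ring
  have hI1 : Integrable N P := integrable_finsetSum _ fun i _ => hint _ (hA i)
  have hI2 : Integrable (fun w => ∑ i, ∑ j, (A i ∩ A j).indicator (fun _ => (1 : ℝ)) w) P :=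
    integrable_finsetSum _ fun i _ => integrable_finsetSum _ fun j _ =>
      hint _ ((hA i).inter (hA j))
  have e1 : ∫ w, N w ∂P = T := by
    rw [← hsum, integral_finsetSum _ fun i _ => hint _ (hA i)]
    refine Finset.sum_congr rfl fun i _ => ?_
    rw [integral_indicator_const _ (hA i)]; simp
  have e2 : ∫ w, (∑ i, ∑ j, (A i ∩ A j).indicator (fun _ => (1 : ℝ)) w) ∂P =
      ∑ i, ∑ j, P.real (A i ∩ A j) := by
    rw [integral_finsetSum _ fun i _ => integrable_finsetSum _ fun j _ =>
      hint _ ((hA i).inter (hA j))]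
    refine Finset.sum_congr rfl fun i _ => ?_
    rw [integral_finsetSum _ fun j _ => hint _ ((hA i).inter (hA j))]
    refine Finset.sum_congr rfl fun j _ => ?_
    rw [integral_indicator_const _ ((hA i).inter (hA j))]; simp
  have hI3 : Integrable (fun w => (N w - T) ^ 2) P := by
    simp only [hN2]
    exact (hI2.sub (hI1.const_mul _)).add (integrable_const _)
  have e3 : ∫ w, (N w - T) ^ 2 ∂P ≤ B - T ^ 2 := by
    simp only [hN2]
    have h3 : Integrable (fun w => (∑ i, ∑ j, (A i ∩ A j).indicator (fun _ => (1 : ℝ)) w) -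
      2 * T * N w) P := hI2.sub (hI1.const_mul _)
    rw [integral_add h3 (integrable_const _),
      integral_sub hI2 (hI1.const_mul _), integral_const_mul, e1, e2]
    simp only [integral_const, probReal_univ, smul_eq_mul, one_mul]
    nlinarith
  have hC : MeasurableSet (⋂ i, (A i)ᶜ) := MeasurableSet.iInter fun i => (hA i).compl
  have e4 : ∫ w, (⋂ i, (A i)ᶜ).indicator (fun _ => T ^ 2) w ∂P ≤ ∫ w, (N w - T) ^ 2 ∂P := by
    refine integral_mono ((integrable_const _).indicator hC) hI3 fun w => ?_
    by_cases hw : w ∈ ⋂ i, (A i)ᶜ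
    · have : N w = 0 := by
        refine Finset.sum_eq_zero fun i _ => ?_
        have := Set.mem_iInter.1 hw i
        simpa using this
      simp only [Set.indicator_of_mem hw, this]; nlinarith
    · simp only [Set.indicator_of_notMem hw]; positivity
  rw [integral_indicator_const _ hC, smul_eq_mul] at e4
  rw [le_div_iff₀ (by positivity)]
  linarith

end Sampling

section Bodies

/-- Euclidean three-space. -/
abbrev E3 := EuclideanSpace ℝ (Fin 3)

/-- Volume of the unit ball. -/
noncomputable def β : ℝ := volume.real (ball (0 : E3) 1)

lemma β_pos : 0 < β := by
  unfold β
  rw [measureReal_def]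
  exact ENNReal.toReal_pos (measure_ball_pos _ _ one_pos).ne' measure_ball_lt_top.ne

lemma vol_closedBall (x : E3) {r : ℝ} (hr : 0 ≤ r) : volume.real (closedBall x r) = r ^ 3 * β := by
  have := Measure.addHaar_real_closedBall (volume : Measure E3) x hr
  simpa [β] using this

lemma vol_image_simil (F : E3 ≃ₗᵢ[ℝ] E3) (s : ℝ) (hs : s ≤ 1) (z w : E3) (S : Set E3) :
    volume.real ((fun q => F ((1 - s) • q + s • z) + w) '' S) = (1 - s) ^ 3 * volume.real S := by
  have e : (fun q => F ((1 - s) • q + s • z) + w) '' S =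
      (fun q => q + w) '' (F '' (AffineMap.homothety z (1 - s) '' S)) := by
    rw [Set.image_image, Set.image_image]
    refine Set.image_congr fun q _ => ?_
    congr 2
    rw [AffineMap.homothety_apply]
    simp only [vsub_eq_sub, vadd_eq_add, smul_sub, sub_smul, one_smul]
    abel
  rw [e, measureReal_def, measureReal_def]
  have h1 : ∀ T : Set E3, volume ((fun q => q + w) '' T) = volume T := fun T => by
    simp
  have h2 : ∀ T : Set E3, volume (F '' T) = volume T := fun T => by
    have : F '' T = F.symm ⁻¹' T := F.toEquiv.image_eq_preimage_symm T
    rw [this]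
    exact (F.symm.measurePreserving).measure_preimage_equiv
      (f := F.symm.toMeasurableEquiv) T
  rw [h1, h2, Measure.addHaar_image_homothety]
  rw [ENNReal.toReal_mul, ENNReal.toReal_ofReal (abs_nonneg _)]
  congr 1
  simp only [finrank_euclideanSpace, Fintype.card_fin]
  exact abs_of_nonneg (pow_nonneg (by linarith) _)

lemma vol_image_homothety (s : ℝ) (hs : s ≤ 1) (z : E3) (S : Set E3) :
    volume.real ((fun q => (1 - s) • q + s • z) '' S) = (1 - s) ^ 3 * volume.real S := by
  simpa using vol_image_simil (LinearIsometryEquiv.refl ℝ E3) s hs z 0 S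

lemma Convex.closedBall_lineMap_subset {Ω : Set E3} (h : Convex ℝ Ω) {x q : E3} (hx : x ∈ Ω)
    {ε t : ℝ} (hq : closedBall q ε ⊆ Ω) (ht0 : 0 ≤ t) (ht1 : t ≤ 1) :
    closedBall (x + t • (q - x)) (t * ε) ⊆ Ω := by
  intro w hw
  rcases ht0.eq_or_lt with rfl | ht
  · simp at hw; rwa [hw]
  · have hw' : q + t⁻¹ • (w - (x + t • (q - x))) ∈ Ω := by
      apply hq
      rw [mem_closedBall, dist_eq_norm] at hw ⊢
      rw [add_sub_cancel_left, norm_smul, norm_inv, Real.norm_of_nonneg ht0,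
        inv_mul_le_iff₀ ht]
      exact hw
    have := h.add_smul_sub_mem hx hw' ⟨ht0, ht1⟩
    convert this using 1
    rw [smul_sub, smul_add, smul_smul, mul_inv_cancel₀ ht.ne', one_smul, smul_sub]
    abel

lemma Convex.closedBall_segment_subset {Ω : Set E3} (h : Convex ℝ Ω) {x q : E3}
    {ε t : ℝ} (hx : closedBall x ε ⊆ Ω) (hq : closedBall q ε ⊆ Ω) (ht0 : 0 ≤ t) (ht1 : t ≤ 1) :
    closedBall (x + t • (q - x)) ε ⊆ Ω := by
  intro w hw
  have h1 : x + (w - (x + t • (q - x))) ∈ Ω := by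
    apply hx; rw [mem_closedBall, dist_eq_norm] at hw ⊢; simpa using hw
  have h2 : q + (w - (x + t • (q - x))) ∈ Ω := by
    apply hq; rw [mem_closedBall, dist_eq_norm] at hw ⊢; simpa using hw
  have := h.add_smul_sub_mem h1 h2 ⟨ht0, ht1⟩
  convert this using 1
  rw [add_sub_add_right_eq_sub]
  abel

/-- A convex body at scale `R`: it contains a ball of radius `R * ρ` around `p` and has diameter at
most `R * D`. -/
structure Body (Ω : Set E3) (p : E3) (ρ D R : ℝ) : Prop where
  conv : Convex ℝ Ω
  comp : IsCompact Ω
  ρ_pos : 0 < ρ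
  ρ_le : ρ ≤ 1
  D_ge : 1 ≤ D
  R_pos : 0 < R
  ball_subset : closedBall p (R * ρ) ⊆ Ω
  dist_le : ∀ x ∈ Ω, ∀ y ∈ Ω, dist x y ≤ R * D

namespace Body

variable {Ω : Set E3} {p : E3} {ρ D R : ℝ} (h : Body Ω p ρ D R)

/-- The point at parameter `t` on the way from `x` into the body. -/
noncomputable def inward (p : E3) (R t : ℝ) (x : E3) : E3 := x + (t / R) • (p - x)

include h

lemma p_mem : p ∈ Ω := h.ball_subset (mem_closedBall_self (mul_pos h.R_pos h.ρ_pos).le)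

lemma vol_ne_top {S : Set E3} (hS : S ⊆ Ω) : volume S ≠ ⊤ :=
  ((measure_mono hS).trans_lt h.comp.measure_lt_top).ne

lemma vol_mono {S T : Set E3} (hST : S ⊆ T) (hT : T ⊆ Ω) : volume.real S ≤ volume.real T :=
  measureReal_mono hST (h.vol_ne_top hT)

lemma inward_ball {x : E3} (hx : x ∈ Ω) {t : ℝ} (ht : 0 ≤ t) (htR : t ≤ R) :
    closedBall (inward p R t x) (t * ρ) ⊆ Ω := by
  have := h.conv.closedBall_lineMap_subset hx h.ball_subset (t := t / R)
    (div_nonneg ht h.R_pos.le) ((div_le_one h.R_pos).2 htR)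
  have e : t / R * (R * ρ) = t * ρ := by field_simp [h.R_pos.ne']
  rwa [e] at this

lemma dist_inward {x : E3} (hx : x ∈ Ω) {t : ℝ} (ht : 0 ≤ t) :
    dist (inward p R t x) x ≤ t * D := by
  have h1 := h.dist_le p h.p_mem x hx
  unfold inward
  rw [dist_eq_norm, add_sub_cancel_left, norm_smul,
    Real.norm_of_nonneg (div_nonneg ht h.R_pos.le), ← dist_eq_norm]
  calc t / R * dist p x ≤ t / R * (R * D) :=
        mul_le_mul_of_nonneg_left h1 (div_nonneg ht h.R_pos.le)
    _ = t * D := by field_simp [h.R_pos.ne']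

lemma vol_ball_ge {x : E3} (hx : x ∈ Ω) {L : ℝ} (hL : 0 < L) (hLR : L ≤ R * (2 * D)) :
    (L * ρ / (2 * D)) ^ 3 * β ≤ volume.real (closedBall x L ∩ Ω) := by
  have hD := h.D_ge
  have ht : 0 ≤ L / (2 * D) := by positivity
  have hsub : closedBall (inward p R (L / (2 * D)) x) (L / (2 * D) * ρ) ⊆ closedBall x L ∩ Ω := by
    refine Set.subset_inter ?_ (h.inward_ball hx ht ?_)
    · apply closedBall_subset_closedBall'
      have h1 := h.dist_inward hx ht
      have h2 : L / (2 * D) * D = L / 2 := by field_simp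
      have h3 : L / (2 * D) * ρ ≤ L / 2 * 1 := by
        apply mul_le_mul _ h.ρ_le h.ρ_pos.le (by positivity)
        apply div_le_div_of_nonneg_left hL.le (by norm_num) (by linarith)
      linarith
    · rw [div_le_iff₀ (by positivity)]; linarith
  have := h.vol_mono hsub Set.inter_subset_right
  rw [vol_closedBall _ (mul_nonneg ht h.ρ_pos.le)] at this
  convert this using 3
  ring

end Body

end Bodies

section PairGeometry

lemma vol_image_add_right (S : Set E3) (w : E3) :
    volume.real ((fun q => q + w) '' S) = volume.real S := by
  rw [measureReal_def, measureReal_def]; simp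

namespace Body

variable {Ω : Set E3} {p : E3} {ρ D R : ℝ}

lemma exists_direction (h : Body Ω p ρ D R) (hR : 8 ≤ R * ρ) {b e : E3} (hb : b ∈ Ω)
    (he : ‖e‖ = 1) (hpe : -(R * ρ / 4) ≤ inner ℝ (p - b) e) :
    ∃ w : E3, ‖w‖ = 1 ∧ ρ / (4 * (D + 1)) ≤ inner ℝ w e ∧
      ∀ s : ℝ, 1 / 2 ≤ s → s ≤ 2 → closedBall (b + s • w) (ρ / (4 * (D + 1))) ⊆ Ω := by
  have hD := h.D_ge
  have hρ := h.ρ_pos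
  have hρ1 := h.ρ_le
  have hRp := h.R_pos
  set v : E3 := p + (R * ρ / 2) • e - b with hv
  have hve : R * ρ / 4 ≤ inner ℝ v e := by
    have : v = (p - b) + (R * ρ / 2) • e := by rw [hv]; abel
    rw [this, inner_add_left, inner_smul_left, real_inner_self_eq_norm_sq, he]
    simp; linarith
  have hvn : R * ρ / 4 ≤ ‖v‖ := by
    have := real_inner_le_norm v e
    rw [he, mul_one] at this; linarith
  have hvpos : 0 < ‖v‖ := by linarith
  have hvu : ‖v‖ ≤ R * (D + 1) := by
    have : v = (p - b) + (R * ρ / 2) • e := by rw [hv]; abel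
    rw [this]
    refine (norm_add_le _ _).trans ?_
    rw [norm_smul, he, Real.norm_of_nonneg (by positivity), ← dist_eq_norm]
    have := h.dist_le p h.p_mem b hb
    nlinarith
  refine ⟨‖v‖⁻¹ • v, ?_, ?_, ?_⟩
  · rw [norm_smul, norm_inv, norm_norm, inv_mul_cancel₀ hvpos.ne']
  · rw [inner_smul_left]
    simp only [map_inv₀, conj_trivial]
    rw [inv_mul_eq_div, le_div_iff₀ hvpos]
    calc ρ / (4 * (D + 1)) * ‖v‖ ≤ ρ / (4 * (D + 1)) * (R * (D + 1)) := by gcongr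
      _ = R * ρ / 4 := by field_simp
      _ ≤ _ := hve
  · intro s hs1 hs2
    have hball : closedBall (p + (R * ρ / 2) • e) (R * ρ / 2) ⊆ Ω := by
      refine Set.Subset.trans (closedBall_subset_closedBall' ?_) h.ball_subset
      rw [dist_eq_norm, add_sub_cancel_left, norm_smul, he, Real.norm_of_nonneg (by positivity)]
      linarith
    have := h.conv.closedBall_lineMap_subset hb hball (t := s / ‖v‖) (by positivity)
      ((div_le_one hvpos).2 (by linarith))
    rw [smul_smul, ← div_eq_mul_inv]
    refine Set.Subset.trans (closedBall_subset_closedBall ?_) this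
    rw [div_mul_eq_mul_div, le_div_iff₀ hvpos]
    calc ρ / (4 * (D + 1)) * ‖v‖ ≤ ρ / (4 * (D + 1)) * (R * (D + 1)) := by gcongr
      _ = 1 / 2 * (R * ρ / 2) := by field_simp; norm_num
      _ ≤ _ := by gcongr

set_option maxHeartbeats 1000000 in
lemma vol_diff_ge_aux (h : Body Ω p ρ D R) (hR : 8 ≤ R * ρ) {x y : E3} (hx : x ∈ Ω) (hy : y ∈ Ω)
    (hxy : 0 < dist x y) (hd : dist x y ≤ R * ρ / 4) (hpe : 0 ≤ inner ℝ (p - x) (y - x)) :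
    ((ρ / (4 * (D + 1))) ^ 2 / 16) ^ 3 * β * min (dist x y) 1 ≤
      volume.real ((closedBall y 1 \ closedBall x 1) ∩ Ω) := by
  have hD := h.D_ge
  have hρ := h.ρ_pos
  have hρ1 := h.ρ_le
  have hβ := β_pos
  set m := ρ / (4 * (D + 1)) with hm
  have hm0 : 0 < m := by positivity
  have hm1 : m ≤ 1 / 8 := by
    rw [hm, div_le_iff₀ (by positivity)]; linarith
  set c := m ^ 2 / 16 with hc
  have hc0 : 0 < c := by positivity
  have hc1 : c ≤ 1 / 16 := by nlinarith
  set d := dist x y with hdd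
  set e : E3 := d⁻¹ • (y - x) with he
  have hyx : ‖y - x‖ = d := by rw [hdd, dist_comm, dist_eq_norm]
  have he1 : ‖e‖ = 1 := by
    rw [he, norm_smul, norm_inv, Real.norm_of_nonneg hxy.le, hyx, inv_mul_cancel₀ hxy.ne']
  have hde : y = x + d • e := by
    rw [he, smul_smul, mul_inv_cancel₀ hxy.ne', one_smul]; abel
  have hxe : 0 ≤ inner ℝ (p - x) e := by
    rw [he, inner_smul_right]; positivity
  have norm_sq : ∀ (a b : ℝ) (w : E3), ‖w‖ = 1 →
      ‖a • w + b • e‖ ^ 2 = a ^ 2 + 2 * a * b * inner ℝ w e + b ^ 2 := by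
    intro a b w hw
    rw [norm_add_sq_real, norm_smul, norm_smul, hw, he1, inner_smul_left, inner_smul_right]
    simp; ring
  rcases le_or_gt d (m / 2) with hdm | hdm
  · obtain ⟨w, hw1, hwe, hwb⟩ := h.exists_direction hR hx he1 (by nlinarith)
    set J := ⌈m / 2 / d⌉₊ with hJ
    have hJ1 : m / 2 ≤ J * d := by
      have := Nat.le_ceil (m / 2 / d)
      rwa [div_le_iff₀ hxy] at this
    have hJ2 : J * d < m / 2 + d := by
      have := Nat.ceil_lt_add_one (a := m / 2 / d) (by positivity)
      rw [← hJ] at this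
      have := mul_lt_mul_of_pos_right this hxy
      rwa [add_mul, div_mul_cancel₀ _ hxy.ne', one_mul] at this
    have hJpos : (0 : ℝ) < J := by
      by_contra hcon
      nlinarith
    set q := x + (1 + c) • w with hq
    have hB1 : ∀ z ∈ closedBall q c, z ∈ closedBall (x + (J * d) • e) 1 := by
      intro z hz
      have h1 : dist q (x + (J * d) • e) ≤ 1 - c := by
        rw [dist_eq_norm]
        have : q - (x + (J * d) • e) = (1 + c) • w + (-(J * d)) • e := by
          rw [hq, neg_smul]; abel
        rw [this]
        apply le_of_sq_le_sq _ (by linarith)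
        rw [norm_sq _ _ _ hw1]
        have k1 : (J * d) * m ≤ (J * d) * inner ℝ w e := by
          apply mul_le_mul_of_nonneg_left hwe (by linarith)
        have k2 : 0 ≤ c * ((J * d) * inner ℝ w e) := by
          apply mul_nonneg hc0.le
          apply mul_nonneg (by linarith) (by linarith)
        have k3 : 0 ≤ (J * d - m / 2) * (m - J * d) := by
          apply mul_nonneg <;> linarith
        have k4 : 0 ≤ (J * d - m / 2) * m := by apply mul_nonneg <;> linarith
        nlinarith
      rw [mem_closedBall] at hz ⊢
      linarith [dist_triangle z q (x + (J * d) • e)]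
    set B0 := ball q c with hB0
    have hB2' : ∀ z ∈ B0, z ∉ closedBall x 1 := by
      intro z hz hz2
      have h1 : dist q x = 1 + c := by
        rw [dist_eq_norm, hq, add_sub_cancel_left, norm_smul, hw1,
          Real.norm_of_nonneg (by linarith), mul_one]
      rw [hB0, mem_ball, dist_comm] at hz
      rw [mem_closedBall] at hz2
      linarith [dist_triangle q z x]
    set S : ℕ → Set E3 := fun j =>
      B0 ∩ (closedBall (x + ((j + 1 : ℕ) * d) • e) 1 \ closedBall (x + ((j : ℕ) * d) • e) 1) with hS
    have hcover : B0 ⊆ ⋃ j ∈ Finset.range J, S j := by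
      intro z hz
      classical
      have hzJ := hB1 z (ball_subset_closedBall hz)
      have hex : ∃ j : ℕ, z ∈ closedBall (x + ((j : ℝ) * d) • e) 1 := ⟨J, hzJ⟩
      set j0 := Nat.find hex with hj0
      have hj0m := Nat.find_spec hex
      have hj0J : j0 ≤ J := Nat.find_min' hex hzJ
      have hj0ne : j0 ≠ 0 := by
        intro h0
        rw [← hj0, h0] at hj0m
        apply hB2' z hz
        simpa using hj0m
      obtain ⟨j, hj⟩ := Nat.exists_eq_succ_of_ne_zero hj0ne
      simp only [Set.mem_iUnion, Finset.mem_range]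
      refine ⟨j, by omega, hz, ?_, ?_⟩
      · rw [← hj0, hj] at hj0m; exact hj0m
      · exact Nat.find_min hex (by omega)
    have hfin : ∀ j ∈ Finset.range J, volume (S j) ≠ ⊤ := fun j _ =>
      ((measure_mono Set.inter_subset_left).trans_lt measure_ball_lt_top).ne
    have hvB0 : volume.real B0 = c ^ 3 * β := by
      rw [hB0, ← vol_closedBall q hc0.le, measureReal_def, measureReal_def,
        Measure.addHaar_closedBall_eq_addHaar_ball]
    have hsum : c ^ 3 * β ≤ ∑ j ∈ Finset.range J, volume.real (S j) := by
      rw [← hvB0]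
      refine (measureReal_mono hcover ?_).trans (measureReal_biUnion_finset_le _ _)
      exact (measure_biUnion_lt_top (Finset.finite_toSet _) fun j hj =>
        (hfin j hj).lt_top).ne
    have hall : ∀ j ∈ Finset.range J, volume.real (S j) ≤
        volume.real ((closedBall y 1 \ closedBall x 1) ∩ Ω) := by
      intro j hj
      rw [Finset.mem_range] at hj
      have hjd : j * d ≤ m / 2 := by
        have : (j : ℝ) + 1 ≤ J := by exact_mod_cast hj
        nlinarith
      rw [← vol_image_add_right (S j) (-((j * d) • e))]
      refine h.vol_mono ?_ Set.inter_subset_right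
      rintro _ ⟨z, ⟨hz0, hz1, hz2⟩, rfl⟩
      refine ⟨⟨?_, ?_⟩, ?_⟩
      · rw [mem_closedBall, dist_eq_norm] at hz1 ⊢
        convert hz1 using 2
        change z + -((j * d) • e) - y = z - (x + ((j + 1 : ℕ) * d) • e)
        rw [hde]; push_cast; rw [add_mul, one_mul, add_smul]; abel
      · intro hcon
        apply hz2
        rw [mem_closedBall, dist_eq_norm] at hcon ⊢
        convert hcon using 2
        change z - (x + (j * d) • e) = z + -((j * d) • e) - x
        abel
      · apply hwb (1 + c) (by linarith) (by linarith)
        rw [mem_closedBall, dist_eq_norm]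
        rw [hB0, mem_ball, dist_eq_norm] at hz0
        have : z + -((j * d) • e) - (x + (1 + c) • w) = (z - q) - (j * d) • e := by
          rw [hq]; abel
        rw [this]
        refine (norm_sub_le _ _).trans ?_
        rw [norm_smul, he1, Real.norm_of_nonneg (by positivity)]
        nlinarith
    have hfinal : c ^ 3 * β ≤ J * volume.real ((closedBall y 1 \ closedBall x 1) ∩ Ω) := by
      refine hsum.trans ((Finset.sum_le_sum hall).trans ?_)
      simp
    set V := volume.real ((closedBall y 1 \ closedBall x 1) ∩ Ω)
    have hV : 0 ≤ V := measureReal_nonneg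
    calc c ^ 3 * β * min d 1 ≤ c ^ 3 * β * d := by
          apply mul_le_mul_of_nonneg_left (min_le_left _ _) (by positivity)
      _ ≤ (J * V) * d := by gcongr
      _ = (J * d) * V := by ring
      _ ≤ 1 * V := by gcongr; linarith
      _ = V := one_mul V
  · have hye : -(R * ρ / 4) ≤ inner ℝ (p - y) e := by
      have : p - y = (p - x) - d • e := by rw [hde]; abel
      rw [this, inner_sub_left, inner_smul_left, real_inner_self_eq_norm_sq, he1]
      simp; linarith
    obtain ⟨w, hw1, hwe, hwb⟩ := h.exists_direction hR hy he1 hye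
    set q := y + (1 - c) • w with hq
    have hqx : 1 + c ≤ dist q x := by
      rw [dist_eq_norm]
      have : q - x = (1 - c) • w + d • e := by rw [hq, hde]; abel
      rw [this]
      apply le_of_sq_le_sq _ (norm_nonneg _)
      rw [norm_sq _ _ _ hw1]
      have k1 : 0 ≤ (1 - c) * d * inner ℝ w e := by
        apply mul_nonneg (mul_nonneg (by linarith) hxy.le) (by linarith)
      nlinarith
    have hqy : dist q y = 1 - c := by
      rw [dist_eq_norm, hq, add_sub_cancel_left, norm_smul, hw1,
        Real.norm_of_nonneg (by linarith), mul_one]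
    have hsub : ball q c ⊆ (closedBall y 1 \ closedBall x 1) ∩ Ω := by
      intro z hz
      rw [mem_ball] at hz
      refine ⟨⟨?_, ?_⟩, ?_⟩
      · rw [mem_closedBall]; linarith [dist_triangle z q y]
      · rw [mem_closedBall]; intro hcon
        rw [dist_comm] at hz
        linarith [dist_triangle q z x]
      · apply hwb (1 - c) (by linarith) (by linarith)
        rw [mem_closedBall]; nlinarith
    have := h.vol_mono hsub Set.inter_subset_right
    have hv : volume.real (ball q c) = c ^ 3 * β := by
      rw [← vol_closedBall q hc0.le, measureReal_def, measureReal_def,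
        Measure.addHaar_closedBall_eq_addHaar_ball]
    rw [hv] at this
    refine le_trans ?_ this
    calc c ^ 3 * β * min d 1 ≤ c ^ 3 * β * 1 := by
          apply mul_le_mul_of_nonneg_left (min_le_right _ _) (by positivity)
      _ = _ := mul_one _

lemma vol_diff_ge (h : Body Ω p ρ D R) (hR : 8 ≤ R * ρ) {x y : E3} (hx : x ∈ Ω) (hy : y ∈ Ω)
    (hxy : 0 < dist x y) (hd : dist x y ≤ R * ρ / 4) :
    ((ρ / (4 * (D + 1))) ^ 2 / 16) ^ 3 * β * min (dist x y) 1 ≤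
      volume.real ((closedBall y 1 \ closedBall x 1) ∩ Ω) ∨
    ((ρ / (4 * (D + 1))) ^ 2 / 16) ^ 3 * β * min (dist x y) 1 ≤
      volume.real ((closedBall x 1 \ closedBall y 1) ∩ Ω) := by
  rcases le_total 0 (inner ℝ (p - x) (y - x)) with hs | hs
  · exact Or.inl (h.vol_diff_ge_aux hR hx hy hxy hd hs)
  · right
    have := h.vol_diff_ge_aux hR hy hx (by rwa [dist_comm]) (by rwa [dist_comm]) ?_
    · rwa [dist_comm]
    · have e : p - y = (p - x) - (y - x) := by abel
      have e2 : x - y = -(y - x) := by abel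
      rw [e, e2, inner_neg_right, inner_sub_left]
      have := real_inner_self_nonneg (x := y - x)
      linarith

end Body

end PairGeometry

section GapAndChords

/-- Points at distance between `2 * τ` and `1 - 2 * τ` from `A`. -/
def gap (A : Set E3) (τ : ℝ) : Set E3 := {q | 2 * τ < infDist q A ∧ infDist q A < 1 - 2 * τ}

lemma closedBall_subset_gap {A : Set E3} {z : E3} {c τ : ℝ} (hz : infDist z A = 1 / 2)
    (hc : c + 2 * τ < 1 / 2) : closedBall z c ⊆ gap A τ := by
  intro w hw
  rw [mem_closedBall] at hw
  have h1 := infDist_le_infDist_add_dist (s := A) (x := w) (y := z)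
  have h2 := infDist_le_infDist_add_dist (s := A) (x := z) (y := w)
  rw [dist_comm z w] at h2
  constructor <;> linarith

lemma exists_infDist_eq_half {A : Set E3} {γ : ℝ → E3} {a b : ℝ} (hab : a ≤ b)
    (hγ : ContinuousOn γ (Set.Icc a b)) (h0 : infDist (γ a) A ≤ 1 / 2)
    (h1 : 1 / 2 ≤ infDist (γ b) A) : ∃ t ∈ Set.Icc a b, infDist (γ t) A = 1 / 2 := by
  have hc : ContinuousOn (fun t => infDist (γ t) A) (Set.Icc a b) :=
    (continuous_infDist_pt A).comp_continuousOn hγ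
  exact intermediate_value_Icc hab hc ⟨h0, h1⟩

lemma exists_half_of_segment {Ω A : Set E3} (hΩ : Convex ℝ Ω) {x y : E3} {c : ℝ}
    (hx : closedBall x c ⊆ Ω) (hy : closedBall y c ⊆ Ω) (h0 : infDist x A ≤ 1 / 2)
    (h1 : 1 / 2 ≤ infDist y A) :
    ∃ t ∈ Set.Icc (0 : ℝ) 1, infDist (x + t • (y - x)) A = 1 / 2 ∧
      closedBall (x + t • (y - x)) c ⊆ Ω := by
  obtain ⟨t, ht, h⟩ := exists_infDist_eq_half (A := A) (γ := fun t => x + t • (y - x))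
    (a := 0) (b := 1) zero_le_one (by fun_prop) (by simpa using h0) (by simpa using h1)
  exact ⟨t, ht, h, hΩ.closedBall_segment_subset hx hy ht.1 ht.2⟩

lemma Convex.chord_of_mem_convexHull {Ω : Set E3} (hΩ : Convex ℝ Ω) {z : E3} {Kb : ℝ}
    (hKb : 0 < Kb) {Q : Set E3} (hQ : Q ⊆ Ω) (hQd : ∀ w ∈ Q, Kb ≤ ‖w - z‖) (hzΩ : z ∈ Ω)
    (hz : z ∈ convexHull ℝ Q) :
    ∃ u : E3, ‖u‖ = 1 ∧ z + (Kb / 3) • u ∈ Ω ∧ z - (Kb / 3) • u ∈ Ω := by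
  classical
  obtain ⟨ι, _, w, l, hw, haff, hl, hl1, hlz⟩ := eq_pos_convex_span_of_mem_convexHull hz
  have hcard : Fintype.card ι ≤ 4 := by
    refine haff.card_le_finrank_succ.trans ?_
    have := Submodule.finrank_le (vectorSpan ℝ (Set.range w))
    rw [finrank_euclideanSpace, Fintype.card_fin] at this
    omega
  obtain ⟨i, hi⟩ : ∃ i, 1 / 4 ≤ l i := by
    by_contra! hcon
    have hne : (Finset.univ : Finset ι).Nonempty := by
      rw [Finset.nonempty_iff_ne_empty]; intro h0; rw [h0] at hl1; simp at hl1
    have : ∑ i, l i < ∑ _i : ι, (1 / 4 : ℝ) := Finset.sum_lt_sum_of_nonempty hne fun i _ => hcon i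
    rw [hl1, Finset.sum_const, Finset.card_univ, nsmul_eq_mul] at this
    have h4 : (Fintype.card ι : ℝ) ≤ 4 := by exact_mod_cast hcard
    linarith
  have hwQ : ∀ j, w j ∈ Q := fun j => hw ⟨j, rfl⟩
  have hwi := hQd _ (hwQ i)
  have hpos : 0 < ‖w i - z‖ := by linarith
  have hsum : ∑ j ∈ Finset.univ.erase i, l j = 1 - l i := by
    rw [← hl1, ← Finset.add_sum_erase _ _ (Finset.mem_univ i)]; ring
  have hli : l i < 1 := by
    by_contra! hcon
    have h0 : ∑ j ∈ Finset.univ.erase i, l j ≤ 0 := by rw [hsum]; linarith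
    have hempty : Finset.univ.erase i = ∅ := by
      by_contra hne
      have := Finset.sum_pos (fun j _ => hl j) (Finset.nonempty_iff_ne_empty.2 hne)
      linarith
    have h1 : l i = 1 := by rw [hempty] at hsum; simp at hsum; linarith
    rw [← Finset.add_sum_erase _ _ (Finset.mem_univ i), hempty] at hlz
    simp [h1] at hlz
    rw [hlz] at hpos; simp at hpos
  have hopp : z - (l i / (1 - l i)) • (w i - z) ∈ Ω := by
    have h1 : ∑ j ∈ Finset.univ.erase i, (l j / (1 - l i)) • w j ∈ Ω := by
      apply hΩ.sum_mem
      · intro j _; exact div_nonneg (hl j).le (by linarith)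
      · rw [← Finset.sum_div, hsum, div_self (by linarith)]
      · intro j _; exact hQ (hwQ j)
    have h2 : ∑ j ∈ Finset.univ.erase i, (l j / (1 - l i)) • w j =
        (1 - l i)⁻¹ • (z - l i • w i) := by
      rw [← hlz, ← Finset.add_sum_erase _ _ (Finset.mem_univ i), add_sub_cancel_left,
        Finset.smul_sum]
      refine Finset.sum_congr rfl fun j _ => ?_
      rw [smul_smul, div_eq_inv_mul]
    rw [h2] at h1
    convert h1 using 1
    have h3 : (1 - l i) ≠ 0 := by linarith
    have e1 : z - l i • w i = (1 - l i) • z - l i • (w i - z) := by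
      rw [sub_smul, smul_sub, one_smul]; abel
    rw [e1, smul_sub (1 - l i)⁻¹, smul_smul, inv_mul_cancel₀ h3, one_smul, smul_smul, div_eq_inv_mul]
  refine ⟨‖w i - z‖⁻¹ • (w i - z), ?_, ?_, ?_⟩
  · rw [norm_smul, norm_inv, norm_norm, inv_mul_cancel₀ hpos.ne']
  · have := hΩ.add_smul_sub_mem hzΩ (hQ (hwQ i)) (t := Kb / 3 * ‖w i - z‖⁻¹) ⟨by positivity, by
      rw [← div_eq_mul_inv, div_le_one hpos]; linarith⟩
    rwa [← smul_smul] at this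
  · have hratio : 1 / 3 ≤ l i / (1 - l i) := by
      rw [le_div_iff₀ (by linarith)]; linarith
    have hr0 : 0 < l i / (1 - l i) := by linarith
    have := hΩ.add_smul_sub_mem hzΩ hopp
      (t := Kb / 3 * ‖w i - z‖⁻¹ * (l i / (1 - l i))⁻¹) ⟨by positivity, by
        rw [← div_eq_mul_inv, ← div_eq_mul_inv, div_le_one hr0, div_le_iff₀ hpos]
        nlinarith⟩
    convert this using 1
    rw [sub_sub_cancel_left, smul_neg, smul_smul, smul_smul, ← sub_eq_add_neg,
      mul_assoc _ _ (l i / (1 - l i)), inv_mul_cancel₀ hr0.ne', mul_one]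

lemma Body.chord_or_vertex {Ω : Set E3} {p : E3} {ρ D R : ℝ} (h : Body Ω p ρ D R) {z : E3}
    (hz : closedBall z ρ ⊆ Ω) {K₁ : ℝ} (hK₁ : 0 < K₁) {N : Set E3}
    (hN : ∀ u : E3, ‖u‖ = 1 → ∃ v ∈ N, ‖v - u‖ ≤ ρ / (2 * (3 * K₁ + 2 * ρ))) {pt : E3 → E3}
    (hpt : ∀ v ∈ N, pt v ∈ Ω) (hmax : ∀ v ∈ N, ∀ q ∈ Ω, inner ℝ q v ≤ inner ℝ (pt v) v) :
    (∃ u : E3, ‖u‖ = 1 ∧ z + K₁ • u ∈ Ω ∧ z - K₁ • u ∈ Ω) ∨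
      ∃ v ∈ N, dist (pt v) z ≤ 3 * K₁ + 3 * ρ := by
  have hρ := h.ρ_pos
  have hzΩ : z ∈ Ω := hz (mem_closedBall_self hρ.le)
  set Q : Set E3 := interior Ω ∩ {w | 3 * K₁ < ‖w - z‖} with hQdef
  have hQo : IsOpen Q := isOpen_interior.inter (isOpen_lt continuous_const (by fun_prop))
  by_cases hconv : z ∈ convexHull ℝ Q
  · left
    have := h.conv.chord_of_mem_convexHull (Kb := 3 * K₁) (by positivity)
      (fun w hw => interior_subset hw.1) (fun w hw => le_of_lt hw.2) hzΩ hconv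
    simpa using this
  · right
    obtain ⟨f, hf⟩ := geometric_hahn_banach_point_open (convex_convexHull ℝ Q) hQo.convexHull hconv
    set g : E3 := -(InnerProductSpace.toDual ℝ E3).symm f with hg
    have hgf : ∀ x, inner ℝ x g = - f x := fun x => by
      rw [hg, inner_neg_right, real_inner_comm, InnerProductSpace.toDual_symm_apply]
    by_cases hg0 : g = 0
    · -- then `Q` is empty and `Ω` is contained in a ball
      have hf0 : ∀ x, f x = 0 := fun x => by have := hgf x; rw [hg0] at this; simp at this; exact this
      have hQe : ∀ w ∈ interior Ω, ‖w - z‖ ≤ 3 * K₁ := by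
        intro w hw
        by_contra! hcon
        have := hf w (subset_convexHull ℝ Q ⟨hw, hcon⟩)
        rw [hf0, hf0] at this; exact lt_irrefl _ this
      obtain ⟨e, he⟩ : ∃ e : E3, ‖e‖ = 1 := ⟨EuclideanSpace.single 0 1, by simp⟩
      obtain ⟨v, hv, -⟩ := hN e he
      refine ⟨v, hv, ?_⟩
      by_contra! hcon
      have hd : 0 < dist (pt v) z := by linarith
      -- move slightly towards `z`
      set t : ℝ := ρ / dist (pt v) z with ht
      have ht0 : 0 < t := by positivity
      have ht1 : t ≤ 1 := by rw [ht, div_le_one hd]; linarith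
      have hb := h.conv.closedBall_lineMap_subset (hpt v hv) hz ht0.le ht1
      have hint : pt v + t • (z - pt v) ∈ interior Ω :=
        mem_interior.2 ⟨ball _ (t * ρ), ball_subset_closedBall.trans hb, isOpen_ball,
          mem_ball_self (by positivity)⟩
      have h1 := hQe _ hint
      have e1 : pt v + t • (z - pt v) - z = (1 - t) • (pt v - z) := by module
      rw [e1, norm_smul, Real.norm_of_nonneg (by linarith), ← dist_eq_norm, ht, sub_mul, one_mul,
        div_mul_cancel₀ _ hd.ne'] at h1
      linarith
    have hgn : 0 < ‖g‖ := norm_pos_iff.2 hg0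
    -- closed version of the separation
    have hsep : ∀ q ∈ Ω, 3 * K₁ < ‖q - z‖ → inner ℝ (q - z) g ≤ 0 := by
      intro q hq hqz
      by_contra! hcon
      set t : ℝ := (1 - 3 * K₁ / ‖q - z‖) / 2 with ht
      have hqp : 0 < ‖q - z‖ := by linarith
      have hlt : 3 * K₁ / ‖q - z‖ < 1 := (div_lt_one hqp).2 hqz
      have hge : 0 < 3 * K₁ / ‖q - z‖ := by positivity
      have ht0 : 0 < t := by linarith
      have ht1 : t < 1 := by linarith
      have hb := h.conv.closedBall_lineMap_subset hq hz ht0.le ht1.le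
      have hint : q + t • (z - q) ∈ interior Ω :=
        mem_interior.2 ⟨ball _ (t * ρ), ball_subset_closedBall.trans hb, isOpen_ball,
          mem_ball_self (by positivity)⟩
      have e1 : q + t • (z - q) - z = (1 - t) • (q - z) := by module
      have hfar : 3 * K₁ < ‖q + t • (z - q) - z‖ := by
        rw [e1, norm_smul, Real.norm_of_nonneg (by linarith)]
        have : 3 * K₁ / ‖q - z‖ < 1 - t := by linarith
        rwa [div_lt_iff₀ hqp] at this
      have := hf _ (subset_convexHull ℝ Q ⟨hint, hfar⟩)
      have h2 : inner ℝ (q + t • (z - q) - z) g < 0 := by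
        rw [hgf, map_sub]; linarith
      rw [e1, inner_smul_left] at h2
      have : 0 < (1 - t) * inner ℝ (q - z) g := mul_pos (by linarith) hcon
      simp at h2
      linarith
    set n : E3 := ‖g‖⁻¹ • g with hn
    have hn1 : ‖n‖ = 1 := by rw [hn, norm_smul, norm_inv, norm_norm, inv_mul_cancel₀ hgn.ne']
    have hsep' : ∀ q ∈ Ω, 3 * K₁ < ‖q - z‖ → inner ℝ (q - z) n ≤ 0 := by
      intro q hq hqz
      rw [hn, inner_smul_right]
      exact mul_nonpos_of_nonneg_of_nonpos (by positivity) (hsep q hq hqz)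
    obtain ⟨v, hv, hvn⟩ := hN n hn1
    refine ⟨v, hv, ?_⟩
    by_contra! hcon
    set zp : E3 := z + ρ • n with hzp
    have hzpz : ‖zp - z‖ = ρ := by
      rw [hzp, add_sub_cancel_left, norm_smul, hn1, mul_one, Real.norm_of_nonneg hρ.le]
    have hzpΩ : zp ∈ Ω := hz (by rw [mem_closedBall, dist_eq_norm, hzpz])
    set q := pt v
    have hqzp : 3 * K₁ + 2 * ρ < ‖q - zp‖ := by
      rw [dist_eq_norm] at hcon
      have : q - z = (q - zp) + (zp - z) := by abel
      have := norm_add_le (q - zp) (zp - z)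
      rw [sub_add_sub_cancel, hzpz] at this
      linarith
    set s : ℝ := (3 * K₁ + 2 * ρ) / ‖q - zp‖ with hs
    have hq0 : 0 < ‖q - zp‖ := by linarith
    have hs0 : 0 < s := by positivity
    have hs1 : s ≤ 1 := by rw [hs, div_le_one hq0]; exact hqzp.le
    have hwΩ : zp + s • (q - zp) ∈ Ω := h.conv.add_smul_sub_mem hzpΩ (hpt v hv) ⟨hs0.le, hs1⟩
    have hwn : ‖s • (q - zp)‖ = 3 * K₁ + 2 * ρ := by
      rw [norm_smul, Real.norm_of_nonneg hs0.le, hs, div_mul_cancel₀ _ hq0.ne']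
    have hwz : 3 * K₁ < ‖zp + s • (q - zp) - z‖ := by
      have := norm_sub_norm_le (s • (q - zp)) (z - zp)
      rw [hwn, ← norm_neg (z - zp), neg_sub, hzpz] at this
      have e : zp + s • (q - zp) - z = s • (q - zp) - (z - zp) := by abel
      rw [e]; linarith
    have h1 := hsep' _ hwΩ hwz
    have e : zp + s • (q - zp) - z = s • (q - zp) + ρ • n := by rw [hzp]; abel
    rw [e, inner_add_left, inner_smul_left, inner_smul_left, real_inner_self_eq_norm_sq, hn1] at h1
    simp only [conj_trivial, one_pow, mul_one] at h1
    -- contradiction with maximality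
    have hm := hmax v hv zp hzpΩ
    have h2 : inner ℝ (q - zp) (v - n) ≤ ‖q - zp‖ * (ρ / (2 * (3 * K₁ + 2 * ρ))) :=
      (real_inner_le_norm _ _).trans (mul_le_mul_of_nonneg_left hvn (norm_nonneg _))
    rw [inner_sub_right] at h2
    have h3 : 0 ≤ inner ℝ (q - zp) v := by rw [inner_sub_left]; linarith
    have h4 : s * ‖q - zp‖ = 3 * K₁ + 2 * ρ := by rw [hs, div_mul_cancel₀ _ hq0.ne']
    have h5 : s * inner ℝ (q - zp) n ≥ s * (inner ℝ (q - zp) v -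
        ‖q - zp‖ * (ρ / (2 * (3 * K₁ + 2 * ρ)))) := mul_le_mul_of_nonneg_left (by linarith) hs0.le
    have h6 : s * (‖q - zp‖ * (ρ / (2 * (3 * K₁ + 2 * ρ)))) = ρ / 2 := by
      rw [← mul_assoc, h4]; field_simp
    have h7 : 0 ≤ s * inner ℝ (q - zp) v := mul_nonneg hs0.le h3
    rw [mul_sub, h6] at h5
    linarith

end GapAndChords

section HalfGaps

lemma abs_inner_unit_le {u : E3} (hu : ‖u‖ = 1) (v : E3) : |inner ℝ u v| ≤ ‖v‖ := by
  have := abs_real_inner_le_norm u v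
  rwa [hu, one_mul] at this

lemma Convex.slide {Ω : Set E3} (hΩ : Convex ℝ Ω) {z u : E3} {K₁ K₂ s : ℝ}
    (hp : z + K₁ • u ∈ Ω) (hm : z - K₁ • u ∈ Ω) (hK : 2 * K₂ ≤ s * K₁) (hK₁ : 0 < K₁)
    (hs0 : 0 < s) (hs1 : s ≤ 1) {q : E3} (hq : q ∈ Ω) (hqz : |inner ℝ u (q - z)| ≤ K₂) {t : ℝ}
    (ht : |inner ℝ u ((1 - s) • q + s • z - z) + t| ≤ K₂) :
    (1 - s) • q + s • z + t • u ∈ Ω := by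
  have e : (1 - s) • q + s • z - z = (1 - s) • (q - z) := by module
  rw [e, inner_smul_right] at ht
  have htK : |t| ≤ s * K₁ := by
    rw [abs_le] at ht hqz ⊢
    constructor <;> nlinarith
  have h1 : z + (t / s) • u ∈ Ω := by
    set r : ℝ := (t / s + K₁) / (2 * K₁) with hr
    have hts : |t / s| ≤ K₁ := by
      rw [abs_div, abs_of_pos hs0, div_le_iff₀ hs0]; linarith
    rw [abs_le] at hts
    have hr0 : 0 ≤ r := div_nonneg (by linarith) (by linarith)
    have hr1 : r ≤ 1 := by rw [hr, div_le_one (by linarith)]; linarith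
    have := hΩ hm hp (a := 1 - r) (b := r) (by linarith) hr0 (by ring)
    convert this using 1
    have : t / s = (2 * r - 1) * K₁ := by rw [hr]; field_simp; ring
    rw [this]; module
  have h2 := hΩ hq h1 (a := 1 - s) (b := s) (by linarith) hs0.le (by ring)
  convert h2 using 1
  rw [smul_add, smul_smul, mul_div_cancel₀ _ hs0.ne', add_assoc]

lemma reflection_apply_unit {u : E3} (hu : ‖u‖ = 1) (v : E3) :
    (ℝ ∙ u)ᗮ.reflection v = v - (2 * inner ℝ u v) • u := by
  rw [Submodule.reflection_orthogonal_apply, Submodule.reflection_singleton_apply, hu]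
  simp only [RCLike.ofReal_real_eq_id, id_eq, one_pow, div_one]
  module

lemma vol_half_gap_ge {Ω : Set E3} {p : E3} {ρ D R : ℝ} (h : Body Ω p ρ D R) {A : Set E3}
    {z u : E3} (hu : ‖u‖ = 1) {K K₁ s lam κ τ : ℝ}
    (hp : z + K₁ • u ∈ Ω) (hm : z - K₁ • u ∈ Ω)
    (hK₁ : 0 < K₁) (hKK : 2 * (K + 2) ≤ s * K₁) (hs0 : 0 < s) (hs1 : s ≤ 1) (hτ : 0 < τ)
    (hκ : 0 ≤ κ) (hκ1 : κ ≤ 1 / 2) (hlam : s * (K + 1) + κ + 5 * τ < lam) (hlam1 : lam ≤ 1)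
    (hAz : ∀ a ∈ A, dist a z ≤ K) {x b : E3} (hx : x ∈ A) (hb : b ∈ A)
    (hmin : ∀ a ∈ A, inner ℝ u x ≤ inner ℝ u a) (hbx : 12 * (inner ℝ u (b - x)) ≤ κ ^ 2) :
    volume.real ((closedBall x 1 ∪ closedBall b 1) ∩ Ω) / 2 - 3 * β * (lam + s) ≤
      volume.real ({q | inner ℝ u q < inner ℝ u x} ∩ gap A τ ∩ Ω) := by
  have hβ := β_pos
  have hK0 : 0 ≤ K := dist_nonneg.trans (hAz x hx)
  set σ := s * (K + 1) with hσ
  have hσ0 : 0 ≤ σ := by positivity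
  set T : Set E3 := {q | inner ℝ u q < inner ℝ u x} ∩ gap A τ ∩ Ω with hT
  set g : E3 → E3 := fun q => (1 - s) • q + s • z with hg
  set S : Set E3 := (closedBall x (1 - lam) ∪ closedBall b (1 - lam)) ∩ Ω with hS
  have hAne : A.Nonempty := ⟨x, hx⟩
  have hb0 : 0 ≤ inner ℝ u (b - x) := by rw [inner_sub_right]; linarith [hmin b hb]
  have hb1 : inner ℝ u (b - x) ≤ 1 := by nlinarith
  -- criterion for membership in the target
  have hcrit : ∀ w : E3, w ∈ Ω → inner ℝ u w ≤ inner ℝ u x - 3 * τ →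
      (∃ c ∈ A, dist w c < 1 - 2 * τ) → w ∈ T := by
    rintro w hwΩ hwu ⟨c, hc, hwc⟩
    refine ⟨⟨?_, ?_, ?_⟩, hwΩ⟩
    · change inner ℝ u w < inner ℝ u x; linarith
    · refine lt_of_lt_of_le (by linarith : 2 * τ < 3 * τ) ((le_infDist hAne).2 fun a ha => ?_)
      have h1 := abs_inner_unit_le hu (a - w)
      have h2 := le_abs_self (inner ℝ u (a - w))
      rw [inner_sub_right] at h1 h2
      rw [dist_comm, dist_eq_norm]
      linarith [hmin a ha]
    · exact (infDist_le_dist_of_mem hc).trans_lt hwc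
  -- points of the source
  have hsrc : ∀ q ∈ S, q ∈ Ω ∧ ‖q - z‖ ≤ K + 1 ∧ ∃ c ∈ A, (c = x ∨ c = b) ∧
      ‖g q - c‖ ≤ 1 - lam + σ := by
    rintro q ⟨hq, hqΩ⟩
    have aux : ∀ c ∈ A, q ∈ closedBall c (1 - lam) → ‖q - z‖ ≤ K + 1 ∧
        ‖g q - c‖ ≤ 1 - lam + σ := by
      intro c hc hqc
      rw [mem_closedBall, dist_eq_norm] at hqc
      have h1 := hAz c hc
      rw [dist_eq_norm] at h1
      have h2 : ‖q - z‖ ≤ K + 1 := by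
        have := norm_sub_le_norm_sub_add_norm_sub q c z
        linarith
      refine ⟨h2, ?_⟩
      have e : g q - c = (q - c) - s • (q - z) := by simp only [hg]; module
      rw [e]
      refine (norm_sub_le _ _).trans ?_
      rw [norm_smul, Real.norm_of_nonneg hs0.le]
      have := mul_le_mul_of_nonneg_left h2 hs0.le
      linarith
    rcases hq with hq | hq
    · exact ⟨hqΩ, (aux x hx hq).1, x, hx, Or.inl rfl, (aux x hx hq).2⟩
    · exact ⟨hqΩ, (aux b hb hq).1, b, hb, Or.inr rfl, (aux b hb hq).2⟩
  have hmemΩ : ∀ q ∈ S, ∀ t : ℝ, (∃ c ∈ A, ‖g q + t • u - c‖ ≤ 2) → g q + t • u ∈ Ω := by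
    rintro q hq t ⟨c, hc, hct⟩
    obtain ⟨hqΩ, hqz, -⟩ := hsrc q hq
    refine h.conv.slide hp hm hKK hK₁ hs0 hs1 hqΩ
      ((abs_inner_unit_le hu _).trans (hqz.trans (by linarith))) ?_
    have e : inner ℝ u ((1 - s) • q + s • z - z) + t = inner ℝ u (g q + t • u - z) := by
      have : g q + t • u - z = ((1 - s) • q + s • z - z) + t • u := by simp only [hg]; abel
      rw [this, inner_add_right, inner_smul_right, real_inner_self_eq_norm_sq, hu]; ring
    rw [e]
    refine (abs_inner_unit_le hu _).trans ?_
    have h1 := hAz c hc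
    rw [dist_eq_norm] at h1
    have := norm_sub_le_norm_sub_add_norm_sub (g q + t • u) c z
    linarith
  set SL := S ∩ {q | inner ℝ u (g q) ≤ inner ℝ u x} with hSL
  set SR := S ∩ {q | inner ℝ u x < inner ℝ u (g q)} with hSR
  have hleft : (fun q => LinearIsometryEquiv.refl ℝ E3 ((1 - s) • q + s • z) + (-(3 * τ)) • u) '' SL
      ⊆ T := by
    rintro _ ⟨q, ⟨hq, hqu⟩, rfl⟩
    obtain ⟨hqΩ, hqz, c, hc, -, hgc⟩ := hsrc q hq
    change g q + (-(3 * τ)) • u ∈ T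
    have hd : ‖g q + (-(3 * τ)) • u - c‖ ≤ 1 - lam + σ + 3 * τ := by
      have e : g q + (-(3 * τ)) • u - c = (g q - c) + (-(3 * τ)) • u := by abel
      rw [e]
      refine (norm_add_le _ _).trans ?_
      rw [norm_smul, hu, Real.norm_eq_abs, abs_neg, abs_of_pos (by linarith)]
      linarith
    refine hcrit _ (hmemΩ q hq _ ⟨c, hc, by linarith⟩) ?_ ⟨c, hc, ?_⟩
    · rw [inner_add_right, inner_smul_right, real_inner_self_eq_norm_sq, hu]
      have : inner ℝ u (g q) ≤ inner ℝ u x := hqu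
      linarith
    · rw [dist_eq_norm]; linarith
  have hright : (fun q => (ℝ ∙ u)ᗮ.reflection ((1 - s) • q + s • z) +
      (2 * inner ℝ u x - 3 * τ) • u) '' SR ⊆ T := by
    rintro _ ⟨q, ⟨hq, hqu⟩, rfl⟩
    obtain ⟨hqΩ, hqz, c, hc, hcxb, hgc⟩ := hsrc q hq
    have hqu' : inner ℝ u x < inner ℝ u (g q) := hqu
    have e : (ℝ ∙ u)ᗮ.reflection ((1 - s) • q + s • z) + (2 * inner ℝ u x - 3 * τ) • u =
        g q + (-(2 * inner ℝ u (g q - x)) - 3 * τ) • u := by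
      rw [reflection_apply_unit hu, inner_sub_right]
      simp only [hg]; module
    simp only [e]
    set α := inner ℝ u (g q - x) with hα
    have hα0 : 0 < α := by rw [hα, inner_sub_right]; linarith
    have hcx0 : 0 ≤ inner ℝ u (c - x) := by
      rcases hcxb with rfl | rfl
      · simp
      · exact hb0
    have hcx : 12 * inner ℝ u (c - x) ≤ κ ^ 2 := by
      rcases hcxb with rfl | rfl
      · simp; positivity
      · exact hbx
    have hα3 : α ≤ 3 := by
      have e1 : α = inner ℝ u (g q - c) + inner ℝ u (c - x) := by
        rw [hα, ← inner_add_right, sub_add_sub_cancel]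
      have := (le_abs_self _).trans (abs_inner_unit_le hu (g q - c))
      nlinarith
    have href : ‖g q - c + (-(2 * α)) • u‖ ≤ 1 - lam + σ + κ := by
      apply le_of_sq_le_sq _ (by linarith)
      rw [norm_add_sq_real, norm_smul, hu, inner_smul_right, real_inner_comm]
      have e1 : inner ℝ u (g q - c) = α - inner ℝ u (c - x) := by
        rw [hα, ← inner_sub_right]; congr 1; abel
      rw [e1, mul_one, Real.norm_eq_abs, sq_abs]
      have h1 : ‖g q - c‖ ^ 2 ≤ (1 - lam + σ) ^ 2 := by
        apply pow_le_pow_left₀ (norm_nonneg _) hgc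
      have h2 : α * inner ℝ u (c - x) ≤ 3 * inner ℝ u (c - x) :=
        mul_le_mul_of_nonneg_right hα3 hcx0
      have h3 : 0 ≤ (1 - lam + σ) * κ := mul_nonneg (by linarith) hκ
      nlinarith
    have hd : ‖g q + (-(2 * α) - 3 * τ) • u - c‖ ≤ 1 - lam + σ + κ + 3 * τ := by
      have e : g q + (-(2 * α) - 3 * τ) • u - c = (g q - c + (-(2 * α)) • u) + (-(3 * τ)) • u := by
        module
      rw [e]
      refine (norm_add_le _ _).trans ?_
      rw [norm_smul, hu, Real.norm_eq_abs, abs_neg, abs_of_pos (by linarith : 0 < 3 * τ)]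
      linarith
    refine hcrit _ (hmemΩ q hq _ ⟨c, hc, by linarith⟩) ?_ ⟨c, hc, ?_⟩
    · rw [inner_add_right, inner_smul_right, real_inner_self_eq_norm_sq, hu]
      have : α = inner ℝ u (g q) - inner ℝ u x := by rw [hα, inner_sub_right]
      linarith
    · rw [dist_eq_norm]; linarith
  have hTΩ : T ⊆ Ω := Set.inter_subset_right
  have hvL := h.vol_mono hleft hTΩ
  have hvR := h.vol_mono hright hTΩ
  rw [vol_image_simil _ s hs1] at hvL hvR
  have hSΩ : S ⊆ Ω := Set.inter_subset_right
  have hsplit : volume.real S ≤ volume.real SL + volume.real SR := by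
    have : S ⊆ SL ∪ SR := by
      intro q hq
      rcases le_or_gt (inner ℝ u (g q)) (inner ℝ u x) with h1 | h1
      · exact Or.inl ⟨hq, h1⟩
      · exact Or.inr ⟨hq, h1⟩
    refine (h.vol_mono this ?_).trans (measureReal_union_le _ _)
    exact Set.union_subset (Set.inter_subset_left.trans hSΩ) (Set.inter_subset_left.trans hSΩ)
  -- loss of volume from shrinking the balls
  set V0 := volume.real ((closedBall x 1 ∪ closedBall b 1) ∩ Ω) with hV0
  have hshell : ∀ c : E3, volume.real (closedBall c 1 \ closedBall c (1 - lam)) ≤ 3 * β * lam := by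
    intro c
    have hlam0 : 0 ≤ lam := by linarith
    rw [measureReal_sdiff (closedBall_subset_closedBall (by linarith)) measurableSet_closedBall
      measure_closedBall_lt_top.ne, vol_closedBall _ zero_le_one,
      vol_closedBall _ (by linarith)]
    have : 1 - (1 - lam) ^ 3 ≤ 3 * lam := by nlinarith [mul_nonneg hlam0 hlam0]
    nlinarith
  have hSV : V0 ≤ volume.real S + 6 * β * lam := by
    have hsub : (closedBall x 1 ∪ closedBall b 1) ∩ Ω ⊆ S ∪
        ((closedBall x 1 \ closedBall x (1 - lam)) ∪ (closedBall b 1 \ closedBall b (1 - lam))) := by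
      rintro q ⟨hq, hqΩ⟩
      by_cases hqS : q ∈ S
      · exact Or.inl hqS
      · right
        rcases hq with hq | hq
        · exact Or.inl ⟨hq, fun hc => hqS ⟨Or.inl hc, hqΩ⟩⟩
        · exact Or.inr ⟨hq, fun hc => hqS ⟨Or.inr hc, hqΩ⟩⟩
    have hfin : ∀ c : E3, volume (closedBall c 1 \ closedBall c (1 - lam)) ≠ ⊤ := fun c =>
      ((measure_mono Set.sdiff_subset).trans_lt measure_closedBall_lt_top).ne
    refine (measureReal_mono hsub ?_).trans ?_
    · exact measure_union_ne_top (h.vol_ne_top hSΩ) (measure_union_ne_top (hfin _) (hfin _))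
    · refine (measureReal_union_le _ _).trans ?_
      have := measureReal_union_le (μ := volume) (closedBall x 1 \ closedBall x (1 - lam))
        (closedBall b 1 \ closedBall b (1 - lam))
      linarith [hshell x, hshell b]
  have hV02 : V0 ≤ 2 * β := by
    refine (measureReal_mono (Set.inter_subset_left) ?_).trans ?_
    · exact measure_union_ne_top measure_closedBall_lt_top.ne measure_closedBall_lt_top.ne
    · refine (measureReal_union_le _ _).trans ?_
      rw [vol_closedBall _ zero_le_one, vol_closedBall _ zero_le_one]; linarith
  have hcube : 1 - 3 * s ≤ (1 - s) ^ 3 := by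
    nlinarith [mul_nonneg hs0.le hs0.le, mul_nonneg (mul_nonneg hs0.le hs0.le) (sub_nonneg.2 hs1)]
  have hcube0 : 0 ≤ (1 - s) ^ 3 := pow_nonneg (by linarith) _
  have hcube1 : (1 - s) ^ 3 ≤ 1 := pow_le_one₀ (by linarith) (by linarith)
  have hT2 : (1 - s) ^ 3 * volume.real S ≤ 2 * volume.real T := by
    have := mul_le_mul_of_nonneg_left hsplit hcube0
    linarith
  have hS0 : 0 ≤ volume.real S := measureReal_nonneg
  have hSV0 : volume.real S ≤ V0 := by
    apply h.vol_mono _ Set.inter_subset_right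
    apply Set.inter_subset_inter_left
    exact Set.union_subset_union (closedBall_subset_closedBall (by linarith))
      (closedBall_subset_closedBall (by linarith))
  have h1 : (1 - 3 * s) * volume.real S ≤ 2 * volume.real T :=
    (mul_le_mul_of_nonneg_right hcube hS0).trans hT2
  have h2 : s * volume.real S ≤ s * (2 * β) := mul_le_mul_of_nonneg_left (hSV0.trans hV02) hs0.le
  linarith

end HalfGaps

section SlabBall

lemma exists_unit_orthogonal (u : E3) (v : E3) :
    ∃ w : E3, ‖w‖ = 1 ∧ inner ℝ u w = 0 ∧ 0 ≤ inner ℝ w v := by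
  have h1 : 0 < Module.finrank ℝ (ℝ ∙ u)ᗮ := by
    have h2 := Submodule.finrank_add_finrank_orthogonal (ℝ ∙ u)
    have h3 : Module.finrank ℝ (ℝ ∙ u) ≤ 1 := (finrank_span_le_card ({u} : Set E3)).trans (by simp)
    rw [finrank_euclideanSpace, Fintype.card_fin] at h2
    omega
  have : Nontrivial (ℝ ∙ u)ᗮ := Module.finrank_pos_iff.1 h1
  obtain ⟨w, hw⟩ := exists_norm_eq (ℝ ∙ u)ᗮ (zero_le_one (α := ℝ))
  have hw0 : inner ℝ u (w : E3) = 0 := Submodule.mem_orthogonal_singleton_iff_inner_right.1 w.2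
  rcases le_total 0 (inner ℝ (w : E3) v) with h | h
  · exact ⟨w, hw, hw0, h⟩
  · exact ⟨-w, by rwa [norm_neg], by rw [inner_neg_right, hw0, neg_zero],
      by rw [inner_neg_left]; linarith⟩

lemma exists_ball_in_slab {Ω : Set E3} {p : E3} {ρ D R : ℝ} (h : Body Ω p ρ D R) {A : Set E3}
    {z u : E3} (hu : ‖u‖ = 1) {K K' K₁ s η τ : ℝ}
    (hp : z + K₁ • u ∈ Ω) (hm : z - K₁ • u ∈ Ω) (hK₁ : 0 < K₁) (hs0 : 0 < s)
    (hs1 : s * ((2 * K' + 2) / ρ * D + K + 1) ≤ 1 / 16)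
    (hKK : 2 * ((2 * K' + 2) / ρ * D + K + 3) ≤ s * K₁) (hR : (2 * K' + 2) / ρ ≤ R)
    (hη0 : 0 < η) (hη : η ≤ 1 / 4) (hτ : τ ≤ 1 / 16) {x : E3} (hxA : x ∈ A) (hxΩ : x ∈ Ω)
    (hAx : ∀ a ∈ A, dist a x ≤ K') (hxz : dist x z ≤ K) :
    ∃ q : E3, closedBall q (min (ρ / (128 * D)) (η / 4)) ⊆
      {q | inner ℝ u x < inner ℝ u q ∧ inner ℝ u q < inner ℝ u x + η} ∩ gap A τ ∩ Ω := by
  have hD := h.D_ge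
  have hρ := h.ρ_pos
  have hρ1 := h.ρ_le
  have hRp := h.R_pos
  have hK0 : 0 ≤ K := dist_nonneg.trans hxz
  have hK'0 : 0 ≤ K' := dist_nonneg.trans (hAx x hxA)
  set K₃ := (2 * K' + 2) / ρ with hK₃
  have hK₃ρ : K₃ * ρ = 2 * K' + 2 := by rw [hK₃]; field_simp
  have hK₃2 : 2 ≤ K₃ := by
    rw [hK₃, le_div_iff₀ hρ]; linarith
  have hK₃D : 2 ≤ K₃ * D := by nlinarith
  have hs12 : s ≤ 1 / 16 := by
    have : s * 1 ≤ s * (K₃ * D + K + 1) := mul_le_mul_of_nonneg_left (by linarith) hs0.le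
    linarith
  obtain ⟨w, hw, huw, hwx⟩ := exists_unit_orthogonal u (p - x)
  have hwu : inner ℝ w u = 0 := by rw [real_inner_comm]; exact huw
  set p' : E3 := p + (R * ρ / 2) • w with hp'
  have hp'b : closedBall p' (R * ρ / 2) ⊆ Ω := by
    refine subset_trans (closedBall_subset_closedBall' ?_) h.ball_subset
    rw [hp', dist_eq_norm, add_sub_cancel_left, norm_smul, hw,
      Real.norm_of_nonneg (by positivity)]
    linarith
  have hp'w : R * ρ / 2 ≤ inner ℝ w (p' - x) := by
    have : p' - x = (p - x) + (R * ρ / 2) • w := by rw [hp']; abel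
    rw [this, inner_add_right, inner_smul_right, real_inner_self_eq_norm_sq, hw]; linarith
  have hp'x : dist p' x ≤ R * D :=
    h.dist_le p' (hp'b (mem_closedBall_self (by positivity))) x hxΩ
  set zx : ℝ → E3 := fun t => x + (t / R) • (p' - x) with hzx
  have hzxΩ : ∀ t, 0 ≤ t → t ≤ R → closedBall (zx t) (t * ρ / 2) ⊆ Ω := by
    intro t h0 h1
    have := h.conv.closedBall_lineMap_subset hxΩ hp'b (t := t / R) (by positivity)
      ((div_le_one hRp).2 h1)
    have e : t / R * (R * ρ / 2) = t * ρ / 2 := by field_simp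
    rwa [e] at this
  have hzxd : ∀ t, 0 ≤ t → ‖zx t - x‖ ≤ t * D := by
    intro t h0
    simp only [hzx]
    rw [add_sub_cancel_left, norm_smul, Real.norm_of_nonneg (by positivity), ← dist_eq_norm]
    calc t / R * dist p' x ≤ t / R * (R * D) := mul_le_mul_of_nonneg_left hp'x (by positivity)
      _ = t * D := by field_simp
  have hzxw : ∀ t, 0 ≤ t → t * ρ / 2 ≤ inner ℝ w (zx t - x) := by
    intro t h0
    simp only [hzx]
    rw [add_sub_cancel_left, inner_smul_right]
    calc t * ρ / 2 = t / R * (R * ρ / 2) := by field_simp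
      _ ≤ _ := mul_le_mul_of_nonneg_left hp'w (by positivity)
  set μ₀ := inner ℝ u x + η / 2 with hμ₀
  set g : ℝ → E3 := fun t => (1 - s) • zx t + s • z with hg
  set γ : ℝ → E3 := fun t => g t + (μ₀ - inner ℝ u (g t)) • u with hγ
  have hgz : ∀ t, 0 ≤ t → t ≤ K₃ → ‖g t - zx t‖ ≤ 1 / 16 := by
    intro t h0 h1
    have e : g t - zx t = s • ((z - x) - (zx t - x)) := by simp only [hg]; module
    rw [e, norm_smul, Real.norm_of_nonneg hs0.le]
    refine le_trans (mul_le_mul_of_nonneg_left ?_ hs0.le) hs1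
    have h2 := norm_sub_le (z - x) (zx t - x)
    have h3 := hzxd t h0
    have h4 : t * D ≤ K₃ * D := mul_le_mul_of_nonneg_right h1 (by linarith)
    rw [← dist_eq_norm z x, dist_comm] at h2
    linarith
  set t₀ : ℝ := 1 / (16 * D) with ht₀
  have ht₀D : t₀ * D = 1 / 16 := by rw [ht₀]; field_simp
  have ht₀0 : 0 < t₀ := by positivity
  have ht₀1 : t₀ ≤ K₃ := by
    have : t₀ ≤ t₀ * D := le_mul_of_one_le_right ht₀0.le hD
    linarith
  have hγc : Continuous γ := by
    have : Continuous g := by simp only [hg, hzx]; fun_prop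
    simp only [hγ]; fun_prop
  have hstart : infDist (γ t₀) A ≤ 1 / 2 := by
    refine (infDist_le_dist_of_mem hxA).trans ?_
    rw [dist_eq_norm]
    have h1 : ‖g t₀ - x‖ ≤ 1 / 8 := by
      have := norm_sub_le_norm_sub_add_norm_sub (g t₀) (zx t₀) x
      have := hgz t₀ ht₀0.le ht₀1
      have := hzxd t₀ ht₀0.le
      linarith
    have h2 := abs_inner_unit_le hu (g t₀ - x)
    rw [inner_sub_right, abs_le] at h2
    have e : γ t₀ - x = (g t₀ - x) + (μ₀ - inner ℝ u (g t₀)) • u := by simp only [hγ]; abel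
    rw [e]
    refine (norm_add_le _ _).trans ?_
    rw [norm_smul, hu, Real.norm_eq_abs, mul_one]
    have : |μ₀ - inner ℝ u (g t₀)| ≤ 1 / 4 := by
      rw [abs_le]; constructor <;> linarith
    linarith
  have hend : 1 / 2 ≤ infDist (γ K₃) A := by
    refine (le_infDist ⟨x, hxA⟩).2 fun a ha => ?_
    have h1 : inner ℝ w (γ K₃ - x) = inner ℝ w (g K₃ - zx K₃) + inner ℝ w (zx K₃ - x) := by
      have e : γ K₃ - x = (g K₃ - zx K₃) + (zx K₃ - x) + (μ₀ - inner ℝ u (g K₃)) • u := by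
        simp only [hγ]; abel
      rw [e, inner_add_right, inner_add_right, inner_smul_right, hwu]; ring
    have h2 := abs_inner_unit_le hw (g K₃ - zx K₃)
    have h3 := hgz K₃ (by linarith) le_rfl
    have h4 := hzxw K₃ (by linarith)
    have h5 := abs_inner_unit_le hw (γ K₃ - x)
    have h6 := le_abs_self (inner ℝ w (γ K₃ - x))
    rw [abs_le] at h2
    have h7 := dist_triangle (γ K₃) a x
    rw [dist_eq_norm (γ K₃) x] at h7
    have h8 := hAx a ha
    linarith
  obtain ⟨t, ⟨htl, hth⟩, ht⟩ := exists_infDist_eq_half (A := A) ht₀1 hγc.continuousOn hstart hend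
  have htp : 0 ≤ t := ht₀0.le.trans htl
  refine ⟨γ t, ?_⟩
  set c := min (ρ / (128 * D)) (η / 4) with hc
  have hc1 : c ≤ ρ / (128 * D) := min_le_left _ _
  have hc2 : c ≤ η / 4 := min_le_right _ _
  have hγu : inner ℝ u (γ t) = μ₀ := by
    simp only [hγ]
    rw [inner_add_right, inner_smul_right, real_inner_self_eq_norm_sq, hu]; ring
  have hc3 : ρ / (128 * D) = t₀ * ρ / 8 := by rw [ht₀]; field_simp; norm_num
  have hslab : ∀ q ∈ closedBall (γ t) c, |inner ℝ u q - μ₀| ≤ η / 4 := by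
    intro q hq
    rw [mem_closedBall, dist_eq_norm] at hq
    have := abs_inner_unit_le hu (q - γ t)
    rw [inner_sub_right, hγu] at this
    linarith
  refine Set.subset_inter (Set.subset_inter ?_ ?_) ?_
  · intro q hq
    have := hslab q hq
    rw [abs_le] at this
    constructor <;> linarith
  · exact closedBall_subset_gap ht (by linarith)
  · intro q hq
    have hqs := hslab q hq
    rw [mem_closedBall, dist_eq_norm] at hq
    have hs2 : 0 < 1 - s := by linarith
    set e := q - γ t with he
    set q' := zx t + (1 - s)⁻¹ • e with hq'
    have hq'n : ‖(1 - s)⁻¹ • e‖ ≤ t₀ * ρ / 2 := by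
      rw [norm_smul, norm_inv, Real.norm_of_nonneg hs2.le, inv_mul_le_iff₀ hs2]
      have : 0 < t₀ * ρ := by positivity
      nlinarith
    have hq'Ω : q' ∈ Ω := by
      apply hzxΩ t htp (hth.trans hR)
      rw [mem_closedBall, dist_eq_norm, hq', add_sub_cancel_left]
      have : t₀ * ρ ≤ t * ρ := mul_le_mul_of_nonneg_right htl hρ.le
      linarith
    have heq : (1 - s) • q' + s • z + (μ₀ - inner ℝ u (g t)) • u = q := by
      have : (1 - s) • q' = (1 - s) • zx t + e := by
        rw [hq', smul_add, smul_smul, mul_inv_cancel₀ hs2.ne', one_smul]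
      rw [this, he]; simp only [hγ, hg]; abel
    rw [← heq]
    refine h.conv.slide hp hm hKK hK₁ hs0 (by linarith) hq'Ω ?_ ?_
    · refine (abs_inner_unit_le hu _).trans ?_
      have e1 : q' - z = (1 - s)⁻¹ • e + (zx t - x) + (x - z) := by rw [hq']; abel
      rw [e1]
      have h1 := norm_add₃_le (a := (1 - s)⁻¹ • e) (b := zx t - x) (c := x - z)
      have h2 := hzxd t htp
      have h4 : t * D ≤ K₃ * D := mul_le_mul_of_nonneg_right hth (by linarith)
      rw [dist_eq_norm] at hxz
      have h5 : t₀ * ρ ≤ t₀ * D := mul_le_mul_of_nonneg_left (by linarith) ht₀0.le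
      linarith
    · have e1 : inner ℝ u ((1 - s) • q' + s • z - z) + (μ₀ - inner ℝ u (g t)) =
          (inner ℝ u q - μ₀) + (μ₀ - inner ℝ u x) + inner ℝ u (x - z) := by
        have e2 : inner ℝ u q = inner ℝ u ((1 - s) • q' + s • z) + (μ₀ - inner ℝ u (g t)) := by
          rw [← heq, inner_add_right, inner_smul_right _ u (μ₀ - _), real_inner_self_eq_norm_sq, hu]
          ring
        rw [inner_sub_right, inner_sub_right, e2]
        ring
      rw [e1]
      have h1 := abs_inner_unit_le hu (x - z)
      rw [← dist_eq_norm] at h1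
      rw [abs_le] at h1 hqs ⊢
      constructor <;> linarith

end SlabBall

section MediumClusters

lemma isOpen_gap (A : Set E3) (τ : ℝ) : IsOpen (gap A τ) :=
  (isOpen_lt continuous_const (continuous_infDist_pt A)).inter
    (isOpen_lt (continuous_infDist_pt A) continuous_const)

lemma Body.exists_half_ball {Ω : Set E3} {p : E3} {ρ D R : ℝ} (h : Body Ω p ρ D R) (hR : 1 ≤ R)
    {A : Set E3} {a y : E3} (ha : a ∈ A) (haΩ : a ∈ Ω) (hy : closedBall y (ρ / (4 * D)) ⊆ Ω)
    (hyA : 1 / 2 ≤ infDist y A) {M : ℝ} (hM : 1 / 4 ≤ M) (hya : dist y a ≤ M) :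
    ∃ z, infDist z A = 1 / 2 ∧ closedBall z (ρ / (4 * D)) ⊆ Ω ∧ dist z a ≤ M := by
  have hD := h.D_ge
  have ht0 : 0 ≤ 1 / (4 * D) := by positivity
  have ht1 : 1 / (4 * D) ≤ R := by
    rw [div_le_iff₀ (by positivity)]; nlinarith
  have hb := h.inward_ball haΩ ht0 ht1
  have e : 1 / (4 * D) * ρ = ρ / (4 * D) := by ring
  rw [e] at hb
  have hd := h.dist_inward haΩ ht0
  have e2 : 1 / (4 * D) * D = 1 / 4 := by field_simp
  rw [e2] at hd
  obtain ⟨t, ht, h1, h2⟩ := exists_half_of_segment (A := A) h.conv hb hy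
    ((infDist_le_dist_of_mem ha).trans (by linarith)) hyA
  refine ⟨_, h1, h2, ?_⟩
  have := (convex_closedBall a M).add_smul_sub_mem (x := inward p R (1 / (4 * D)) a) (y := y)
    (mem_closedBall.2 (hd.trans hM)) (mem_closedBall.2 hya) ht
  exact mem_closedBall.1 this

lemma Body.vol_gap_ge {Ω : Set E3} {p : E3} {ρ D R : ℝ} (h : Body Ω p ρ D R) {A : Set E3}
    {a : E3} (ha : a ∈ A) (hAΩ : A ⊆ Ω) {K' : ℝ} (hK' : ∀ b ∈ A, dist b a ≤ K')
    (hR : 2 * K' + 2 ≤ R * ρ) {τ : ℝ} (hτ : τ ≤ 1 / 16) :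
    (ρ / (4 * D)) ^ 3 * β ≤ volume.real (gap A τ ∩ Ω) := by
  have hD := h.D_ge
  have hρ := h.ρ_pos
  have hρ1 := h.ρ_le
  have hRp := h.R_pos
  have hK0 : 0 ≤ K' := dist_nonneg.trans (hK' a ha)
  have hR1 : 1 ≤ R := by nlinarith
  have hc : ρ / (4 * D) ≤ 1 / 4 := by
    rw [div_le_iff₀ (by positivity)]; linarith
  obtain ⟨w, hw, -, hwa⟩ := exists_unit_orthogonal 0 (p - a)
  set y : E3 := p + (R * ρ / 2) • w with hy
  have hyb : closedBall y (ρ / (4 * D)) ⊆ Ω := by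
    refine subset_trans (closedBall_subset_closedBall' ?_) h.ball_subset
    rw [hy, dist_eq_norm, add_sub_cancel_left, norm_smul, hw,
      Real.norm_of_nonneg (by positivity)]
    linarith
  have hyw : R * ρ / 2 ≤ dist y a := by
    have e : y - a = (p - a) + (R * ρ / 2) • w := by rw [hy]; abel
    have h1 : R * ρ / 2 ≤ inner ℝ w (y - a) := by
      rw [e, inner_add_right, inner_smul_right, real_inner_self_eq_norm_sq, hw]; linarith
    rw [dist_eq_norm]
    exact h1.trans ((le_abs_self _).trans (abs_inner_unit_le hw _))
  have hyA : 1 / 2 ≤ infDist y A := by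
    refine (le_infDist ⟨a, ha⟩).2 fun b hb => ?_
    have := dist_triangle y b a
    linarith [hK' b hb]
  obtain ⟨q, hq, hqΩ, -⟩ := h.exists_half_ball hR1 ha (hAΩ ha) hyb hyA
    (le_max_left (1 / 4) (dist y a)) (le_max_right _ _)
  have hsub : closedBall q (ρ / (4 * D)) ⊆ gap A τ ∩ Ω :=
    Set.subset_inter (closedBall_subset_gap hq (by linarith)) hqΩ
  have := h.vol_mono hsub Set.inter_subset_right
  rwa [vol_closedBall _ (by positivity)] at this

theorem Body.medium_cluster {η K' ρ D : ℝ} (hη : 0 < η) (hK' : 0 ≤ K') (hρ : 0 < ρ)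
    (hD : 1 ≤ D) : ∃ c τ₀ K₁ R₀ : ℝ, 0 < c ∧ 0 < τ₀ ∧ 0 < K₁ ∧ 0 < R₀ ∧
      ∀ (Ω : Set E3) (p : E3) (R : ℝ) (A : Set E3), Body Ω p ρ D R → R₀ ≤ R →
        A.Finite → A ⊆ Ω → (∀ a ∈ A, ∀ b ∈ A, dist a b ≤ K') →
        (∃ a ∈ A, ∃ b ∈ A, η ≤ dist a b) → ∀ z : E3, (∀ a ∈ A, dist a z ≤ K' + D) →
        (∃ u : E3, ‖u‖ = 1 ∧ z + K₁ • u ∈ Ω ∧ z - K₁ • u ∈ Ω) →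
        ∀ V : ℝ, (∀ a ∈ A, V ≤ volume.real (closedBall a 1 ∩ Ω)) →
        ∀ τ : ℝ, 0 < τ → τ ≤ τ₀ → V + c ≤ volume.real (gap A τ ∩ Ω) := by
  have hβ := β_pos
  set K := K' + D with hK
  set K₃ := (2 * K' + 2) / ρ with hK₃
  have hK₃0 : 0 < K₃ := by positivity
  set e₀ := ((ρ / (4 * (D + 1))) ^ 2 / 16) ^ 3 * β with he₀
  have he₀0 : 0 < e₀ := by positivity
  set G := e₀ * min (η / 2) 1 with hG
  have hG0 : 0 < G := by positivity
  set κ := min (1 / 8) (G / (72 * β)) with hκ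
  have hκ0 : 0 < κ := by positivity
  have hκ8 : κ ≤ 1 / 8 := min_le_left _ _
  have hκG : 72 * β * κ ≤ G := by
    have : κ ≤ G / (72 * β) := min_le_right _ _
    rw [le_div_iff₀ (by positivity)] at this
    linarith
  set η' := κ ^ 2 / 12 with hη'
  have hη'0 : 0 < η' := by positivity
  have hη'4 : η' ≤ 1 / 4 := by rw [hη']; nlinarith
  set c₂ := min (ρ / (128 * D)) (η' / 4) with hc₂
  have hc₂0 : 0 < c₂ := by positivity
  have hc₂1 : c₂ ≤ 1 := (min_le_right _ _).trans (by linarith)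
  set l₂ := c₂ ^ 3 / 24 with hl₂
  have hl₂0 : 0 < l₂ := by positivity
  have hl₂1 : l₂ ≤ 1 := by
    have : c₂ ^ 3 ≤ 1 := pow_le_one₀ hc₂0.le hc₂1
    rw [hl₂]; linarith
  set m := min κ l₂ with hm
  have hm0 : 0 < m := by positivity
  have hmκ : m ≤ κ := min_le_left _ _
  have hml : m ≤ l₂ := min_le_right _ _
  set W := K₃ * D + K + 3 with hW
  have hKK₃ : 0 ≤ K₃ * D := by positivity
  have hK0 : 0 ≤ K := by positivity
  have hW3 : 3 ≤ W := by linarith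
  set s := m / (4 * W) with hs
  have hs0 : 0 < s := by positivity
  have hsW : s * W = m / 4 := by rw [hs]; field_simp
  have hsm : s ≤ m / 12 := by nlinarith
  have hsK : s * (K + 1) ≤ m / 4 := by
    rw [← hsW]; exact mul_le_mul_of_nonneg_left (by linarith) hs0.le
  refine ⟨min (G / 4) (c₂ ^ 3 * β / 2), m / 40, 2 * W / s, (8 + 4 * K') / ρ, by positivity,
    by positivity, by positivity, by positivity, ?_⟩
  intro Ω p R A h hR hfin hAΩ hAd hAη z hAz hz V hV τ hτ hτ0
  obtain ⟨u, hu, hzp, hzm⟩ := hz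
  have hRρ : 8 + 4 * K' ≤ R * ρ := by rwa [div_le_iff₀ hρ] at hR
  have hsK₁ : s * (2 * W / s) = 2 * W := by field_simp
  have hK₁0 : 0 < 2 * W / s := by positivity
  obtain ⟨a₀, ha₀, b₀, hb₀, hab₀⟩ := hAη
  have hAne : A.Nonempty := ⟨a₀, ha₀⟩
  obtain ⟨x, hx, hmin⟩ := Set.exists_min_image A (fun a => inner ℝ u a) hfin hAne
  obtain ⟨y, hy, hmax⟩ := Set.exists_max_image A (fun a => inner ℝ u a) hfin hAne
  have hxy : inner ℝ u x ≤ inner ℝ u y := hmin y hy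
  have hnu : ‖-u‖ = 1 := by rwa [norm_neg]
  have hzp' : z + (2 * W / s) • (-u) ∈ Ω := by rwa [smul_neg, ← sub_eq_add_neg]
  have hzm' : z - (2 * W / s) • (-u) ∈ Ω := by rwa [smul_neg, sub_neg_eq_add]
  have left : ∀ lam κ' : ℝ, 0 ≤ κ' → κ' ≤ 1 / 2 → s * (K + 1) + κ' + 5 * τ < lam → lam ≤ 1 →
      ∀ b ∈ A, 12 * inner ℝ u (b - x) ≤ κ' ^ 2 →
      volume.real ((closedBall x 1 ∪ closedBall b 1) ∩ Ω) / 2 - 3 * β * (lam + s) ≤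
      volume.real ({q | inner ℝ u q < inner ℝ u x} ∩ gap A τ ∩ Ω) := by
    intro lam κ' h1 h2 h3 h4 b hb hbx
    exact vol_half_gap_ge h hu hzp hzm hK₁0 (by rw [hsK₁]; linarith) hs0 (by linarith) hτ h1 h2 h3
      h4 hAz hx hb hmin hbx
  have right : ∀ lam : ℝ, s * (K + 1) + 5 * τ < lam → lam ≤ 1 →
      V / 2 - 3 * β * (lam + s) ≤
      volume.real ({q | inner ℝ (-u) q < inner ℝ (-u) y} ∩ gap A τ ∩ Ω) := by
    intro lam h3 h4
    have := vol_half_gap_ge h hnu hzp' hzm' hK₁0 (by rw [hsK₁]; linarith) hs0 (by linarith) hτ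
      le_rfl (by norm_num) (by linarith) h4 hAz hy hy
      (fun a ha => by rw [inner_neg_left, inner_neg_left]; linarith [hmax a ha]) (by simp)
    rw [Set.union_self] at this
    linarith [hV y hy]
  set L := {q | inner ℝ u q < inner ℝ u x} ∩ gap A τ ∩ Ω with hL
  set Rt := {q | inner ℝ (-u) q < inner ℝ (-u) y} ∩ gap A τ ∩ Ω with hRt
  have hLm : MeasurableSet L :=
    (((isOpen_lt (by fun_prop) continuous_const).inter (isOpen_gap A τ)).measurableSet).inter
      h.comp.isClosed.measurableSet
  have hRm : MeasurableSet Rt :=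
    (((isOpen_lt (by fun_prop) continuous_const).inter (isOpen_gap A τ)).measurableSet).inter
      h.comp.isClosed.measurableSet
  have hLΩ : L ⊆ Ω := Set.inter_subset_right
  have hRΩ : Rt ⊆ Ω := Set.inter_subset_right
  have hLR : Disjoint L Rt := by
    rw [Set.disjoint_left]
    rintro q ⟨⟨h1, -⟩, -⟩ ⟨⟨h2, -⟩, -⟩
    have h1' : inner ℝ u q < inner ℝ u x := h1
    have h2' : inner ℝ (-u) q < inner ℝ (-u) y := h2
    rw [inner_neg_left, inner_neg_left] at h2'
    linarith
  have hLRv : volume.real (L ∪ Rt) = volume.real L + volume.real Rt :=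
    measureReal_union hLR hRm (h.vol_ne_top hLΩ) (h.vol_ne_top hRΩ)
  rcases lt_or_ge (inner ℝ u y) (inner ℝ u x + η') with hcase | hcase
  · obtain ⟨b, hb, hbx⟩ : ∃ b ∈ A, η / 2 ≤ dist x b := by
      by_contra! hcon
      have h1 := hcon a₀ ha₀
      have h2 := hcon b₀ hb₀
      have := dist_triangle_left a₀ b₀ x
      linarith
    have hu1 : V + G ≤ volume.real ((closedBall x 1 ∪ closedBall b 1) ∩ Ω) := by
      have hGe : G ≤ e₀ * min (dist x b) 1 := by
        apply mul_le_mul_of_nonneg_left (min_le_min hbx le_rfl) he₀0.le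
      have hadd : ∀ c d : E3, volume.real (closedBall c 1 ∩ Ω) +
          volume.real ((closedBall d 1 \ closedBall c 1) ∩ Ω) ≤
          volume.real ((closedBall c 1 ∪ closedBall d 1) ∩ Ω) := by
        intro c d
        rw [← measureReal_union ?_ ?_ (h.vol_ne_top Set.inter_subset_right)
          (h.vol_ne_top Set.inter_subset_right)]
        · apply h.vol_mono _ Set.inter_subset_right
          rintro q (⟨hq, hqΩ⟩ | ⟨hq, hqΩ⟩)
          · exact ⟨Or.inl hq, hqΩ⟩
          · exact ⟨Or.inr hq.1, hqΩ⟩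
        · rw [Set.disjoint_left]
          rintro q ⟨hq, -⟩ ⟨hq', -⟩
          exact hq'.2 hq
        · exact (measurableSet_closedBall.diff measurableSet_closedBall).inter
            h.comp.isClosed.measurableSet
      rcases h.vol_diff_ge (by linarith) (hAΩ hx) (hAΩ hb) (by linarith)
        (by linarith [hAd x hx b hb]) with h1 | h1
      · have := hadd x b
        rw [← he₀] at h1
        linarith [hV x hx]
      · have := hadd b x
        rw [← he₀] at h1
        rw [Set.union_comm] at this
        linarith [hV b hb]
    have hbx' : 12 * inner ℝ u (b - x) ≤ κ ^ 2 := by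
      rw [inner_sub_right]
      linarith [hmax b hb]
    have h1 := left (2 * κ) κ hκ0.le (by linarith) (by linarith) (by linarith) b hb hbx'
    have h2 := right (2 * κ) (by linarith) (by linarith)
    have h3 : volume.real (L ∪ Rt) ≤ volume.real (gap A τ ∩ Ω) := by
      apply h.vol_mono _ Set.inter_subset_right
      rintro q (⟨⟨-, h1⟩, h2⟩ | ⟨⟨-, h1⟩, h2⟩) <;> exact ⟨h1, h2⟩
    have h4 : 6 * β * (2 * κ + s) ≤ 6 * β * (3 * κ) :=
      mul_le_mul_of_nonneg_left (by linarith) (by positivity)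
    have h5 : min (G / 4) (c₂ ^ 3 * β / 2) ≤ G / 4 := min_le_left _ _
    linarith
  · obtain ⟨q, hq⟩ := exists_ball_in_slab h hu (K := K) (K' := K') (η := η') (τ := τ) hzp hzm hK₁0
      hs0 (by
        refine (mul_le_mul_of_nonneg_left (?_ : _ ≤ W) hs0.le).trans ?_
        · linarith
        · linarith) (by rw [hsK₁])
      (by rw [div_le_iff₀ hρ]; linarith) hη'0 hη'4 (by linarith) hx (hAΩ hx)
      (fun a ha => hAd a ha x hx) (hAz x hx)
    rw [← hc₂] at hq
    have h1 := left l₂ 0 le_rfl (by norm_num) (by linarith) hl₂1 x hx (by simp)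
    rw [Set.union_self] at h1
    have h2 := right l₂ (by linarith) hl₂1
    have hdis : Disjoint (L ∪ Rt) (closedBall q c₂) := by
      rw [Set.disjoint_left]
      intro w hw hwq
      obtain ⟨⟨⟨h1, h2⟩, -⟩, -⟩ := hq hwq
      have h1' : inner ℝ u x < inner ℝ u w := h1
      have h2' : inner ℝ u w < inner ℝ u x + η' := h2
      rcases hw with ⟨⟨h3, -⟩, -⟩ | ⟨⟨h3, -⟩, -⟩
      · have h3' : inner ℝ u w < inner ℝ u x := h3
        linarith
      · have h3' : inner ℝ (-u) w < inner ℝ (-u) y := h3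
        rw [inner_neg_left, inner_neg_left] at h3'
        linarith
    have h3 : volume.real ((L ∪ Rt) ∪ closedBall q c₂) ≤ volume.real (gap A τ ∩ Ω) := by
      apply h.vol_mono _ Set.inter_subset_right
      rintro w ((⟨⟨-, h1⟩, h2⟩ | ⟨⟨-, h1⟩, h2⟩) | hw)
      · exact ⟨h1, h2⟩
      · exact ⟨h1, h2⟩
      · exact ⟨(hq hw).1.2, (hq hw).2⟩
    rw [measureReal_union hdis measurableSet_closedBall
      (h.vol_ne_top (Set.union_subset hLΩ hRΩ)) measure_closedBall_lt_top.ne, hLRv,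
      vol_closedBall _ hc₂0.le] at h3
    have h4 : 6 * β * (l₂ + s) ≤ 6 * β * (2 * l₂) :=
      mul_le_mul_of_nonneg_left (by linarith) (by positivity)
    have h5 : min (G / 4) (c₂ ^ 3 * β / 2) ≤ c₂ ^ 3 * β / 2 := min_le_right _ _
    have h6 : 6 * β * (2 * l₂) = c₂ ^ 3 * β / 2 := by rw [hl₂]; ring
    linarith [hV x hx]

end MediumClusters

section Isoperimetry

lemma continuous_measureReal_closedBall (ν : Measure E3) [IsFiniteMeasure ν]
    (hν : ν ≪ (volume : Measure E3)) :
    Continuous fun q : E3 × ℝ => ν.real (closedBall q.1 q.2) := by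
  have e : (fun q : E3 × ℝ => ν.real (closedBall q.1 q.2)) =
      fun q : E3 × ℝ => ∫ y, (closedBall q.1 q.2).indicator (fun _ => (1 : ℝ)) y ∂ν := by
    funext q
    rw [integral_indicator_const _ measurableSet_closedBall, smul_eq_mul, mul_one]
  rw [e, continuous_iff_continuousAt]
  rintro ⟨x, r⟩
  refine continuousAt_of_dominated (bound := fun _ => 1) ?_ ?_ (integrable_const 1) ?_
  · exact Eventually.of_forall fun q =>
      (measurable_const.indicator measurableSet_closedBall).aestronglyMeasurable
  · refine Eventually.of_forall fun q => Eventually.of_forall fun y => ?_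
    refine (norm_indicator_le_norm_self _ _).trans ?_
    simp
  · have hs : ν (sphere x r) = 0 := hν (Measure.addHaar_sphere volume x r)
    filter_upwards [measure_eq_zero_iff_ae_notMem.1 hs] with y hy
    rw [mem_sphere] at hy
    have hc : Continuous fun q : E3 × ℝ => dist y q.1 := by fun_prop
    rcases lt_or_gt_of_ne hy with h | h
    · have : ∀ᶠ q : E3 × ℝ in 𝓝 (x, r), dist y q.1 < q.2 :=
        hc.continuousAt.eventually_lt continuous_snd.continuousAt h
      refine ContinuousAt.congr (f := fun _ => (1 : ℝ)) continuousAt_const ?_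
      filter_upwards [this] with q hq
      rw [Set.indicator_of_mem (mem_closedBall.2 hq.le)]
    · have : ∀ᶠ q : E3 × ℝ in 𝓝 (x, r), q.2 < dist y q.1 :=
        continuous_snd.continuousAt.eventually_lt hc.continuousAt h
      refine ContinuousAt.congr (f := fun _ => (0 : ℝ)) continuousAt_const ?_
      filter_upwards [this] with q hq
      rw [Set.indicator_of_notMem]
      rw [mem_closedBall]; exact not_le.2 hq

lemma continuous_vol_inter_closedBall {S : Set E3} (hS : volume S ≠ ⊤) (L : ℝ) :
    Continuous fun x : E3 => volume.real (S ∩ closedBall x L) := by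
  have : IsFiniteMeasure (volume.restrict S) := isFiniteMeasure_restrict.2 hS
  have h := (continuous_measureReal_closedBall (volume.restrict S)
    Measure.absolutelyContinuous_restrict).comp
    (by fun_prop : Continuous fun x : E3 => (x, L))
  refine h.congr fun x => ?_
  simp only [Function.comp]
  rw [measureReal_restrict_apply measurableSet_closedBall, Set.inter_comm]

lemma prod_vol_segment_le {W H : Set E3} (hW : MeasurableSet W) (hWf : volume W ≠ ⊤)
    (hH : MeasurableSet H) (hHW : H ⊆ W) {t : ℝ} (ht : t ≤ 1 / 2) :
    (volume.prod volume) {q : E3 × E3 | q.1 ∈ W ∧ q.2 ∈ W ∧ (1 - t) • q.1 + t • q.2 ∈ H} ≤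
      ENNReal.ofReal (8 * volume.real H) * volume W := by
  have hm : MeasurableSet
      {q : E3 × E3 | q.1 ∈ W ∧ q.2 ∈ W ∧ (1 - t) • q.1 + t • q.2 ∈ H} :=
    (measurable_fst hW).inter ((measurable_snd hW).inter
      ((by fun_prop : Measurable fun q : E3 × E3 => (1 - t) • q.1 + t • q.2) hH))
  rw [Measure.prod_apply_symm hm]
  calc _ ≤ ∫⁻ y, W.indicator (fun _ => ENNReal.ofReal (8 * volume.real H)) y := by
        refine lintegral_mono fun y => ?_
        by_cases hy : y ∈ W
        · rw [Set.indicator_of_mem hy]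
          set T : Set E3 := (fun x => (x, y)) ⁻¹'
            {q : E3 × E3 | q.1 ∈ W ∧ q.2 ∈ W ∧ (1 - t) • q.1 + t • q.2 ∈ H} with hT
          have hTW : T ⊆ W := fun x hx => hx.1
          have hTf : volume T ≠ ⊤ := ((measure_mono hTW).trans_lt hWf.lt_top).ne
          rw [← ofReal_measureReal hTf]
          apply ENNReal.ofReal_le_ofReal
          have h1 := vol_image_homothety t (by linarith) y T
          have h2 : volume.real ((fun q => (1 - t) • q + t • y) '' T) ≤ volume.real H := by
            refine measureReal_mono ?_ ((measure_mono hHW).trans_lt hWf.lt_top).ne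
            rintro _ ⟨x, hx, rfl⟩
            exact hx.2.2
          have h3 : (1 / 2 : ℝ) ^ 3 ≤ (1 - t) ^ 3 := pow_le_pow_left₀ (by norm_num) (by linarith) 3
          have h4 : 0 ≤ volume.real T := measureReal_nonneg
          nlinarith
        · have : (fun x => (x, y)) ⁻¹'
              {q : E3 × E3 | q.1 ∈ W ∧ q.2 ∈ W ∧ (1 - t) • q.1 + t • q.2 ∈ H} = ∅ := by
            ext x
            simp [hy]
          rw [this]; simp
    _ = _ := by rw [lintegral_indicator_const hW]

lemma prod_vol_segment_le_of_mem {W H : Set E3} (hW : MeasurableSet W) (hWf : volume W ≠ ⊤)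
    (hH : MeasurableSet H) (hHW : H ⊆ W) (t : ℝ) :
    (volume.prod volume) {q : E3 × E3 | q.1 ∈ W ∧ q.2 ∈ W ∧ (1 - t) • q.1 + t • q.2 ∈ H} ≤
      ENNReal.ofReal (8 * volume.real H) * volume W := by
  rcases le_total t (1 / 2) with h | h
  · exact prod_vol_segment_le hW hWf hH hHW h
  · have h1 := prod_vol_segment_le hW hWf hH hHW (t := 1 - t) (by linarith)
    rw [← (Measure.measurePreserving_swap (μ := (volume : Measure E3))
      (ν := (volume : Measure E3))).measure_preimage] at h1
    · refine le_trans (le_of_eq ?_) h1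
      congr 1
      ext q
      simp only [Set.mem_preimage, Set.mem_ofPred_eq, Prod.fst_swap, Prod.snd_swap, sub_sub_cancel]
      rw [add_comm]
      tauto
    · exact ((measurable_fst hW).inter ((measurable_snd hW).inter
        ((by fun_prop : Measurable fun q : E3 × E3 => (1 - (1 - t)) • q.1 + (1 - t) • q.2)
          hH))).nullMeasurableSet

lemma exists_between_of_small_steps {f : ℕ → ℝ} {a b : ℝ} {J : ℕ} (h0 : f 0 < a) (hJ : a ≤ f J)
    (hstep : ∀ j < J, f (j + 1) ≤ f j + (b - a)) : ∃ j ≤ J, a ≤ f j ∧ f j ≤ b := by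
  classical
  have hex : ∃ j, a ≤ f j := ⟨J, hJ⟩
  set j := Nat.find hex with hj
  have hjJ : j ≤ J := Nat.find_min' hex hJ
  have hja : a ≤ f j := Nat.find_spec hex
  rcases Nat.eq_zero_or_pos j with h | h
  · rw [h] at hja; linarith
  · have h1 : f (j - 1) < a := not_le.1 (Nat.find_min hex (by omega : j - 1 < j))
    have h2 := hstep (j - 1) (by omega)
    rw [Nat.sub_add_cancel h] at h2
    exact ⟨j, hjJ, hja, by linarith⟩

lemma vol_middle_ge {W A : Set E3} (hWc : Convex ℝ W) (hW : MeasurableSet W)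
    (hWf : volume W ≠ ⊤) {L : ℝ} (hL : ∀ x ∈ W, ∀ y ∈ W, dist x y ≤ L) {J : ℕ} (hJ0 : 0 < J)
    (hJ : 4 * L ≤ J)
    (hP : 2 * volume.real {q | q ∈ W ∧ infDist q A < 1 / 2} = volume.real W) :
    volume.real W ≤ 4 * (8 * (J + 1) + 1) *
      volume.real {q | q ∈ W ∧ 1 / 2 ≤ infDist q A ∧ infDist q A ≤ 3 / 4} := by
  have hc := continuous_infDist_pt A
  set P := {q | q ∈ W ∧ infDist q A < 1 / 2} with hPd
  set H := {q | q ∈ W ∧ 1 / 2 ≤ infDist q A ∧ infDist q A ≤ 3 / 4} with hHd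
  set Q := {q | q ∈ W ∧ 3 / 4 < infDist q A} with hQd
  have hPm : MeasurableSet P := hW.inter (isOpen_lt hc continuous_const).measurableSet
  have hQm : MeasurableSet Q := hW.inter (isOpen_lt continuous_const hc).measurableSet
  have hHm : MeasurableSet H := hW.inter ((isClosed_le continuous_const hc).measurableSet.inter
    (isClosed_le hc continuous_const).measurableSet)
  have hHW : H ⊆ W := fun q hq => hq.1
  have hcover : volume.real W ≤ volume.real P + volume.real H + volume.real Q := by
    have hsub : W ⊆ (P ∪ H) ∪ Q := by
      intro q hq
      rcases lt_or_ge (infDist q A) (1 / 2) with h1 | h1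
      · exact Or.inl (Or.inl ⟨hq, h1⟩)
      · rcases le_or_gt (infDist q A) (3 / 4) with h2 | h2
        · exact Or.inl (Or.inr ⟨hq, h1, h2⟩)
        · exact Or.inr ⟨hq, h2⟩
    have hsub' : (P ∪ H) ∪ Q ⊆ W := by
      rintro q ((hq | hq) | hq) <;> exact hq.1
    refine (measureReal_mono hsub ((measure_mono hsub').trans_lt hWf.lt_top).ne).trans ?_
    refine (measureReal_union_le _ _).trans ?_
    linarith [measureReal_union_le (μ := volume) P H]
  have hmain : volume.real P * volume.real Q ≤ (J + 1) * (8 * volume.real H * volume.real W) := by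
    have hsub : P ×ˢ Q ⊆ ⋃ j ∈ Finset.range (J + 1),
        {q : E3 × E3 | q.1 ∈ W ∧ q.2 ∈ W ∧ (1 - (j / J : ℝ)) • q.1 + (j / J : ℝ) • q.2 ∈ H} := by
      rintro ⟨x, y⟩ ⟨hx, hy⟩
      have hJp : (0 : ℝ) < J := by exact_mod_cast hJ0
      set γ : ℕ → E3 := fun j => (1 - (j / J : ℝ)) • x + (j / J : ℝ) • y with hγ
      obtain ⟨j, hj, h1, h2⟩ := exists_between_of_small_steps (f := fun j => infDist (γ j) A)
        (a := 1 / 2) (b := 3 / 4) (J := J) (by simpa [hγ] using hx.2) (by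
          have : γ J = y := by simp [hγ, div_self hJp.ne']
          simp only [this]
          linarith [hy.2]) (by
          intro j _
          refine (infDist_le_infDist_add_dist (y := γ j)).trans ?_
          gcongr
          have e : γ (j + 1) - γ j = (1 / J : ℝ) • (y - x) := by
            simp only [hγ]; push_cast; rw [add_div]; module
          rw [dist_eq_norm, e, norm_smul, ← dist_eq_norm, Real.norm_of_nonneg (by positivity),
            div_mul_eq_mul_div, one_mul, div_le_iff₀ hJp]
          linarith [hL y hy.1 x hx.1])
      simp only [Set.mem_iUnion]
      refine ⟨j, Finset.mem_range.2 (by omega), hx.1, hy.1, ?_, h1, h2⟩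
      apply hWc hx.1 hy.1 _ (by positivity) (by ring)
      have : (j : ℝ) ≤ J := by exact_mod_cast hj
      rw [sub_nonneg, div_le_one hJp]; exact this
    have h1 := measure_mono (μ := (volume : Measure E3).prod volume) hsub
    rw [Measure.prod_prod] at h1
    have h2 := (h1.trans (measure_biUnion_finset_le _ _)).trans (Finset.sum_le_sum fun j _ =>
      prod_vol_segment_le_of_mem hW hWf hHm hHW (j / J : ℝ))
    rw [Finset.sum_const, Finset.card_range, nsmul_eq_mul] at h2
    have h3 := ENNReal.toReal_mono (by finiteness) h2
    rw [ENNReal.toReal_mul, ENNReal.toReal_mul, ENNReal.toReal_mul,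
      ENNReal.toReal_ofReal (by positivity), ENNReal.toReal_natCast, Nat.cast_add,
      Nat.cast_one] at h3
    simpa [measureReal_def] using h3
  have hw0 : 0 ≤ volume.real W := measureReal_nonneg
  have hH0 : 0 ≤ volume.real H := measureReal_nonneg
  rcases hw0.eq_or_lt with hw | hw
  · rw [← hw]; positivity
  · have hP' : volume.real P = volume.real W / 2 := by linarith
    have hQ' : volume.real W / 2 - volume.real H ≤ volume.real Q := by linarith
    rw [hP'] at hmain
    have h5 : volume.real W / 2 * (volume.real W / 2 - volume.real H) ≤
        (J + 1) * (8 * volume.real H * volume.real W) :=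
      (mul_le_mul_of_nonneg_left hQ' (by linarith)).trans hmain
    have h6 : volume.real W * (volume.real W / 4 - volume.real H / 2 -
        (J + 1) * (8 * volume.real H)) ≤ 0 := by linarith
    have h7 := nonpos_of_mul_nonpos_right h6 hw
    linarith

end Isoperimetry

section LargeClusters

/-- A set whose points can be reached from one another by steps of length at most `2`. -/
def StepConn (A : Set E3) : Prop :=
  ∀ a ∈ A, ∀ l : ℝ, 0 ≤ l → (∃ b ∈ A, l ≤ dist b a) → ∃ b ∈ A, l ≤ dist b a ∧ dist b a ≤ l + 2

lemma Body.exists_deep_of_half {Ω : Set E3} {p : E3} {ρ D R : ℝ} (h : Body Ω p ρ D R)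
    (hR : 10 ≤ R) {L : ℝ} (hL : 10 ≤ L) {A : Set E3} {a : E3} (haΩ : a ∈ Ω)
    (hP : volume.real {q | q ∈ Ω ∩ closedBall a L ∧ infDist q A < 1 / 2} <
      volume.real (Ω ∩ closedBall a L) / 2) :
    ∃ y : E3, closedBall y (ρ / (4 * D)) ⊆ Ω ∧ 1 / 2 ≤ infDist y A ∧ dist y a ≤ L := by
  have hD := h.D_ge
  have hρ := h.ρ_pos
  set s : ℝ := 1 / D / R with hs
  have hs0 : 0 ≤ s := by positivity
  have hs1 : s ≤ 1 / 10 := by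
    rw [hs, div_div, div_le_div_iff₀ (by positivity) (by norm_num)]; nlinarith
  set T₁ := (fun q : E3 => (1 - 1 / 10 : ℝ) • q + (1 / 10 : ℝ) • a) '' (Ω ∩ closedBall a L) with hT₁
  set T₂ := (fun q : E3 => (1 - s) • q + s • p) '' T₁ with hT₂
  have hv : volume.real (Ω ∩ closedBall a L) / 2 ≤ volume.real T₂ := by
    rw [hT₂, vol_image_homothety _ (by linarith), hT₁, vol_image_homothety _ (by norm_num)]
    have h1 : (9 / 10 : ℝ) ^ 3 ≤ (1 - s) ^ 3 := pow_le_pow_left₀ (by norm_num) (by linarith) 3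
    have h2 : 0 ≤ volume.real (Ω ∩ closedBall a L) := measureReal_nonneg
    nlinarith
  have hT₁Ω : ∀ q ∈ T₁, q ∈ Ω ∧ dist q a ≤ L - 1 := by
    rintro _ ⟨q, ⟨hq, hqa⟩, rfl⟩
    refine ⟨h.conv hq haΩ (by norm_num) (by norm_num) (by norm_num), ?_⟩
    have e : (1 - 1 / 10 : ℝ) • q + (1 / 10 : ℝ) • a - a = (9 / 10 : ℝ) • (q - a) := by module
    rw [dist_eq_norm, e, norm_smul, ← dist_eq_norm, Real.norm_of_nonneg (by norm_num)]
    rw [mem_closedBall] at hqa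
    linarith
  have hT₂Ω : ∀ q ∈ T₂, closedBall q (ρ / (4 * D)) ⊆ Ω ∧ dist q a ≤ L := by
    rintro _ ⟨q, hq, rfl⟩
    obtain ⟨hqΩ, hqa⟩ := hT₁Ω q hq
    have e : (1 - s) • q + s • p = inward p R (1 / D) q := by
      unfold inward; rw [← hs]; module
    simp only [e]
    have ht : 0 ≤ 1 / D := by positivity
    constructor
    · refine subset_trans (closedBall_subset_closedBall ?_) (h.inward_ball hqΩ ht ?_)
      · rw [one_div_mul_eq_div]
        apply div_le_div_of_nonneg_left hρ.le (by linarith) (by linarith)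
      · rw [div_le_iff₀ (by linarith)]; nlinarith
    · have h1 := h.dist_inward hqΩ ht
      have h2 : 1 / D * D = 1 := by field_simp
      have := dist_triangle (inward p R (1 / D) q) q a
      linarith
  obtain ⟨y, hy, hyn⟩ : ∃ y ∈ T₂, ¬ (infDist y A < 1 / 2) := by
    by_contra! hcon
    have : volume.real T₂ ≤ volume.real {q | q ∈ Ω ∩ closedBall a L ∧ infDist q A < 1 / 2} := by
      apply h.vol_mono
      · intro q hq
        obtain ⟨h1, h2⟩ := hT₂Ω q hq
        exact ⟨⟨h1 (mem_closedBall_self (by positivity)), h2⟩, hcon q hq⟩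
      · exact fun q hq => hq.1.1
    linarith
  exact ⟨y, (hT₂Ω y hy).1, not_lt.1 hyn, (hT₂Ω y hy).2⟩

lemma Body.exists_half_or_vol_gap_ge {Ω : Set E3} {p : E3} {ρ D R : ℝ} (h : Body Ω p ρ D R)
    (hR : 10 ≤ R) {L : ℝ} (hL : 10 ≤ L) {A : Set E3} (hAΩ : A ⊆ Ω) (hA : StepConn A) {J : ℕ}
    {M : ℝ} (hM : M ≤ J * ((ρ / (4 * D)) ^ 3 * β)) (hdiam : ∃ a ∈ A, ∃ b ∈ A, 5 * L * J ≤ dist b a)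
    {τ : ℝ} (hτ : τ ≤ 1 / 16) :
    (∃ a ∈ A, volume.real (Ω ∩ closedBall a L) ≤
      2 * volume.real {q | q ∈ Ω ∩ closedBall a L ∧ infDist q A < 1 / 2}) ∨
    ∃ a ∈ A, M ≤ volume.real (gap A τ ∩ Ω ∩ closedBall a (5 * L * J + 2 * L)) := by
  by_contra! hcon
  obtain ⟨hno, hgap⟩ := hcon
  obtain ⟨a, ha, b, hb, hab⟩ := hdiam
  have hD := h.D_ge
  have hρ := h.ρ_pos
  have hρ1 := h.ρ_le
  have hc : ρ / (4 * D) ≤ 1 / 4 := by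
    rw [div_le_iff₀ (by positivity)]; linarith
  have hex : ∀ c ∈ A, ∃ z, infDist z A = 1 / 2 ∧ closedBall z (ρ / (4 * D)) ⊆ Ω ∧ dist z c ≤ L := by
    intro c hc
    obtain ⟨y, hy, hyA, hyc⟩ := h.exists_deep_of_half hR hL (hAΩ hc) (A := A)
      (by linarith [hno c hc])
    exact h.exists_half_ball (by linarith) hc (hAΩ hc) hy hyA (by linarith) hyc
  have hseq : ∀ j : ℕ, ∃ z, j < J → closedBall z (ρ / (4 * D)) ⊆ gap A τ ∩ Ω ∧
      5 * L * j - L ≤ dist z a ∧ dist z a ≤ 5 * L * j + L + 2 := by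
    intro j
    by_cases hj : j < J
    · have hjJ : (j : ℝ) ≤ J := by exact_mod_cast hj.le
      obtain ⟨c, hcA, h1, h2⟩ := hA a ha (5 * L * j) (by positivity) ⟨b, hb,
        (mul_le_mul_of_nonneg_left hjJ (by linarith)).trans hab⟩
      obtain ⟨z, hz1, hz2, hz3⟩ := hex c hcA
      refine ⟨z, fun _ => ⟨Set.subset_inter (closedBall_subset_gap hz1 (by linarith)) hz2, ?_, ?_⟩⟩
      · have := dist_triangle_left c a z
        linarith
      · have := dist_triangle z c a
        linarith
    · exact ⟨a, fun h => absurd h hj⟩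
  choose z hz using hseq
  have hdisj : Set.PairwiseDisjoint (↑(Finset.range J)) fun j => closedBall (z j) (ρ / (4 * D)) := by
    have key : ∀ i < J, ∀ j < J, i < j →
        Disjoint (closedBall (z i) (ρ / (4 * D))) (closedBall (z j) (ρ / (4 * D))) := by
      intro i hi j hj hij
      apply closedBall_disjoint_closedBall
      have h1 := (hz i hi).2.2
      have h2 := (hz j hj).2.1
      have h3 := dist_triangle (z j) (z i) a
      rw [dist_comm (z j) (z i)] at h3
      have h4 : (i : ℝ) + 1 ≤ j := by exact_mod_cast hij
      have h5 : 5 * L * (i + 1) ≤ 5 * L * j := mul_le_mul_of_nonneg_left h4 (by linarith)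
      linarith
    intro i hi j hj hij
    rw [Finset.coe_range, Set.mem_Iio] at hi hj
    rcases lt_or_gt_of_ne hij with h1 | h1
    · exact key i hi j hj h1
    · exact (key j hj i hi h1).symm
  have hvol := measureReal_biUnion_finset (μ := (volume : Measure E3)) hdisj
    (fun j _ => measurableSet_closedBall) (fun j _ => measure_closedBall_lt_top.ne)
  simp only [vol_closedBall _ (by positivity : 0 ≤ ρ / (4 * D)), Finset.sum_const,
    Finset.card_range, nsmul_eq_mul] at hvol
  have hsub : (⋃ j ∈ Finset.range J, closedBall (z j) (ρ / (4 * D))) ⊆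
      gap A τ ∩ Ω ∩ closedBall a (5 * L * J + 2 * L) := by
    intro q hq
    simp only [Set.mem_iUnion] at hq
    obtain ⟨j, hj, hq⟩ := hq
    rw [Finset.mem_range] at hj
    refine ⟨(hz j hj).1 hq, ?_⟩
    have hjJ : (j : ℝ) ≤ J := by exact_mod_cast hj.le
    have h5 : 5 * L * j ≤ 5 * L * J := mul_le_mul_of_nonneg_left hjJ (by linarith)
    rw [mem_closedBall] at hq ⊢
    have := dist_triangle q (z j) a
    linarith [(hz j hj).2.2]
  have := h.vol_mono hsub (fun q hq => hq.1.2)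
  linarith [hgap a ha]

theorem Body.large_clusters {ρ D : ℝ} (hρ : 0 < ρ) (hD : 1 ≤ D) (M : ℝ) :
    ∃ K K' R₀ : ℝ, 0 < K ∧ 0 < K' ∧ 0 < R₀ ∧ ∀ (Ω : Set E3) (p : E3) (R : ℝ) (A B : Set E3),
      Body Ω p ρ D R → R₀ ≤ R → A ⊆ Ω → B ⊆ Ω → StepConn A → StepConn B →
      (∃ a ∈ A, ∃ b ∈ A, K' ≤ dist b a) → (∃ a ∈ B, ∃ b ∈ B, K' ≤ dist b a) →
      (∀ a ∈ A, ∀ b ∈ B, 1 < dist a b) → ∀ τ : ℝ, τ ≤ 1 / 16 →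
      (∃ a ∈ A, M ≤ volume.real (gap A τ ∩ Ω ∩ closedBall a K)) ∨
      ∃ b ∈ B, M ≤ volume.real (gap B τ ∩ Ω ∩ closedBall b K) := by
  have hβ := β_pos
  -- the window size
  set m := (ρ / (2 * D)) ^ 3 * β with hm
  have hm0 : 0 < m := by positivity
  obtain ⟨L, hL10, hLM⟩ : ∃ L : ℝ, 10 ≤ L ∧ 4 * (80 * L) * |M| ≤ L ^ 3 * m := by
    refine ⟨10 + 320 * |M| / m, by linarith [show 0 ≤ 320 * |M| / m by positivity], ?_⟩
    set L := 10 + 320 * |M| / m with hL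
    have h1 : 320 * |M| ≤ L * m := by
      rw [hL, add_mul, div_mul_cancel₀ _ hm0.ne']; linarith
    have hL1 : 1 ≤ L := by
      rw [hL]; linarith [show 0 ≤ 320 * |M| / m by positivity]
    have h2 : L * m ≤ L ^ 2 * m := by
      apply mul_le_mul_of_nonneg_right _ hm0.le; nlinarith
    nlinarith
  obtain ⟨J, hJ⟩ := exists_nat_ge (M / ((ρ / (4 * D)) ^ 3 * β))
  rw [div_le_iff₀ (by positivity)] at hJ
  refine ⟨5 * L * J + 2 * L + 1, 5 * L * J + 1, L, by positivity, by positivity, by linarith, ?_⟩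
  intro Ω p R A B h hR hAΩ hBΩ hA hB hdA hdB hAB τ hτ
  have hball : ∀ (C : Set E3) (c : E3), volume.real (gap C τ ∩ Ω ∩ closedBall c (5 * L * J + 2 * L))
      ≤ volume.real (gap C τ ∩ Ω ∩ closedBall c (5 * L * J + 2 * L + 1)) := by
    intro C c
    apply h.vol_mono _ (fun q hq => hq.1.2)
    exact Set.inter_subset_inter_right _ (closedBall_subset_closedBall (by linarith))
  obtain ⟨a₁, ha₁, a₂, ha₂, ha⟩ := hdA
  obtain ⟨b₁, hb₁, b₂, hb₂, hb⟩ := hdB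
  have hAne : A.Nonempty := ⟨a₁, ha₁⟩
  have hBne : B.Nonempty := ⟨b₁, hb₁⟩
  rcases h.exists_half_or_vol_gap_ge (by linarith) hL10 hAΩ hA hJ
    ⟨a₁, ha₁, a₂, ha₂, by linarith⟩ hτ with ⟨x, hx, hxA⟩ | ⟨c, hc, hcM⟩
  swap
  · exact Or.inl ⟨c, hc, hcM.trans (hball A c)⟩
  rcases h.exists_half_or_vol_gap_ge (by linarith) hL10 hBΩ hB hJ
    ⟨b₁, hb₁, b₂, hb₂, by linarith⟩ hτ with ⟨y, hy, hyB⟩ | ⟨c, hc, hcM⟩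
  swap
  · exact Or.inr ⟨c, hc, hcM.trans (hball B c)⟩
  left
  have hcA := continuous_infDist_pt A
  have hcB := continuous_infDist_pt B
  have hΩm := h.comp.isClosed.measurableSet
  set PA := {q | q ∈ Ω ∧ infDist q A < 1 / 2} with hPA
  have hPAΩ : PA ⊆ Ω := fun q hq => hq.1
  have hPm : MeasurableSet PA := hΩm.inter (isOpen_lt hcA continuous_const).measurableSet
  have hPe : ∀ x : E3, {q | q ∈ Ω ∩ closedBall x L ∧ infDist q A < 1 / 2} =
      PA ∩ closedBall x L := by
    intro x; ext q; simp only [hPA, Set.mem_inter_iff, Set.mem_ofPred_eq]; tauto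
  have hyA : 2 * volume.real (PA ∩ closedBall y L) ≤ volume.real (Ω ∩ closedBall y L) := by
    set Q := {q | q ∈ Ω ∩ closedBall y L ∧ infDist q B < 1 / 2} with hQ
    have hdis : Disjoint (PA ∩ closedBall y L) Q := by
      rw [Set.disjoint_left]
      rintro q ⟨⟨-, h1⟩, -⟩ ⟨-, h2⟩
      obtain ⟨a, ha, hqa⟩ := (infDist_lt_iff hAne).1 h1
      obtain ⟨b, hb, hqb⟩ := (infDist_lt_iff hBne).1 h2
      have := hAB a ha b hb
      have := dist_triangle_left a b q
      linarith
    have hun := measureReal_union (μ := (volume : Measure E3)) hdis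
      ((hΩm.inter measurableSet_closedBall).inter (isOpen_lt hcB continuous_const).measurableSet)
      (h.vol_ne_top (Set.inter_subset_left.trans hPAΩ)) (h.vol_ne_top fun q hq => hq.1.1)
    have hle : volume.real (PA ∩ closedBall y L ∪ Q) ≤ volume.real (Ω ∩ closedBall y L) := by
      apply h.vol_mono _ Set.inter_subset_left
      rintro q (⟨h1, h2⟩ | ⟨h1, -⟩)
      · exact ⟨hPAΩ h1, h2⟩
      · exact h1
    linarith
  rw [hPe] at hxA
  obtain ⟨w, hwΩ, hw⟩ : ∃ w ∈ Ω, 2 * volume.real (PA ∩ closedBall w L) =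
      volume.real (Ω ∩ closedBall w L) := by
    set f : ℝ → ℝ := fun t => 2 * volume.real (PA ∩ closedBall (x + t • (y - x)) L) -
      volume.real (Ω ∩ closedBall (x + t • (y - x)) L) with hf
    have hfc : Continuous f := by
      have hγ : Continuous fun t : ℝ => x + t • (y - x) := by fun_prop
      exact (continuous_const.mul ((continuous_vol_inter_closedBall (h.vol_ne_top hPAΩ) L).comp
        hγ)).sub ((continuous_vol_inter_closedBall (h.vol_ne_top subset_rfl) L).comp hγ)
    obtain ⟨t, ht, hft⟩ := intermediate_value_Icc' (zero_le_one' ℝ) hfc.continuousOn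
      (show (0 : ℝ) ∈ Set.Icc (f 1) (f 0) by
        simp only [hf]
        constructor
        · simp; linarith
        · simp; linarith)
    refine ⟨_, h.conv.add_smul_sub_mem (hAΩ hx) (hBΩ hy) ht, ?_⟩
    simp only [hf] at hft
    linarith
  rw [← hPe] at hw
  set W := Ω ∩ closedBall w L with hW
  have hWm : MeasurableSet W := hΩm.inter measurableSet_closedBall
  obtain ⟨N, hN1, hN2⟩ : ∃ N : ℕ, 4 * (2 * L) ≤ N ∧ (N : ℝ) ≤ 8 * L + 1 := by
    refine ⟨⌈8 * L⌉₊, ?_, (Nat.ceil_lt_add_one (by positivity)).le⟩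
    have := Nat.le_ceil (8 * L)
    linarith
  have hN0 : 0 < N := by
    have : (0 : ℝ) < N := by linarith
    exact_mod_cast this
  have hmid := vol_middle_ge (A := A) (h.conv.inter (convex_closedBall w L)) hWm
    (h.vol_ne_top Set.inter_subset_left) (L := 2 * L) (J := N) (by
      rintro q ⟨-, hq⟩ q' ⟨-, hq'⟩
      rw [mem_closedBall] at hq hq'
      have := dist_triangle_right q q' w
      linarith) hN0 hN1 hw
  set H := {q | q ∈ W ∧ 1 / 2 ≤ infDist q A ∧ infDist q A ≤ 3 / 4} with hH
  have hWv : L ^ 3 * m ≤ volume.real W := by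
    have := h.vol_ball_ge hwΩ (L := L) (by linarith) (by nlinarith)
    rw [Set.inter_comm] at this
    rw [hm]
    refine le_trans (le_of_eq ?_) this
    ring
  have hHv : |M| ≤ volume.real H := by
    have h1 : 4 * (8 * ((N : ℝ) + 1) + 1) ≤ 4 * (80 * L) := by linarith
    have h2 := mul_le_mul_of_nonneg_right h1 (measureReal_nonneg (μ := (volume : Measure E3)) (s := H))
    have h3 : 4 * (80 * L) * |M| ≤ 4 * (80 * L) * volume.real H := by linarith
    exact le_of_mul_le_mul_left h3 (by positivity)
  have hHW : H ⊆ W := fun q hq => hq.1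
  rcases H.eq_empty_or_nonempty with hHe | ⟨q₀, hq₀⟩
  · refine ⟨a₁, ha₁, ?_⟩
    rw [hHe, measureReal_empty] at hHv
    have := le_abs_self M
    exact (by linarith : M ≤ 0).trans measureReal_nonneg
  · obtain ⟨a, haA, hqa⟩ := (infDist_lt_iff hAne).1
      (lt_of_le_of_lt hq₀.2.2 (by norm_num : (3 / 4 : ℝ) < 1))
    refine ⟨a, haA, (le_abs_self M).trans (hHv.trans ?_)⟩
    apply h.vol_mono _ (fun q hq => hq.1.2)
    intro q hq
    refine ⟨⟨⟨?_, ?_⟩, hq.1.1⟩, ?_⟩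
    · linarith [hq.2.1]
    · linarith [hq.2.2]
    · have h1 := hq.1.2
      have h2 := hq₀.1.2
      rw [mem_closedBall] at h1 h2 ⊢
      have h3 := dist_triangle4 q w q₀ a
      rw [dist_comm w q₀] at h3
      have : 0 ≤ 5 * L * J := by positivity
      linarith

end LargeClusters

section Clusters

lemma exists_mem_dist_le_of_mem_gap {A : Set E3} (hA : A.Nonempty) {τ : ℝ} (hτ : 0 ≤ τ) {q : E3}
    (hq : q ∈ gap A τ) : ∃ a ∈ A, dist q a < 1 :=
  (infDist_lt_iff hA).1 (hq.2.trans_le (by linarith))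

theorem Body.cluster_gap {η ρ D : ℝ} (hη : 0 < η) (hρ : 0 < ρ) (hD : 1 ≤ D) :
    ∃ c c' τ K C δ R₀ : ℝ, 0 < c ∧ 0 < c' ∧ 0 < τ ∧ 0 < K ∧ 0 < C ∧ 0 < δ ∧ 0 < R₀ ∧
      ∀ (Ω : Set E3) (p : E3) (R : ℝ) (N : Set E3) (pt : E3 → E3), Body Ω p ρ D R → R₀ ≤ R →
      (∀ u : E3, ‖u‖ = 1 → ∃ v ∈ N, ‖v - u‖ ≤ δ) → (∀ v ∈ N, pt v ∈ Ω) →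
      (∀ v ∈ N, ∀ q ∈ Ω, inner ℝ q v ≤ inner ℝ (pt v) v) →
      ∀ A : Bool → Set E3, (∀ i, (A i).Finite) → (∀ i, A i ⊆ Ω) → (∀ i, StepConn (A i)) →
      (∀ i, ∃ a ∈ A i, ∃ b ∈ A i, η ≤ dist a b) →
      (∀ a ∈ A false, ∀ b ∈ A true, 1 < dist a b) →
      ∃ i, ∃ a ∈ A i, (volume.real (closedBall a 1 ∩ Ω) + c ≤
          volume.real (gap (A i) τ ∩ Ω ∩ closedBall a K)) ∨
        ((∃ v ∈ N, dist a (pt v) ≤ C) ∧ c' ≤ volume.real (gap (A i) τ ∩ Ω ∩ closedBall a K)) := by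
  have hβ := β_pos
  obtain ⟨K, K', R₁, hK, hK', hR₁, hlarge⟩ := Body.large_clusters hρ hD (β + 1)
  obtain ⟨c, τ₀, K₁, R₂, hc, hτ₀, hK₁, hR₂, hmed⟩ := Body.medium_cluster hη hK'.le hρ hD
  refine ⟨min c 1, (ρ / (4 * D)) ^ 3 * β, min τ₀ (1 / 16), max K (K' + 1), 3 * K₁ + 3 * ρ + D,
    ρ / (2 * (3 * K₁ + 2 * ρ)), max (max R₁ R₂) (max 1 ((2 * K' + 2) / ρ)), by positivity,
    by positivity, by positivity, by positivity, by positivity, by positivity, by positivity, ?_⟩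
  intro Ω p R N pt h hR hN hpt hmax A hfin hAΩ hstep hAη hAB
  have hR1 : R₁ ≤ R := (le_max_left _ _).trans ((le_max_left _ _).trans hR)
  have hR2 : R₂ ≤ R := (le_max_right _ _).trans ((le_max_left _ _).trans hR)
  have hR3 : 1 ≤ R := (le_max_left _ _).trans ((le_max_right _ _).trans hR)
  have hR4 : (2 * K' + 2) / ρ ≤ R := (le_max_right _ _).trans ((le_max_right _ _).trans hR)
  rw [div_le_iff₀ hρ] at hR4
  set τ := min τ₀ (1 / 16) with hτ
  have hτ0 : 0 < τ := by positivity
  have hτ1 : τ ≤ τ₀ := min_le_left _ _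
  have hτ2 : τ ≤ 1 / 16 := min_le_right _ _
  have hmono : ∀ (S : Set E3) (a : E3) (r : ℝ), r ≤ max K (K' + 1) →
      volume.real (gap S τ ∩ Ω ∩ closedBall a r) ≤
      volume.real (gap S τ ∩ Ω ∩ closedBall a (max K (K' + 1))) := by
    intro S a r hr
    apply h.vol_mono _ (fun q hq => hq.1.2)
    exact Set.inter_subset_inter_right _ (closedBall_subset_closedBall hr)
  by_cases hbig : ∀ i, ∃ a ∈ A i, ∃ b ∈ A i, K' ≤ dist b a
  · have key : ∀ i, (∃ a ∈ A i, β + 1 ≤ volume.real (gap (A i) τ ∩ Ω ∩ closedBall a K)) →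
        ∃ i, ∃ a ∈ A i, (volume.real (closedBall a 1 ∩ Ω) + min c 1 ≤
          volume.real (gap (A i) τ ∩ Ω ∩ closedBall a (max K (K' + 1)))) ∨
        ((∃ v ∈ N, dist a (pt v) ≤ 3 * K₁ + 3 * ρ + D) ∧ (ρ / (4 * D)) ^ 3 * β ≤
          volume.real (gap (A i) τ ∩ Ω ∩ closedBall a (max K (K' + 1)))) := by
      rintro i ⟨a, ha, hM⟩
      refine ⟨i, a, ha, Or.inl ?_⟩
      have h1 : volume.real (closedBall a 1 ∩ Ω) ≤ β := by
        refine (measureReal_mono Set.inter_subset_left measure_closedBall_lt_top.ne).trans ?_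
        rw [vol_closedBall _ zero_le_one]; simp
      have h2 := hmono (A i) a K (le_max_left _ _)
      have h3 : min c 1 ≤ 1 := min_le_right _ _
      linarith
    rcases hlarge Ω p R (A false) (A true) h hR1 (hAΩ _) (hAΩ _) (hstep _) (hstep _) (hbig _)
      (hbig _) hAB τ hτ2 with h1 | h1
    · exact key _ h1
    · exact key _ h1
  · push Not at hbig
    obtain ⟨i, hi⟩ := hbig
    obtain ⟨a₀, ha₀, -⟩ := hAη i
    have hne : (A i).Nonempty := ⟨a₀, ha₀⟩
    obtain ⟨a, ha, hmin⟩ := Set.exists_min_image (A i)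
      (fun a => volume.real (closedBall a 1 ∩ Ω)) (hfin i) hne
    refine ⟨i, a, ha, ?_⟩
    have haΩ := hAΩ i ha
    have hgapsub : gap (A i) τ ∩ Ω ⊆ gap (A i) τ ∩ Ω ∩ closedBall a (max K (K' + 1)) := by
      rintro q ⟨hq, hqΩ⟩
      refine ⟨⟨hq, hqΩ⟩, ?_⟩
      obtain ⟨b, hb, hqb⟩ := exists_mem_dist_le_of_mem_gap hne hτ0.le hq
      have h1 := hi a ha b hb
      have h2 := dist_triangle q b a
      have h3 : K' + 1 ≤ max K (K' + 1) := le_max_right _ _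
      rw [mem_closedBall]; linarith
    have hgapv := h.vol_mono hgapsub (fun q hq => hq.1.2)
    set z := Body.inward p R 1 a with hz
    have hzΩ : closedBall z ρ ⊆ Ω := by
      have := h.inward_ball haΩ zero_le_one hR3
      rwa [one_mul] at this
    have hza : dist z a ≤ D := by
      have := h.dist_inward haΩ zero_le_one
      rwa [one_mul] at this
    rcases h.chord_or_vertex hzΩ hK₁ hN hpt hmax with hch | ⟨v, hv, hvz⟩
    · left
      have := hmed Ω p R (A i) h hR2 (hfin i) (hAΩ i) (fun a ha b hb => (hi b hb a ha).le) (hAη i) z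
        (fun b hb => by
          have := hi a ha b hb
          have := dist_triangle_right b z a
          linarith) hch _ hmin τ hτ0 hτ1
      have h3 : min c 1 ≤ c := min_le_left _ _
      linarith
    · right
      refine ⟨⟨v, hv, ?_⟩, (h.vol_gap_ge ha (hAΩ i) (fun b hb => (hi a ha b hb).le) hR4 hτ2).trans
        hgapv⟩
      have := dist_triangle_right a (pt v) z
      rw [dist_comm a z] at this
      linarith

end Clusters

section Rescaling

open scoped Pointwise

lemma vol_smul {r : ℝ} (hr : 0 < r) (S : Set E3) :
    volume.real (r⁻¹ • S) = (r ^ 3)⁻¹ * volume.real S := by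
  rw [measureReal_def, measureReal_def, Measure.addHaar_smul, ENNReal.toReal_mul,
    ENNReal.toReal_ofReal (abs_nonneg _)]
  simp only [finrank_euclideanSpace, Fintype.card_fin, inv_pow]
  rw [abs_of_nonneg (by positivity)]

lemma dist_inv_smul {r : ℝ} (hr : 0 < r) (x y : E3) :
    dist (r⁻¹ • x) (r⁻¹ • y) = r⁻¹ * dist x y := by
  rw [dist_smul₀, norm_inv, Real.norm_of_nonneg hr.le]

lemma inv_smul_closedBall {r : ℝ} (hr : 0 < r) (x : E3) (L : ℝ) :
    r⁻¹ • closedBall x (L * r) = closedBall (r⁻¹ • x) L := by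
  rw [smul_closedBall' (inv_ne_zero hr.ne'), norm_inv, Real.norm_of_nonneg hr.le]
  congr 1
  field_simp

lemma Body.inv_smul {Ω : Set E3} {p : E3} {ρ D : ℝ} (h : Body Ω p ρ D 1) {r : ℝ} (hr : 0 < r) :
    Body (r⁻¹ • Ω) (r⁻¹ • p) ρ D r⁻¹ where
  conv := h.conv.smul _
  comp := h.comp.smul _
  ρ_pos := h.ρ_pos
  ρ_le := h.ρ_le
  D_ge := h.D_ge
  R_pos := inv_pos.2 hr
  ball_subset := by
    rw [← inv_smul_closedBall hr]
    refine Set.smul_set_mono ?_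
    have := h.ball_subset
    rwa [show r⁻¹ * ρ * r = 1 * ρ by field_simp]
  dist_le := by
    rintro _ ⟨x, hx, rfl⟩ _ ⟨y, hy, rfl⟩
    have := h.dist_le x hx y hy
    simp only [dist_inv_smul hr]
    gcongr
    linarith

/-- Points whose distance to `A` is between `2 τ r` and `(1 - 2 τ) r`. -/
def rgap (A : Set E3) (τ r : ℝ) : Set E3 :=
  {q | 2 * τ * r < infDist q A ∧ infDist q A < (1 - 2 * τ) * r}

lemma inv_smul_rgap (A : Set E3) (τ : ℝ) {r : ℝ} (hr : 0 < r) :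
    r⁻¹ • rgap A τ r = gap (r⁻¹ • A) τ := by
  have hr' : r⁻¹ ≠ 0 := inv_ne_zero hr.ne'
  ext q
  rw [Set.mem_smul_set_iff_inv_smul_mem₀ hr', inv_inv]
  have e : infDist q (r⁻¹ • A) = r⁻¹ * infDist (r • q) A := by
    have := infDist_smul₀ hr' A (r • q)
    rwa [norm_inv, Real.norm_of_nonneg hr.le, inv_smul_smul₀ hr.ne'] at this
  simp only [rgap, gap, Set.mem_ofPred_eq, e]
  rw [lt_inv_mul_iff₀ hr, inv_mul_lt_iff₀ hr]
  constructor <;> rintro ⟨h1, h2⟩ <;> constructor <;> linarith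

lemma Body.exists_vol_diff_ge {Ω : Set E3} {p : E3} {ρ D : ℝ} (h : Body Ω p ρ D 1) :
    ∃ e r₁ : ℝ, 0 < e ∧ 0 < r₁ ∧ ∀ r : ℝ, 0 < r → r ≤ r₁ → ∀ x ∈ Ω, ∀ y ∈ Ω, dist x y ≤ 2 * r →
      e * r ^ 2 * dist x y ≤ volume.real ((closedBall y r \ closedBall x r) ∩ Ω) ∨
      e * r ^ 2 * dist x y ≤ volume.real ((closedBall x r \ closedBall y r) ∩ Ω) := by
  have hβ := β_pos
  have hρ := h.ρ_pos
  have hD := h.D_ge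
  set e0 := ((ρ / (4 * (D + 1))) ^ 2 / 16) ^ 3 * β with he0
  have he : 0 < e0 := by positivity
  refine ⟨e0 / 2, ρ / 8, by positivity, by positivity, fun r hr hr1 x hx y hy hxy => ?_⟩
  rcases eq_or_ne x y with rfl | hne
  · left
    rw [dist_self, mul_zero]
    exact measureReal_nonneg
  have hB := h.inv_smul hr
  have hd := dist_inv_smul hr x y
  have hd0 : 0 < dist x y := dist_pos.2 hne
  have hRρ : 8 ≤ r⁻¹ * ρ := by
    rw [le_inv_mul_iff₀ hr]; linarith
  have key := hB.vol_diff_ge hRρ (Set.smul_mem_smul_set hx) (Set.smul_mem_smul_set hy)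
    (by rw [hd]; positivity) (by
      rw [hd, mul_div_assoc]
      gcongr
      linarith)
  have e : ∀ x y : E3, r⁻¹ • ((closedBall y r \ closedBall x r) ∩ Ω) =
      (closedBall (r⁻¹ • y) 1 \ closedBall (r⁻¹ • x) 1) ∩ r⁻¹ • Ω := by
    intro x y
    rw [Set.smul_set_inter₀ (inv_ne_zero hr.ne'), Set.smul_set_sdiff₀ (inv_ne_zero hr.ne'),
      ← inv_smul_closedBall hr, ← inv_smul_closedBall hr, one_mul]
  have hmin : e0 / 2 * (r⁻¹ * dist x y) ≤ e0 * min (dist (r⁻¹ • x) (r⁻¹ • y)) 1 := by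
    rw [hd]
    have : r⁻¹ * dist x y ≤ 2 := by rw [inv_mul_le_iff₀ hr]; linarith
    have h2 : r⁻¹ * dist x y / 2 ≤ min (r⁻¹ * dist x y) 1 := by
      refine le_min ?_ (by linarith)
      have : 0 < r⁻¹ * dist x y := by positivity
      linarith
    nlinarith
  have conv : ∀ t : ℝ, e0 * min (dist (r⁻¹ • x) (r⁻¹ • y)) 1 ≤ (r ^ 3)⁻¹ * t →
      e0 / 2 * r ^ 2 * dist x y ≤ t := by
    intro t ht
    have := hmin.trans ht
    rw [le_inv_mul_iff₀ (by positivity)] at this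
    calc _ = r ^ 3 * (e0 / 2 * (r⁻¹ * dist x y)) := by field_simp
      _ ≤ t := this
  simp only [← e, vol_smul hr] at key
  exact key.imp (conv _) (conv _)

lemma exists_finite_net {δ : ℝ} (hδ : 0 < δ) :
    ∃ N : Finset E3, ∀ u : E3, ‖u‖ = 1 → ∃ v ∈ N, ‖v - u‖ ≤ δ := by
  obtain ⟨t, -, ht, hcov⟩ := finite_cover_balls_of_compact (isCompact_sphere (0 : E3) 1) hδ
  refine ⟨ht.toFinset, fun u hu => ?_⟩
  obtain ⟨v, hv, huv⟩ := Set.mem_iUnion₂.1 (hcov (by simpa using hu : u ∈ sphere (0 : E3) 1))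
  refine ⟨v, by simpa using hv, ?_⟩
  rw [mem_ball, dist_comm, dist_eq_norm] at huv
  exact huv.le

/-- Consecutive distances from a point of `A` jump by at most `2 r`. -/
def RStepConn (r : ℝ) (A : Set E3) : Prop :=
  ∀ a ∈ A, ∀ l : ℝ, 0 ≤ l → (∃ b ∈ A, l ≤ dist b a) → ∃ b ∈ A, l ≤ dist b a ∧ dist b a ≤ l + 2 * r

theorem Body.exists_cluster_rgap {Ω : Set E3} {p : E3} {ρ D : ℝ} (h : Body Ω p ρ D 1) {η : ℝ}
    (hη : 0 < η) :
    ∃ (c τ K C r₁ : ℝ) (F : Finset E3), 0 < c ∧ 0 < τ ∧ 0 < K ∧ 0 < C ∧ 0 < r₁ ∧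
      ∀ r : ℝ, 0 < r → r ≤ r₁ → ∀ A : Bool → Set E3, (∀ i, (A i).Finite) → (∀ i, A i ⊆ Ω) →
      (∀ i, RStepConn r (A i)) → (∀ i, ∃ a ∈ A i, ∃ b ∈ A i, η * r ≤ dist a b) →
      (∀ a ∈ A false, ∀ b ∈ A true, r < dist a b) →
      ∃ i, ∃ a ∈ A i, (volume.real (closedBall a r ∩ Ω) + c * r ^ 3 ≤
          volume.real (rgap (A i) τ r ∩ Ω ∩ closedBall a (K * r))) ∨
        ((∃ v ∈ F, dist a v ≤ C * r) ∧
          c * r ^ 3 ≤ volume.real (rgap (A i) τ r ∩ Ω ∩ closedBall a (K * r))) := by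
  classical
  obtain ⟨c, c', τ, K, C, δ, R₀, hc, hc', hτ, hK, hC, hδ, hR₀, key⟩ :=
    Body.cluster_gap hη h.ρ_pos h.D_ge
  obtain ⟨N, hN⟩ := exists_finite_net hδ
  have hmax : ∀ v : E3, ∃ q ∈ Ω, ∀ q' ∈ Ω, inner ℝ q' v ≤ inner ℝ q v := by
    intro v
    obtain ⟨q, hq, hq'⟩ := h.comp.exists_isMaxOn ⟨p, h.p_mem⟩
      (by fun_prop : ContinuousOn (fun q : E3 => inner ℝ q v) Ω)
    exact ⟨q, hq, fun q' h' => hq' h'⟩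
  choose pt hpt hmax using hmax
  refine ⟨min c c', τ, K, C, R₀⁻¹, N.image pt, lt_min hc hc', hτ, hK, hC, inv_pos.2 hR₀, ?_⟩
  intro r hr hr1 A hfin hAΩ hstep hAη hAB
  obtain ⟨i, _, ⟨a, ha, rfl⟩, hout⟩ := key (r⁻¹ • Ω) (r⁻¹ • p) r⁻¹ N (fun v => r⁻¹ • pt v)
    (h.inv_smul hr) ((le_inv_comm₀ hR₀ hr).2 hr1) hN
    (fun v _ => Set.smul_mem_smul_set (hpt v))
    (by
      rintro v - _ ⟨q, hq, rfl⟩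
      simp only [inner_smul_left]
      have := hmax v q hq
      have hr' : 0 < r⁻¹ := inv_pos.2 hr
      simpa using (mul_le_mul_iff_right₀ hr').2 this)
    (fun i => r⁻¹ • A i) (fun i => (hfin i).smul_set) (fun i => Set.smul_set_mono (hAΩ i))
    (by
      rintro i _ ⟨a, ha, rfl⟩ l hl ⟨_, ⟨b, hb, rfl⟩, hlb⟩
      simp only [dist_inv_smul hr] at hlb
      rw [le_inv_mul_iff₀ hr] at hlb
      obtain ⟨b', hb', h1, h2⟩ := hstep i a ha (r * l) (by positivity) ⟨b, hb, hlb⟩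
      refine ⟨_, Set.smul_mem_smul_set hb', ?_, ?_⟩
      · simp only [dist_inv_smul hr]
        rwa [le_inv_mul_iff₀ hr]
      · simp only [dist_inv_smul hr]
        rw [inv_mul_le_iff₀ hr]
        linarith)
    (by
      intro i
      obtain ⟨a, ha, b, hb, hab⟩ := hAη i
      refine ⟨_, Set.smul_mem_smul_set ha, _, Set.smul_mem_smul_set hb, ?_⟩
      rw [dist_inv_smul hr, le_inv_mul_iff₀ hr]
      linarith)
    (by
      rintro _ ⟨a, ha, rfl⟩ _ ⟨b, hb, rfl⟩
      have := hAB a ha b hb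
      simp only [dist_inv_smul hr]
      rw [lt_inv_mul_iff₀ hr]
      linarith)
  refine ⟨i, a, ha, ?_⟩
  have hr' : r⁻¹ ≠ 0 := inv_ne_zero hr.ne'
  have e1 : r⁻¹ • (rgap (A i) τ r ∩ Ω ∩ closedBall a (K * r)) =
      gap (r⁻¹ • A i) τ ∩ r⁻¹ • Ω ∩ closedBall (r⁻¹ • a) K := by
    rw [Set.smul_set_inter₀ hr', Set.smul_set_inter₀ hr', inv_smul_closedBall hr,
      inv_smul_rgap _ _ hr]
  have e2 : r⁻¹ • (closedBall a r ∩ Ω) = closedBall (r⁻¹ • a) 1 ∩ r⁻¹ • Ω := by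
    rw [Set.smul_set_inter₀ hr', ← inv_smul_closedBall hr, one_mul]
  simp only [← e1, ← e2, vol_smul hr] at hout
  have hr3 : 0 < r ^ 3 := by positivity
  refine hout.imp (fun h1 => ?_) (fun h1 => ⟨?_, ?_⟩)
  · rw [le_inv_mul_iff₀ hr3, mul_add, mul_inv_cancel_left₀ hr3.ne'] at h1
    have : min c c' * r ^ 3 ≤ r ^ 3 * c := by
      rw [mul_comm]; gcongr; exact min_le_left _ _
    linarith
  · obtain ⟨v, hv, hd⟩ := h1.1
    refine ⟨pt v, Finset.mem_image_of_mem _ (by simpa using hv), ?_⟩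
    rw [dist_inv_smul hr, inv_mul_le_iff₀ hr] at hd
    linarith
  · have := h1.2
    rw [le_inv_mul_iff₀ hr3] at this
    refine le_trans ?_ this
    rw [mul_comm]; gcongr; exact min_le_right _ _

end Rescaling

section Graph

lemma reachable_induction {V : Type*} {G : SimpleGraph V} {P : V → Prop} {u v : V}
    (h : G.Reachable u v) (hu : P u) (hP : ∀ a b, G.Adj a b → P a → P b) : P v := by
  rw [SimpleGraph.reachable_iff_reflTransGen] at h
  induction h with
  | refl => exact hu
  | tail _ hbc ih => exact hP _ _ hbc ih

variable {n : ℕ} (X : Fin n → E3) (k : ℕ)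

/-- Radii at which all degrees are at least `k + 1`. -/
def degRadii : Set ℝ :=
  {r : ℝ | 0 < r ∧ ∀ i : Fin n, k + 1 ≤ {j : Fin n | j ≠ i ∧ dist (X i) (X j) ≤ r}.ncard}

/-- Radii at which the graph is `k + 1`-connected. -/
def connRadii : Set ℝ :=
  {r : ℝ | 0 < r ∧ k + 2 ≤ n ∧ ∀ S : Finset (Fin n), S.card ≤ k →
    ((SimpleGraph.fromRel fun i j : Fin n => dist (X i) (X j) ≤ r).induce
      ((↑S : Set (Fin n))ᶜ)).Connected}

variable {X k}

lemma fromRel_dist_adj {r : ℝ} {i j : Fin n} :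
    (SimpleGraph.fromRel fun i j : Fin n => dist (X i) (X j) ≤ r).Adj i j ↔
      i ≠ j ∧ dist (X i) (X j) ≤ r := by
  rw [SimpleGraph.fromRel_adj, dist_comm (X j), or_self]

lemma exists_notMem_of_card_le {k : ℕ} (hn : k + 2 ≤ n) {S : Finset (Fin n)} (hS : S.card ≤ k)
    (i : Fin n) : ∃ j, j ∉ S ∧ j ≠ i := by
  by_contra! hcon
  have : (Finset.univ : Finset (Fin n)) ⊆ insert i S := fun j _ => by
    by_cases hj : j ∈ S
    · exact Finset.mem_insert_of_mem hj
    · rw [hcon j hj]; exact Finset.mem_insert_self _ _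
  have h1 := Finset.card_le_card this
  have h2 := Finset.card_insert_le i S
  rw [Finset.card_univ, Fintype.card_fin] at h1
  omega

lemma connRadii_subset_degRadii : connRadii X k ⊆ degRadii X k := by
  classical
  rintro r ⟨hr, hn, hconn⟩
  refine ⟨hr, fun i => ?_⟩
  by_contra! hlt
  set N := {j : Fin n | j ≠ i ∧ dist (X i) (X j) ≤ r} with hN
  have hS : N.toFinset.card ≤ k := by
    rw [← Set.ncard_eq_toFinset_card']; omega
  have hc := hconn N.toFinset hS
  obtain ⟨j, hj, hji⟩ := exists_notMem_of_card_le hn hS i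
  have hi : i ∈ ((↑N.toFinset : Set (Fin n))ᶜ) := by simp [hN]
  have hj' : j ∈ ((↑N.toFinset : Set (Fin n))ᶜ) := by simpa using hj
  have := reachable_induction (P := fun w => w.1 = i) (hc.preconnected ⟨i, hi⟩ ⟨j, hj'⟩) rfl
    (by
      rintro ⟨a, ha⟩ ⟨b, hb⟩ hab hai
      simp only at hai
      subst hai
      have hab := fromRel_dist_adj.1 (SimpleGraph.induce_adj.1 hab)
      refine absurd ?_ hb
      simpa [hN] using ⟨hab.1.symm, hab.2⟩)
  exact hji this

lemma connRadii_nonempty (hn : k + 2 ≤ n) : (connRadii X k).Nonempty := by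
  refine ⟨1 + ∑ i, ∑ j, dist (X i) (X j), by positivity, hn, fun S hS => ?_⟩
  have hle : ∀ i j, dist (X i) (X j) ≤ 1 + ∑ i, ∑ j, dist (X i) (X j) := by
    intro i j
    have h1 : dist (X i) (X j) ≤ ∑ j, dist (X i) (X j) :=
      Finset.single_le_sum (f := fun j => dist (X i) (X j)) (fun _ _ => dist_nonneg)
        (Finset.mem_univ j)
    have h2 : ∑ j, dist (X i) (X j) ≤ ∑ i, ∑ j, dist (X i) (X j) :=
      Finset.single_le_sum (f := fun i => ∑ j, dist (X i) (X j))
        (fun _ _ => Finset.sum_nonneg fun _ _ => dist_nonneg) (Finset.mem_univ i)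
    linarith
  obtain ⟨j, hj, -⟩ := exists_notMem_of_card_le hn hS ⟨0, by omega⟩
  have : Nonempty ((↑S : Set (Fin n))ᶜ : Set (Fin n)) := ⟨⟨j, by simpa using hj⟩⟩
  refine SimpleGraph.Connected.mk fun a b => ?_
  by_cases hab : a = b
  · rw [hab]
  · refine SimpleGraph.Adj.reachable (SimpleGraph.induce_adj.2 (fromRel_dist_adj.2 ⟨?_, hle _ _⟩))
    exact fun h => hab (Subtype.ext h)

/-- If the two critical radii differ, then at some radius in `[r₀, 2 r₀]` there are two well
separated clusters of sample points, each with at most `k` other points within distance `r₀`. -/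
theorem exists_clusters (hn : k + 2 ≤ n) {r₀ : ℝ} (hr₀ : 0 < r₀)
    (hne : sInf (degRadii X k) ≠ sInf (connRadii X k))
    (h1 : r₀ ∉ degRadii X k) (h2 : 2 * r₀ ∈ degRadii X k) :
    ∃ (A : Bool → Set (Fin n)) (S : Finset (Fin n)), S.card ≤ k ∧
      (∀ b, ∃ i ∈ A b, ∃ j ∈ A b, i ≠ j) ∧
      (∀ b, RStepConn r₀ (X '' A b)) ∧
      (∀ b, ∀ i ∈ A b, ∀ j, dist (X i) (X j) ≤ r₀ → j ∈ A b ∨ j ∈ S) ∧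
      (∀ i ∈ A false, ∀ j ∈ A true, r₀ < dist (X i) (X j)) := by
  classical
  have hbdd : BddBelow (degRadii X k) := ⟨0, fun r hr => hr.1.le⟩
  have hle := csInf_le_csInf hbdd (connRadii_nonempty (X := X) hn) connRadii_subset_degRadii
  obtain ⟨r₁, hr₁, hlt⟩ := exists_lt_of_csInf_lt
    ((connRadii_nonempty (X := X) hn).mono connRadii_subset_degRadii) (lt_of_le_of_ne hle hne)
  have hr01 : r₀ < r₁ := by
    by_contra! hcon
    exact h1 ⟨hr₀, fun i => (hr₁.2 i).trans
      (Set.ncard_le_ncard (fun j hj => ⟨hj.1, hj.2.trans hcon⟩) (Set.toFinite _))⟩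
  set r := min r₁ (2 * r₀) with hr
  have hr0 : r₀ ≤ r := le_min hr01.le (by linarith)
  have hr2 : r ≤ 2 * r₀ := min_le_right _ _
  have hdeg : r ∈ degRadii X k := by
    rcases min_choice r₁ (2 * r₀) with h | h <;> rw [hr, h] <;> assumption
  have hnot : r ∉ connRadii X k := fun hmem =>
    (csInf_le ⟨0, fun r hr => hr.1.le⟩ hmem).not_gt ((min_le_left _ _).trans_lt hlt)
  have hrpos : 0 < r := hr₀.trans_le hr0
  have : ∃ S : Finset (Fin n), S.card ≤ k ∧
      ¬((SimpleGraph.fromRel fun i j : Fin n => dist (X i) (X j) ≤ r).induce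
        ((↑S : Set (Fin n))ᶜ)).Connected := by
    by_contra! hcon
    exact hnot ⟨hrpos, hn, hcon⟩
  obtain ⟨S, hS, hSc⟩ := this
  set G := (SimpleGraph.fromRel fun i j : Fin n => dist (X i) (X j) ≤ r).induce
        ((↑S : Set (Fin n))ᶜ) with hG
  have hadj : ∀ a b, G.Adj a b ↔ a.1 ≠ b.1 ∧ dist (X a) (X b) ≤ r := fun a b => by
    rw [hG, SimpleGraph.induce_adj, fromRel_dist_adj]
  obtain ⟨j, hj, -⟩ := exists_notMem_of_card_le hn hS ⟨0, by omega⟩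
  have hnonempty : Nonempty ((↑S : Set (Fin n))ᶜ : Set (Fin n)) := ⟨⟨j, by simpa using hj⟩⟩
  have hpre : ¬ G.Preconnected := fun hp => hSc (SimpleGraph.Connected.mk hp)
  unfold SimpleGraph.Preconnected at hpre
  push Not at hpre
  obtain ⟨u, v, huv⟩ := hpre
  set w : Bool → ((↑S : Set (Fin n))ᶜ : Set (Fin n)) := fun b => if b then v else u with hw
  refine ⟨fun b => {i | ∃ h, G.Reachable (w b) ⟨i, h⟩}, S, hS, ?_, ?_, ?_, ?_⟩
  · intro b
    refine ⟨w b, ⟨(w b).2, SimpleGraph.Reachable.refl _⟩, ?_⟩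
    have hd := hdeg.2 (w b)
    have : ¬ {j : Fin n | j ≠ w b ∧ dist (X (w b)) (X j) ≤ r} ⊆ ↑S := fun hsub => by
      have := Set.ncard_le_ncard hsub (Set.toFinite _)
      rw [Set.ncard_coe_finset] at this
      omega
    obtain ⟨i, ⟨hi1, hi2⟩, hi3⟩ := Set.not_subset.1 this
    exact ⟨i, ⟨hi3, SimpleGraph.Adj.reachable ((hadj _ _).2 ⟨hi1.symm, hi2⟩)⟩, hi1.symm⟩
  · rintro b _ ⟨i, ⟨hi, hwi⟩, rfl⟩ l hl ⟨_, ⟨j, ⟨hj, hwj⟩, rfl⟩, hlj⟩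
    by_contra! hcon
    have hcon' : ∀ x h, G.Reachable (w b) ⟨x, h⟩ → l ≤ dist (X x) (X i) →
        l + 2 * r₀ < dist (X x) (X i) := fun x h hx hlx => hcon _ ⟨x, ⟨h, hx⟩, rfl⟩ hlx
    have hPi : dist (X i) (X i) < l := by
      by_contra! h
      have := hcon' i hi hwi h
      rw [dist_self] at this
      linarith
    have := reachable_induction
      (P := fun x => G.Reachable (w b) x ∧ dist (X x.1) (X i) < l) (hwi.symm.trans hwj) ⟨hwi, hPi⟩
      (by
        rintro x y hxy ⟨hwx, hx⟩
        have hwy := hwx.trans hxy.reachable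
        refine ⟨hwy, ?_⟩
        by_contra! hly
        have h3 := hcon' y.1 y.2 hwy hly
        have h4 := ((hadj _ _).1 hxy).2
        have := dist_triangle_left (X y.1) (X i) (X x.1)
        linarith)
    exact this.2.not_ge hlj
  · rintro b i ⟨hi, hwi⟩ j hij
    by_cases hj : j ∈ S
    · exact Or.inr hj
    left
    refine ⟨hj, ?_⟩
    by_cases hij' : i = j
    · subst hij'; exact hwi
    · exact hwi.trans (SimpleGraph.Adj.reachable ((hadj ⟨i, hi⟩ ⟨j, hj⟩).2 ⟨hij', hij.trans hr0⟩))
  · rintro i ⟨hi, hwi⟩ j ⟨hj, hwj⟩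
    by_contra! hcon
    simp only [hw, Bool.false_eq_true, if_false, if_true] at hwi hwj
    by_cases hij : i = j
    · subst hij; exact huv (hwi.trans hwj.symm)
    · exact huv ((hwi.trans (SimpleGraph.Adj.reachable
        ((hadj ⟨i, hi⟩ ⟨j, hj⟩).2 ⟨hij, hcon.trans hr0⟩))).trans hwj.symm)

end Graph

section Events

open Classical in
lemma cnt_removeNth_eq {E : Type*} {m : ℕ} (D : Set E) (X : Fin (m + 1) → E) (i : Fin (m + 1)) :
    cnt D (i.removeNth X) = {j | j ≠ i ∧ X j ∈ D}.ncard := by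
  have e : {j | j ≠ i ∧ X j ∈ D} =
      i.succAbove '' ↑(Finset.univ.filter fun l : Fin m => i.removeNth X l ∈ D) := by
    ext j
    simp only [Finset.coe_filter, Finset.mem_univ, true_and, Set.mem_image, Set.mem_ofPred_eq]
    constructor
    · rintro ⟨hj, hD⟩
      obtain ⟨l, rfl⟩ := Fin.exists_succAbove_eq hj
      exact ⟨l, hD, rfl⟩
    · rintro ⟨l, hl, rfl⟩
      exact ⟨Fin.succAbove_ne _ _, hl⟩
  rw [e, Set.ncard_image_of_injective _ (Fin.succAbove_right_injective), Set.ncard_coe_finset]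
  rfl

lemma cnt_removeNth_lt_of_subset {E : Type*} {m k : ℕ} {D : Set E} {X : Fin (m + 1) → E}
    {i : Fin (m + 1)} {S : Finset (Fin (m + 1))} (hS : S.card ≤ k)
    (h : ∀ j, j ≠ i → X j ∈ D → j ∈ S) : cnt D (i.removeNth X) < k + 1 := by
  rw [cnt_removeNth_eq]
  have := Set.ncard_le_ncard (t := ↑S) (fun j (hj : j ≠ i ∧ X j ∈ D) => h j hj.1 hj.2)
    (Set.toFinite _)
  rw [Set.ncard_coe_finset] at this
  exact Nat.lt_succ_of_le (le_trans this hS)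

lemma cnt_removeNth_le {E : Type*} {m : ℕ} (D : Set E) (X : Fin (m + 1) → E) (i : Fin (m + 1)) :
    cnt D (i.removeNth X) ≤ cnt D X := by
  classical
  rw [cnt_removeNth_eq, cnt, ← Set.ncard_coe_finset]
  exact Set.ncard_le_ncard (fun j hj => by simpa using hj.2) (Set.toFinite _)

/-- The pairs of points at distance at most `r`. -/
def closeSet (r : ℝ) : Set (E3 × E3) := {w | dist w.1 w.2 ≤ r}

/-- The event that the `i`-th point has at most `k` other points within distance `r`. -/
def lowDeg {m : ℕ} (k : ℕ) (r : ℝ) (i : Fin (m + 1)) : Set (Fin (m + 1) → E3) :=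
  {X | cnt {y | (X i, y) ∈ closeSet r} (i.removeNth X) < k + 1}

lemma mem_degRadii_iff {m k : ℕ} {r : ℝ} (hr : 0 < r) {X : Fin (m + 1) → E3} :
    r ∈ degRadii X k ↔ ∀ i, X ∉ lowDeg k r i := by
  simp only [degRadii, lowDeg, closeSet, Set.mem_ofPred_eq, hr, true_and, not_lt, cnt_removeNth_eq]

/-- Pairs of close points for which the ball around the second has large excess. -/
def pairSet (μ : Measure E3) (e r : ℝ) : Set (E3 × E3) :=
  {w | dist w.1 w.2 ≤ 2 * r ∧
    e * r ^ 2 * dist w.1 w.2 ≤ μ.real (closedBall w.2 r \ closedBall w.1 r)}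

/-- Points in the ball around the first point of a pair, outside a small concentric ball. -/
def shellSet (η r : ℝ) : Set ((E3 × E3) × E3) :=
  {z | dist z.1.1 z.2 ≤ r ∧ min (dist z.1.1 z.1.2) (η * r) < dist z.1.1 z.2}

/-- Points in the ball around the second point of a pair but not in that around the first. -/
def luneSet (r : ℝ) : Set ((E3 × E3) × E3) := {z | dist z.1.2 z.2 ≤ r ∧ r < dist z.1.1 z.2}

/-- The event that a pair of close points sees few further points. -/
def pairEv {m : ℕ} (μ : Measure E3) (k : ℕ) (e η r : ℝ) (i : Fin (m + 2)) (j : Fin (m + 1)) :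
    Set (Fin (m + 2) → E3) :=
  {X | (X i, i.removeNth X j) ∈ pairSet μ e r ∧
    cnt {z | ((X i, i.removeNth X j), z) ∈ shellSet η r} (j.removeNth (i.removeNth X)) < k + 1 ∧
    cnt {z | ((X i, i.removeNth X j), z) ∈ luneSet r} (j.removeNth (i.removeNth X)) < k + 1}

/-- The grid cell of side `s` containing `q`. -/
noncomputable def cell (s : ℝ) (q : E3) : Fin 3 → ℤ := fun l => ⌊q l / s⌋

/-- The cube of cells with indices between `-L` and `L`. -/
noncomputable def cellBox (L : ℤ) : Finset (Fin 3 → ℤ) := Fintype.piFinset fun _ => Finset.Icc (-L) L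

/-- Pairs whose difference lies in one of the cells of `𝒞`. -/
def cellSet (s : ℝ) (𝒞 : Finset (Fin 3 → ℤ)) : Set (E3 × E3) := {w | cell s (w.2 - w.1) ∈ 𝒞}

/-- The event that the `i`-th point lies in `Θ` and sees few other points in the cells of `𝒞`. -/
def sparseEv {m : ℕ} (k : ℕ) (s : ℝ) (𝒞 : Finset (Fin 3 → ℤ)) (Θ : Set E3) (i : Fin (m + 1)) :
    Set (Fin (m + 1) → E3) :=
  {X | X i ∈ Θ ∧ cnt {y | (X i, y) ∈ cellSet s 𝒞} (i.removeNth X) < k + 1}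

/-- Points where the cells of `𝒞` weigh more than the ball of radius `r`, by `t`. -/
def heavy (μ : Measure E3) (r s t : ℝ) (𝒞 : Finset (Fin 3 → ℤ)) : Set E3 :=
  {x | μ.real (closedBall x r) + t ≤ μ.real {y | (x, y) ∈ cellSet s 𝒞}}

/-- Points near `F` where the cells of `𝒞` weigh at least `t`. -/
def heavyNear (μ : Measure E3) (F : Finset E3) (r s t : ℝ) (𝒞 : Finset (Fin 3 → ℤ)) : Set E3 :=
  {x | (∃ v ∈ F, dist x v ≤ r) ∧ t ≤ μ.real {y | (x, y) ∈ cellSet s 𝒞}}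

lemma dist_le_of_cell_eq {s : ℝ} (hs : 0 < s) {q w : E3} (h : cell s q = cell s w) :
    dist q w ≤ 2 * s := by
  have hl : ∀ l, dist (q l) (w l) ^ 2 ≤ s ^ 2 := by
    intro l
    have := Int.abs_sub_lt_one_of_floor_eq_floor (congrFun h l)
    rw [← sub_div, abs_div, abs_of_pos hs, div_lt_one hs] at this
    rw [Real.dist_eq]
    gcongr
  rw [EuclideanSpace.dist_eq, Real.sqrt_le_left (by positivity), Fin.sum_univ_three]
  nlinarith [hl 0, hl 1, hl 2]

lemma cell_mem_cellBox {s : ℝ} (hs : 0 < s) {q : E3} {L : ℕ} (h : ‖q‖ ≤ L * s) :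
    cell s q ∈ cellBox L := by
  rw [cellBox, Fintype.mem_piFinset]
  intro l
  have h1 : |q l| ≤ L * s := by
    have := PiLp.norm_apply_le q l
    rw [Real.norm_eq_abs] at this
    exact this.trans h
  rw [abs_le] at h1
  rw [Finset.mem_Icc]
  constructor
  · refine Int.le_floor.2 ?_
    rw [le_div_iff₀ hs]
    push_cast
    linarith
  · have h2 : (⌊q l / s⌋ : ℝ) ≤ L := (Int.floor_le _).trans (by rw [div_le_iff₀ hs]; exact h1.2)
    exact_mod_cast h2

lemma exists_cells {m k : ℕ} {Ω : Set E3} {X : Fin (m + 1) → E3} {A : Set (Fin (m + 1))}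
    {S : Finset (Fin (m + 1))} (hS : S.card ≤ k) {r τ K : ℝ} (hr : 0 < r) (hτ : 0 < τ) {L : ℕ}
    (hL : K ≤ L * (τ / 2)) {i : Fin (m + 1)} (hi : i ∈ A)
    (hAS : ∀ i ∈ A, ∀ j, dist (X i) (X j) ≤ r → j ∈ A ∨ j ∈ S) :
    ∃ 𝒞 ⊆ cellBox L,
      cnt {y | (X i, y) ∈ cellSet (τ / 2 * r) 𝒞} (i.removeNth X) < k + 1 ∧
      rgap (X '' A) τ r ∩ Ω ∩ closedBall (X i) (K * r) ⊆
        {y | (X i, y) ∈ cellSet (τ / 2 * r) 𝒞} ∩ Ω := by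
  classical
  have hs : 0 < τ / 2 * r := by positivity
  set W := rgap (X '' A) τ r ∩ Ω ∩ closedBall (X i) (K * r) with hW
  refine ⟨(cellBox L).filter fun c => ∃ q ∈ W, cell (τ / 2 * r) (q - X i) = c,
    Finset.filter_subset _ _, cnt_removeNth_lt_of_subset hS fun j _ hj => ?_, fun q hq => ⟨?_, hq.1.2⟩⟩
  · simp only [cellSet, Finset.mem_filter, Set.mem_ofPred_eq] at hj
    obtain ⟨-, q, hq, hqj⟩ := hj
    have hd := dist_le_of_cell_eq hs hqj
    rw [dist_sub_right] at hd
    have hd1 := infDist_le_infDist_add_dist (s := X '' A) (x := q) (y := X j)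
    have hd2 := infDist_le_infDist_add_dist (s := X '' A) (x := X j) (y := q)
    rw [dist_comm] at hd2
    obtain ⟨hq1, hq2⟩ := hq.1.1
    have hτr : 0 < τ * r := by positivity
    obtain ⟨_, ⟨a, ha, rfl⟩, hja⟩ := (infDist_lt_iff (s := X '' A) (x := X j) (r := r)
      ⟨X i, i, hi, rfl⟩).1 (by linarith)
    rw [dist_comm] at hja
    refine (hAS a ha j hja.le).resolve_left fun hjA => ?_
    have := infDist_zero_of_mem (Set.mem_image_of_mem X hjA)
    linarith
  · simp only [cellSet, Finset.mem_filter, Set.mem_ofPred_eq]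
    refine ⟨cell_mem_cellBox hs ?_, q, hq, rfl⟩
    have := hq.2
    rw [mem_closedBall, dist_eq_norm] at this
    refine this.trans ?_
    calc K * r ≤ L * (τ / 2) * r := by gcongr
      _ = _ := by ring

lemma mem_pairEv_of_cluster {m k : ℕ} {μ : Measure E3} {e η r : ℝ} (hη : η ≤ 1) (hr : 0 < r)
    {X : Fin (m + 2) → E3} {A : Set (Fin (m + 2))} {S : Finset (Fin (m + 2))} (hS : S.card ≤ k)
    (hAS : ∀ i ∈ A, ∀ j, dist (X i) (X j) ≤ r → j ∈ A ∨ j ∈ S) {i j : Fin (m + 2)} (hij : i ≠ j)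
    (hi : i ∈ A) (hj : j ∈ A) (hmax : ∀ l ∈ A, dist (X i) (X l) ≤ dist (X i) (X j))
    (hd : dist (X i) (X j) < η * r)
    (hmem : (X i, X j) ∈ pairSet μ e r) : ∃ i j, X ∈ pairEv (m := m) μ k e η r i j := by
  obtain ⟨j, rfl⟩ := Fin.exists_succAbove_eq hij.symm
  refine ⟨i, j, hmem, ?_, ?_⟩
  · refine (cnt_removeNth_le _ _ _).trans_lt (cnt_removeNth_lt_of_subset hS fun l _ hl => ?_)
    obtain ⟨hl1, hl2⟩ := hl
    refine (hAS i hi l hl1).resolve_left fun hlA => ?_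
    change min (dist (X i) (X (i.succAbove j))) (η * r) < dist (X i) (X l) at hl2
    rw [min_eq_left hd.le] at hl2
    exact (hmax l hlA).not_gt hl2
  · refine (cnt_removeNth_le _ _ _).trans_lt (cnt_removeNth_lt_of_subset hS fun l _ hl => ?_)
    obtain ⟨hl1, hl2⟩ := hl
    refine (hAS _ hj l hl1).resolve_left fun hlA => ?_
    have h1 := (hmax l hlA).trans_lt hd
    have h2 : r < dist (X i) (X l) := hl2
    nlinarith

/-- The dichotomy for the excess volume of two nearby balls. -/
def LuneDich (Ω : Set E3) (e r : ℝ) : Prop :=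
  ∀ x ∈ Ω, ∀ y ∈ Ω, dist x y ≤ 2 * r →
    (x, y) ∈ pairSet (volume.restrict Ω) e r ∨ (y, x) ∈ pairSet (volume.restrict Ω) e r

lemma Body.exists_luneDich {Ω : Set E3} {p : E3} {ρ D : ℝ} (h : Body Ω p ρ D 1) :
    ∃ e r₁ : ℝ, 0 < e ∧ 0 < r₁ ∧ ∀ r, 0 < r → r ≤ r₁ → LuneDich Ω e r := by
  obtain ⟨e, r₁, he, hr₁, hlune⟩ := h.exists_vol_diff_ge
  refine ⟨e, r₁, he, hr₁, fun r hr hr1 x hx y hy hxy => ?_⟩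
  have hΩm : MeasurableSet Ω := h.comp.measurableSet
  simp only [pairSet, Set.mem_ofPred_eq, dist_comm y x, measureReal_restrict_apply' hΩm, hxy,
    true_and]
  exact hlune r hr hr1 x hx y hy hxy

/-- The event that the two critical radii differ. -/
def badEv (m k : ℕ) : Set (Fin m → E3) := {X | sInf (degRadii X k) ≠ sInf (connRadii X k)}

theorem Body.exists_badEv_subset {Ω : Set E3} {p : E3} {ρ D : ℝ} (h : Body Ω p ρ D 1) :
    ∀ η > 0, η ≤ 1 →
      ∃ (c τ C r₁ : ℝ) (L : ℕ) (F : Finset E3), 0 < c ∧ 0 < τ ∧ 0 < C ∧ 0 < r₁ ∧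
      ∀ e r : ℝ, 0 < r → r ≤ r₁ → LuneDich Ω e r →
      ∀ k m : ℕ, k ≤ m → ∀ X : Fin (m + 2) → E3, (∀ i, X i ∈ Ω) → X ∈ badEv (m + 2) k →
        (∀ i, X ∉ lowDeg k r i) ∨ (∃ i, X ∈ lowDeg k (2 * r) i) ∨
        (∃ i j, X ∈ pairEv (volume.restrict Ω) k e η r i j) ∨
        (∃ i, ∃ 𝒞 ⊆ cellBox L,
          X ∈ sparseEv k (τ * r) 𝒞 (heavy (volume.restrict Ω) r (τ * r) (c * r ^ 3) 𝒞) i ∨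
          X ∈ sparseEv k (τ * r) 𝒞
            (heavyNear (volume.restrict Ω) F (C * r) (τ * r) (c * r ^ 3) 𝒞) i) := by
  classical
  intro η hη hη1
  obtain ⟨c, τ, K, C, r₂, F, hc, hτ, hK, hC, hr₂, hclus⟩ := h.exists_cluster_rgap hη
  obtain ⟨L, hL⟩ := exists_nat_ge (K / (τ / 2))
  rw [div_le_iff₀ (by positivity)] at hL
  refine ⟨c, τ / 2, C, r₂, L, F, hc, by positivity, hC, hr₂, ?_⟩
  intro e r hr hrle hlune k m hkm X hX hbad
  by_cases h1 : ∀ i, X ∉ lowDeg k r i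
  · exact Or.inl h1
  by_cases h2 : ∃ i, X ∈ lowDeg k (2 * r) i
  · exact Or.inr (Or.inl h2)
  refine Or.inr (Or.inr ?_)
  obtain ⟨A, S, hS, hpair, hstep, hAS, hsep⟩ := exists_clusters (by omega) hr hbad
    (fun hmem => h1 ((mem_degRadii_iff hr).1 hmem))
    ((mem_degRadii_iff (by positivity)).2 fun i hi => h2 ⟨i, hi⟩)
  have hΩm : MeasurableSet Ω := h.comp.measurableSet
  have hμ : ∀ T : Set E3, (volume.restrict Ω).real T = volume.real (T ∩ Ω) := fun T =>
    measureReal_restrict_apply' hΩm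
  by_cases hdiam : ∀ b, ∃ a ∈ X '' A b, ∃ a' ∈ X '' A b, η * r ≤ dist a a'
  · right
    obtain ⟨b, _, ⟨i, hi, rfl⟩, hout⟩ := hclus r hr hrle
      (fun b => X '' A b) (fun b => (Set.toFinite _).image X)
      (fun b => by rintro _ ⟨i, -, rfl⟩; exact hX i) hstep hdiam
      (by rintro _ ⟨i, hi, rfl⟩ _ ⟨j, hj, rfl⟩; exact hsep i hi j hj)
    obtain ⟨𝒞, h𝒞, hcnt, hsub⟩ := exists_cells (Ω := Ω) hS hr hτ hL hi (hAS b)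
    have hle := measureReal_mono hsub (μ := volume)
      (measure_ne_top_of_subset Set.inter_subset_right h.comp.measure_ne_top)
    refine ⟨i, 𝒞, h𝒞, hout.imp (fun h => ⟨?_, hcnt⟩) (fun h => ⟨⟨h.1, ?_⟩, hcnt⟩)⟩
    · simp only [heavy, Set.mem_ofPred_eq, hμ]
      exact h.trans hle
    · simp only [hμ]
      exact h.2.trans hle
  · left
    push Not at hdiam
    obtain ⟨b, hb⟩ := hdiam
    obtain ⟨i₀, hi₀, j₀, hj₀, hij₀⟩ := hpair b
    obtain ⟨⟨i, j⟩, hmem, hmax⟩ := Finset.exists_max_image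
      (Finset.univ.filter fun w : Fin (m + 2) × Fin (m + 2) =>
        w.1 ∈ A b ∧ w.2 ∈ A b ∧ w.1 ≠ w.2) (fun w => dist (X w.1) (X w.2))
      ⟨(i₀, j₀), by simp [hi₀, hj₀, hij₀]⟩
    simp only [Finset.mem_filter, Finset.mem_univ, true_and, and_imp, Prod.forall] at hmem hmax
    obtain ⟨hi, hj, hij⟩ := hmem
    have hmax' : ∀ l ∈ A b, ∀ l' ∈ A b, dist (X l) (X l') ≤ dist (X i) (X j) := by
      intro l hl l' hl'
      by_cases hll : l = l'
      · rw [hll, dist_self]; exact dist_nonneg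
      · exact hmax l l' hl hl' hll
    have hd : dist (X i) (X j) < η * r := hb _ ⟨i, hi, rfl⟩ _ ⟨j, hj, rfl⟩
    have hd2 : dist (X i) (X j) ≤ 2 * r := by nlinarith
    rcases hlune _ (hX i) _ (hX j) hd2 with hcase | hcase
    · exact mem_pairEv_of_cluster hη1 hr hS (hAS b) hij hi hj (hmax' i hi) hd hcase
    · refine mem_pairEv_of_cluster hη1 hr hS (hAS b) hij.symm hj hi (fun l hl => ?_)
        (by rwa [dist_comm]) hcase
      rw [dist_comm (X j) (X i)]; exact hmax' j hj l hl

end Events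

section Bounds

/-- Expected chance that a sample point has at most `k` of `m` others within distance `r`. -/
noncomputable def lowMean (μ : Measure E3) (k m : ℕ) (r : ℝ) : ℝ :=
  ∫ x, btail (μ.real (closedBall x r)) m (k + 1) ∂μ

lemma closeSet_slice (r : ℝ) (x : E3) : {y | (x, y) ∈ closeSet r} = closedBall x r := by
  ext y
  simp [closeSet, dist_comm]

lemma measurableSet_closeSet (r : ℝ) : MeasurableSet (closeSet r) := by
  unfold closeSet
  exact measurableSet_le (by fun_prop) (by fun_prop)

lemma measureReal_closedBall_le {μ : Measure E3} (hμ : μ ≤ volume) (x : E3) {r : ℝ} (hr : 0 ≤ r) :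
    μ.real (closedBall x r) ≤ r ^ 3 * β := by
  rw [← vol_closedBall x hr, measureReal_def, measureReal_def]
  exact ENNReal.toReal_mono measure_closedBall_lt_top.ne (hμ _)

variable {μ : Measure E3} [IsProbabilityMeasure μ] (hμ : μ ≤ volume)

include hμ in
lemma continuous_btail_ball (k m : ℕ) :
    Continuous fun q : E3 × ℝ => btail (μ.real (closedBall q.1 q.2)) m k :=
  (continuous_btail m k).comp
    (continuous_measureReal_closedBall μ (Measure.absolutelyContinuous_of_le hμ))

include hμ in
lemma integrable_btail_ball (k m : ℕ) (r : ℝ) :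
    Integrable (fun x => btail (μ.real (closedBall x r)) m k) μ := by
  refine Integrable.of_bound (C := 1) ?_ ?_
  · exact ((continuous_btail_ball hμ k m).comp
      (by fun_prop : Continuous fun x : E3 => (x, r))).aestronglyMeasurable
  · refine ae_of_all _ fun x => ?_
    rw [Real.norm_of_nonneg (btail_nonneg measureReal_nonneg measureReal_le_one _ _)]
    exact btail_le_one measureReal_nonneg measureReal_le_one _ _

lemma lowMean_nonneg (k m : ℕ) (r : ℝ) : 0 ≤ lowMean μ k m r :=
  integral_nonneg fun _ => btail_nonneg measureReal_nonneg measureReal_le_one _ _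

include hμ in
lemma ofReal_lowMean (k m : ℕ) (r : ℝ) :
    ENNReal.ofReal (lowMean μ k m r) =
      ∫⁻ x, ENNReal.ofReal (btail (μ.real (closedBall x r)) m (k + 1)) ∂μ :=
  ofReal_integral_eq_lintegral_ofReal (integrable_btail_ball hμ _ _ _)
    (ae_of_all _ fun _ => btail_nonneg measureReal_nonneg measureReal_le_one _ _)

include hμ in
lemma continuous_lowMean (k m : ℕ) : Continuous (lowMean μ k m) := by
  refine continuous_of_dominated (F := fun r x => btail (μ.real (closedBall x r)) m (k + 1))
    (bound := fun _ => 1) (fun r => ?_) (fun r => ae_of_all _ fun x => ?_)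
    (integrable_const 1) (ae_of_all _ fun x => ?_)
  · exact (integrable_btail_ball hμ (k + 1) m r).aestronglyMeasurable
  · rw [Real.norm_of_nonneg (btail_nonneg measureReal_nonneg measureReal_le_one _ _)]
    exact btail_le_one measureReal_nonneg measureReal_le_one _ _
  · have hx : Continuous fun r : ℝ => ((x, r) : E3 × ℝ) := Continuous.prodMk_right x
    have hc := (continuous_btail_ball hμ (k + 1) m).comp hx
    exact hc

include hμ in
lemma lowMean_le_succ {k m : ℕ} {r q : ℝ} (hr : 0 ≤ r) (hq : r ^ 3 * β ≤ q) :
    (1 - q) * lowMean μ k m r ≤ lowMean μ k (m + 1) r := by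
  unfold lowMean
  rw [← integral_const_mul]
  refine integral_mono ((integrable_btail_ball hμ _ _ _).const_mul _)
    (integrable_btail_ball hμ _ _ _) fun x => ?_
  have h1 := measureReal_closedBall_le hμ x hr
  have hn := btail_nonneg (measureReal_nonneg (μ := μ) (s := closedBall x r)) measureReal_le_one m (k + 1)
  refine le_trans ?_ (one_sub_mul_btail_le measureReal_nonneg measureReal_le_one _ _)
  exact mul_le_mul_of_nonneg_right (by linarith) hn

lemma measurableSet_lowDeg {k m : ℕ} (r : ℝ) (i : Fin (m + 1)) :
    MeasurableSet (lowDeg k r i) :=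
  measurableSet_cnt_removeNth i _ (measurableSet_closeSet r)

include hμ in
lemma pi_lowDeg {k m : ℕ} (r : ℝ) (i : Fin (m + 1)) :
    (Measure.pi fun _ : Fin (m + 1) => μ).real (lowDeg k r i) = lowMean μ k m r := by
  have := pi_mem_cnt_lt μ i (k + 1) MeasurableSet.univ (measurableSet_closeSet r)
  simp only [Set.mem_univ, true_and, Measure.restrict_univ, closeSet_slice] at this
  rw [measureReal_def, lowDeg]
  simp only [closeSet_slice]
  rw [this, ← ofReal_lowMean hμ, ENNReal.toReal_ofReal (lowMean_nonneg _ _ _)]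

lemma measurable_cell (s : ℝ) : Measurable (cell s) := by
  refine measurable_pi_lambda _ fun l => ?_
  unfold cell
  exact Int.measurable_floor.comp (by fun_prop)

lemma measurableSet_cellSet (s : ℝ) (𝒞 : Finset (Fin 3 → ℤ)) : MeasurableSet (cellSet s 𝒞) := by
  have : Measurable fun w : E3 × E3 => cell s (w.2 - w.1) := (measurable_cell s).comp (by fun_prop)
  exact this (MeasurableSet.of_discrete (s := (𝒞 : Set (Fin 3 → ℤ))))

lemma measurable_measureReal_slice {S : Set (E3 × E3)} (hS : MeasurableSet S) :
    Measurable fun x => μ.real {y | (x, y) ∈ S} :=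
  (measurable_measure_prodMk_left hS).ennreal_toReal

include hμ in
lemma measurable_measureReal_closedBall (r : ℝ) : Measurable fun x => μ.real (closedBall x r) :=
  ((continuous_measureReal_closedBall μ (Measure.absolutelyContinuous_of_le hμ)).comp
      (by fun_prop : Continuous fun x : E3 => (x, r))).measurable

include hμ in
lemma pi_sparseEv_heavy_le {k m : ℕ} {r s t : ℝ} (ht : 0 ≤ t) (𝒞 : Finset (Fin 3 → ℤ))
    (i : Fin (m + 1)) :
    (Measure.pi fun _ : Fin (m + 1) => μ).real (sparseEv k s 𝒞 (heavy μ r s t 𝒞) i) ≤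
      2 ^ (k + 1) * exp (-(m * t / 2)) * lowMean μ k m r := by
  have hΘ : MeasurableSet (heavy μ r s t 𝒞) :=
    measurableSet_le ((measurable_measureReal_closedBall hμ r).add_const _)
      (measurable_measureReal_slice (measurableSet_cellSet s 𝒞))
  have h0 : (0 : ℝ) ≤ 2 ^ (k + 1) * exp (-(m * t / 2)) := by positivity
  rw [measureReal_def]
  refine ENNReal.toReal_le_of_le_ofReal (mul_nonneg h0 (lowMean_nonneg _ _ _)) ?_
  rw [sparseEv, pi_mem_cnt_lt μ i (k + 1) hΘ (measurableSet_cellSet s 𝒞), ENNReal.ofReal_mul h0,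
    ofReal_lowMean hμ, ← lintegral_const_mul' _ _ ENNReal.ofReal_ne_top]
  refine (setLIntegral_mono' hΘ fun x hx => ?_).trans (setLIntegral_le_lintegral _ _)
  rw [← ENNReal.ofReal_mul h0]
  refine ENNReal.ofReal_le_ofReal ?_
  have hx' : μ.real (closedBall x r) + t ≤ μ.real {y | (x, y) ∈ cellSet s 𝒞} := hx
  have h1 : μ.real {y | (x, y) ∈ cellSet s 𝒞} ≤ 1 := measureReal_le_one
  have hb : (0 : ℝ) ≤ μ.real (closedBall x r) := measureReal_nonneg
  calc _ ≤ btail (μ.real (closedBall x r) + t) m (k + 1) := btail_anti (by positivity) hx' h1 _ _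
    _ ≤ btail (μ.real (closedBall x r)) m (k + 1) * btail t m (k + 1) :=
        btail_add_le_mul hb ht (hx'.trans h1) _ _
    _ ≤ btail (μ.real (closedBall x r)) m (k + 1) * (2 ^ (k + 1) * exp (-(m * t / 2))) := by
        gcongr
        · exact btail_nonneg hb (by linarith) _ _
        · exact btail_le_exp ht (by linarith) _ _
    _ = _ := by ring

include hμ in
lemma pi_sparseEv_heavyNear_le {k m : ℕ} {r s t : ℝ} (hr : 0 ≤ r) (ht : 0 ≤ t) (F : Finset E3)
    (𝒞 : Finset (Fin 3 → ℤ)) (i : Fin (m + 1)) :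
    (Measure.pi fun _ : Fin (m + 1) => μ).real (sparseEv k s 𝒞 (heavyNear μ F r s t 𝒞) i) ≤
      2 ^ (k + 1) * exp (-(m * t / 2)) * (F.card * (r ^ 3 * β)) := by
  have hβ := β_pos
  have hN : {x : E3 | ∃ v ∈ F, dist x v ≤ r} = ⋃ v ∈ F, closedBall v r := by
    ext x; simp
  have hΘ : MeasurableSet (heavyNear μ F r s t 𝒞) := by
    refine MeasurableSet.inter (s₁ := {x : E3 | ∃ v ∈ F, dist x v ≤ r}) ?_
      (measurableSet_le measurable_const
      (measurable_measureReal_slice (measurableSet_cellSet s 𝒞)))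
    rw [hN]
    exact Finset.measurableSet_biUnion _ fun v _ => measurableSet_closedBall
  have h0 : (0 : ℝ) ≤ 2 ^ (k + 1) * exp (-(m * t / 2)) := by positivity
  have hle : μ.real (heavyNear μ F r s t 𝒞) ≤ F.card * (r ^ 3 * β) := by
    refine (measureReal_mono (s₂ := ⋃ v ∈ F, closedBall v r) ?_ (measure_ne_top _ _)).trans ?_
    · rw [← hN]; exact fun x hx => hx.1
    refine (measureReal_biUnion_finset_le _ _).trans ?_
    rw [← nsmul_eq_mul]
    exact Finset.sum_le_card_nsmul _ _ _ fun v _ => measureReal_closedBall_le hμ v hr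
  rw [measureReal_def]
  refine ENNReal.toReal_le_of_le_ofReal (by positivity) ?_
  rw [sparseEv, pi_mem_cnt_lt μ i (k + 1) hΘ (measurableSet_cellSet s 𝒞), ENNReal.ofReal_mul h0]
  refine (setLIntegral_mono' (g := fun _ => ENNReal.ofReal (2 ^ (k + 1) * exp (-(m * t / 2)))) hΘ
    fun x hx => ?_).trans ?_
  · refine ENNReal.ofReal_le_ofReal ?_
    have h1 : μ.real {y | (x, y) ∈ cellSet s 𝒞} ≤ 1 := measureReal_le_one
    exact (btail_anti ht hx.2 h1 _ _).trans (btail_le_exp ht (hx.2.trans h1) _ _)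
  · rw [setLIntegral_const]
    gcongr
    rw [← ofReal_measureReal]
    exact ENNReal.ofReal_le_ofReal hle

end Bounds

section PairBounds

lemma measurableSet_shellSet (η r : ℝ) : MeasurableSet (shellSet η r) := by
  have h1 : MeasurableSet {z : (E3 × E3) × E3 | dist z.1.1 z.2 ≤ r} :=
    measurableSet_le (by fun_prop) (by fun_prop)
  have h2 : MeasurableSet {z : (E3 × E3) × E3 | min (dist z.1.1 z.1.2) (η * r) < dist z.1.1 z.2} :=
    measurableSet_lt (by fun_prop) (by fun_prop)
  exact h1.inter h2

lemma measurableSet_luneSet (r : ℝ) : MeasurableSet (luneSet r) := by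
  have h1 : MeasurableSet {z : (E3 × E3) × E3 | dist z.1.2 z.2 ≤ r} :=
    measurableSet_le (by fun_prop) (by fun_prop)
  have h2 : MeasurableSet {z : (E3 × E3) × E3 | r < dist z.1.1 z.2} :=
    measurableSet_lt (by fun_prop) (by fun_prop)
  exact h1.inter h2

lemma luneSet_slice (r : ℝ) (w : E3 × E3) :
    {z | (w, z) ∈ luneSet r} = closedBall w.2 r \ closedBall w.1 r := by
  ext z
  simp [luneSet, dist_comm]

variable {μ : Measure E3} [IsProbabilityMeasure μ] (hμ : μ ≤ volume)

lemma measurableSet_pairSet (e r : ℝ) : MeasurableSet (pairSet μ e r) := by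
  have h0 : Measurable fun w : E3 × E3 => μ.real (closedBall w.2 r \ closedBall w.1 r) := by
    simp only [← luneSet_slice]
    exact (measurable_measure_prodMk_left (measurableSet_luneSet r)).ennreal_toReal
  have h2 : MeasurableSet {w : E3 × E3 |
      e * r ^ 2 * dist w.1 w.2 ≤ μ.real (closedBall w.2 r \ closedBall w.1 r)} :=
    measurableSet_le (by fun_prop) h0
  exact (measurableSet_closeSet (2 * r)).inter h2

include hμ in
lemma lintegral_indicator_exp_le (x : E3) {a r s : ℝ} (ha : 0 ≤ a) (hr : 0 ≤ r) (hs : 0 ≤ s) :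
    ∫⁻ y, (closeSet (2 * r)).indicator
        (fun w => ENNReal.ofReal (exp (-(a * dist w.1 w.2)))) (x, y) ∂μ ≤
      ENNReal.ofReal (s ^ 3 * β + (2 * r) ^ 3 * β * exp (-(a * s))) := by
  have hβ := β_pos
  have hle : ∀ y, (closeSet (2 * r)).indicator
        (fun w => ENNReal.ofReal (exp (-(a * dist w.1 w.2)))) (x, y) ≤
      (closedBall x s).indicator (fun _ => 1) y +
        (closedBall x (2 * r)).indicator (fun _ => ENNReal.ofReal (exp (-(a * s)))) y := by
    intro y
    by_cases h1 : (x, y) ∈ closeSet (2 * r)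
    · rw [Set.indicator_of_mem h1]
      by_cases h2 : dist y x ≤ s
      · rw [Set.indicator_of_mem (s := closedBall x s) h2]
        refine le_add_right ?_
        rw [ENNReal.ofReal_le_one, exp_le_one_iff, neg_nonpos]
        positivity
      · have h1' : y ∈ closedBall x (2 * r) := by
          rw [mem_closedBall, dist_comm]; exact h1
        rw [Set.indicator_of_mem h1']
        refine le_add_left (ENNReal.ofReal_le_ofReal (exp_le_exp.2 (neg_le_neg ?_)))
        rw [dist_comm] at h2
        exact mul_le_mul_of_nonneg_left (not_le.1 h2).le ha
    · rw [Set.indicator_of_notMem h1]; exact zero_le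
  refine (lintegral_mono hle).trans ?_
  rw [lintegral_add_left (by fun_prop (disch := exact measurableSet_closedBall)),
    lintegral_indicator_const measurableSet_closedBall,
    lintegral_indicator_const measurableSet_closedBall, one_mul, ← ofReal_measureReal,
    ← ofReal_measureReal, ← ENNReal.ofReal_mul (exp_nonneg _),
    ← ENNReal.ofReal_add measureReal_nonneg (mul_nonneg (exp_nonneg _) measureReal_nonneg)]
  refine ENNReal.ofReal_le_ofReal (add_le_add (measureReal_closedBall_le hμ x hs) ?_)
  rw [mul_comm]
  exact mul_le_mul_of_nonneg_right (measureReal_closedBall_le hμ x (by positivity)) (exp_nonneg _)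

lemma btail_le_exp_mul_btail {p v q : ℝ} (hp : 0 ≤ p) (hpv : p ≤ v) (hv : v ≤ 1 / 4)
    (hq : v - p ≤ q) (m k : ℕ) : btail p m k ≤ exp (4 * q * m) * btail v m k := by
  have h := pow_mul_btail_le (p := p) (q := v - p) (s := 1 - 2 * (v - p)) hp (by linarith)
    (by linarith) (by linarith) (by linarith) (by nlinarith) m k
  rw [add_sub_cancel] at h
  have h1 : 1 ≤ exp (4 * (v - p)) * (1 - 2 * (v - p)) := by
    have := add_one_le_exp (4 * (v - p))
    nlinarith
  have h2 : 1 ≤ exp (4 * (v - p) * m) * (1 - 2 * (v - p)) ^ m := by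
    rw [mul_comm _ (m : ℝ), exp_nat_mul, ← mul_pow]
    exact one_le_pow₀ h1
  have hb := btail_nonneg hp (by linarith) m k
  have hbv := btail_nonneg (hp.trans hpv) (by linarith) m k
  calc btail p m k ≤ (exp (4 * (v - p) * m) * (1 - 2 * (v - p)) ^ m) * btail p m k :=
        le_mul_of_one_le_left hb h2
    _ = exp (4 * (v - p) * m) * ((1 - 2 * (v - p)) ^ m * btail p m k) := by ring
    _ ≤ exp (4 * (v - p) * m) * btail v m k := by gcongr
    _ ≤ exp (4 * q * m) * btail v m k := by gcongr

include hμ in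
lemma pair_btail_le {e η r : ℝ} (hη : 0 ≤ η) (he : 16 * β * η ^ 2 ≤ e) (hr : 0 ≤ r)
    (hr3 : r ^ 3 * β ≤ 1 / 4) {w : E3 × E3} (hw : w ∈ pairSet μ e r) (m k : ℕ) :
    btail (μ.real {z | (w, z) ∈ shellSet η r}) m k * btail (μ.real {z | (w, z) ∈ luneSet r}) m k ≤
      2 ^ k * btail (μ.real (closedBall w.1 r)) m k * exp (-(e / 4 * m * r ^ 2 * dist w.1 w.2)) := by
  have hβ := β_pos
  set d := dist w.1 w.2 with hd
  have hd0 : 0 ≤ d := dist_nonneg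
  have hlune : e * r ^ 2 * d ≤ μ.real {z | (w, z) ∈ luneSet r} := by
    rw [luneSet_slice]; exact hw.2
  have hmin : 0 ≤ min d (η * r) := le_min hd0 (by positivity)
  have hsub : {z | (w, z) ∈ shellSet η r} ⊆ closedBall w.1 r := fun z hz => by
    rw [mem_closedBall, dist_comm]; exact hz.1
  have hcov : closedBall w.1 r ⊆ {z | (w, z) ∈ shellSet η r} ∪ closedBall w.1 (min d (η * r)) := by
    intro z hz
    by_cases h : z ∈ closedBall w.1 (min d (η * r))
    · exact Or.inr h
    · left
      rw [mem_closedBall, dist_comm] at hz h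
      exact ⟨hz, not_le.1 h⟩
  have h1 : μ.real {z | (w, z) ∈ shellSet η r} ≤ μ.real (closedBall w.1 r) :=
    measureReal_mono hsub (measure_ne_top _ _)
  have h2 : μ.real (closedBall w.1 r) - μ.real {z | (w, z) ∈ shellSet η r} ≤ β * η ^ 2 * r ^ 2 * d := by
    have h3 := (measureReal_mono hcov (measure_ne_top μ _)).trans (measureReal_union_le _ _)
    have h4 := measureReal_closedBall_le hμ w.1 hmin
    have h5 : min d (η * r) ^ 3 ≤ (η * r) ^ 2 * d := by
      calc min d (η * r) ^ 3 = min d (η * r) ^ 2 * min d (η * r) := by ring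
        _ ≤ (η * r) ^ 2 * d := by
          gcongr
          · exact min_le_right _ _
          · exact min_le_left _ _
    have h6 : min d (η * r) ^ 3 * β ≤ (η * r) ^ 2 * d * β := by gcongr
    nlinarith
  have hv4 := (measureReal_closedBall_le hμ w.1 hr).trans hr3
  have hA := btail_le_exp_mul_btail measureReal_nonneg h1 hv4 h2 m k
  have hB := btail_le_exp (measureReal_nonneg (μ := μ) (s := {z | (w, z) ∈ luneSet r}))
    measureReal_le_one m k
  have hbv := btail_nonneg (measureReal_nonneg (μ := μ) (s := closedBall w.1 r)) measureReal_le_one m k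
  calc _ ≤ (exp (4 * (β * η ^ 2 * r ^ 2 * d) * m) * btail (μ.real (closedBall w.1 r)) m k) *
        (2 ^ k * exp (-(m * (e * r ^ 2 * d) / 2))) := by
        refine mul_le_mul hA (hB.trans ?_) (btail_nonneg measureReal_nonneg measureReal_le_one _ _)
          (by positivity)
        gcongr
    _ = 2 ^ k * btail (μ.real (closedBall w.1 r)) m k *
        exp (4 * (β * η ^ 2 * r ^ 2 * d) * m + -(m * (e * r ^ 2 * d) / 2)) := by
        rw [exp_add]; ring
    _ ≤ _ := by
        have hm : (0 : ℝ) ≤ m * r ^ 2 * d := by positivity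
        gcongr
        nlinarith

include hμ in
lemma pi_pairEv_le {k m : ℕ} {e η r s : ℝ} (he0 : 0 ≤ e) (hη : 0 ≤ η) (he : 16 * β * η ^ 2 ≤ e)
    (hr : 0 ≤ r) (hr3 : r ^ 3 * β ≤ 1 / 4) (hs : 0 ≤ s) (i : Fin (m + 2)) (j : Fin (m + 1)) :
    (Measure.pi fun _ : Fin (m + 2) => μ).real (pairEv μ k e η r i j) ≤
      2 ^ (k + 1) * (s ^ 3 * β + (2 * r) ^ 3 * β * exp (-(e / 4 * m * r ^ 2 * s))) *
        lowMean μ k m r := by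
  have hβ := β_pos
  have hΦ := lowMean_nonneg (μ := μ) k m r
  rw [measureReal_def]
  refine ENNReal.toReal_le_of_le_ofReal (by positivity) ?_
  refine (pi_pair_cnt_le μ i j (k + 1) (k + 1) (measurableSet_pairSet e r)
    (measurableSet_shellSet η r) (measurableSet_luneSet r) fun x y _ => ?_).trans ?_
  · rw [Set.disjoint_left]
    rintro z ⟨h1, -⟩ ⟨-, h2⟩
    exact h2.not_ge h1
  set a := e / 4 * m * r ^ 2 with ha
  set G := s ^ 3 * β + (2 * r) ^ 3 * β * exp (-(a * s)) with hG
  have hG0 : 0 ≤ G := by positivity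
  have hb : ∀ x : E3, 0 ≤ btail (μ.real (closedBall x r)) m (k + 1) := fun x =>
    btail_nonneg measureReal_nonneg measureReal_le_one _ _
  have hpt : ∀ x y : E3, (pairSet μ e r).indicator (fun w =>
      ENNReal.ofReal (btail (μ.real {z | (w, z) ∈ shellSet η r}) m (k + 1) *
        btail (μ.real {z | (w, z) ∈ luneSet r}) m (k + 1))) (x, y) ≤
      ENNReal.ofReal (2 ^ (k + 1) * btail (μ.real (closedBall x r)) m (k + 1)) *
        (closeSet (2 * r)).indicator
        (fun w => ENNReal.ofReal (exp (-(a * dist w.1 w.2)))) (x, y) := by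
    intro x y
    by_cases h : (x, y) ∈ pairSet μ e r
    · have h' : (x, y) ∈ closeSet (2 * r) := h.1
      rw [Set.indicator_of_mem h, Set.indicator_of_mem h',
        ← ENNReal.ofReal_mul (mul_nonneg (by positivity) (hb x))]
      exact ENNReal.ofReal_le_ofReal (pair_btail_le hμ hη he hr hr3 h m (k + 1))
    · rw [Set.indicator_of_notMem h]; exact zero_le
  calc _ ≤ ∫⁻ x, ENNReal.ofReal (2 ^ (k + 1) * btail (μ.real (closedBall x r)) m (k + 1)) *
        ENNReal.ofReal G ∂μ := by
        refine lintegral_mono fun x => (lintegral_mono (hpt x)).trans ?_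
        rw [lintegral_const_mul' _ _ ENNReal.ofReal_ne_top]
        gcongr
        exact lintegral_indicator_exp_le hμ x (by positivity) hr hs
    _ = ENNReal.ofReal (2 ^ (k + 1) * G * lowMean μ k m r) := by
        rw [ENNReal.ofReal_mul (by positivity), ofReal_lowMean hμ,
          ← lintegral_const_mul' _ _ ENNReal.ofReal_ne_top]
        refine lintegral_congr fun x => ?_
        rw [← ENNReal.ofReal_mul (mul_nonneg (by positivity) (hb x)),
          ← ENNReal.ofReal_mul (by positivity)]
        congr 1
        ring

/-- The event that two distant points both have few neighbours. -/
def farEv {m : ℕ} (k : ℕ) (r : ℝ) (i : Fin (m + 2)) (j : Fin (m + 1)) : Set (Fin (m + 2) → E3) :=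
  {X | (X i, i.removeNth X j) ∈ (closeSet (2 * r))ᶜ ∧
    cnt {z | ((X i, i.removeNth X j), z) ∈ {z : (E3 × E3) × E3 | dist z.1.1 z.2 ≤ r}}
      (j.removeNth (i.removeNth X)) < k + 1 ∧
    cnt {z | ((X i, i.removeNth X j), z) ∈ {z : (E3 × E3) × E3 | dist z.1.2 z.2 ≤ r}}
      (j.removeNth (i.removeNth X)) < k + 1}

include hμ in
lemma pi_farEv_le {k m : ℕ} {r : ℝ} (i : Fin (m + 2)) (j : Fin (m + 1)) :
    (Measure.pi fun _ : Fin (m + 2) => μ).real (farEv k r i j) ≤ lowMean μ k m r ^ 2 := by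
  have hΦ := lowMean_nonneg (μ := μ) k m r
  have hb : ∀ x : E3, 0 ≤ btail (μ.real (closedBall x r)) m (k + 1) := fun x =>
    btail_nonneg measureReal_nonneg measureReal_le_one _ _
  have e1 : ∀ w : E3 × E3, {z | (w, z) ∈ {z : (E3 × E3) × E3 | dist z.1.1 z.2 ≤ r}} =
      closedBall w.1 r := fun w => by ext z; simp [dist_comm]
  have e2 : ∀ w : E3 × E3, {z | (w, z) ∈ {z : (E3 × E3) × E3 | dist z.1.2 z.2 ≤ r}} =
      closedBall w.2 r := fun w => by ext z; simp [dist_comm]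
  rw [measureReal_def]
  refine ENNReal.toReal_le_of_le_ofReal (by positivity) ?_
  refine (pi_pair_cnt_le μ i j (k + 1) (k + 1) (measurableSet_closeSet _).compl
    (measurableSet_le (by fun_prop) (by fun_prop)) (measurableSet_le (by fun_prop) (by fun_prop))
    fun x y hxy => ?_).trans ?_
  · rw [e1, e2]
    have : 2 * r < dist x y := not_le.1 hxy
    exact closedBall_disjoint_closedBall (by linarith)
  calc _ ≤ ∫⁻ x, ∫⁻ y, ENNReal.ofReal (btail (μ.real (closedBall x r)) m (k + 1)) *
        ENNReal.ofReal (btail (μ.real (closedBall y r)) m (k + 1)) ∂μ ∂μ := by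
        refine lintegral_mono fun x => lintegral_mono fun y => (Set.indicator_le_self _ _ _).trans ?_
        simp only [e1, e2]
        rw [ENNReal.ofReal_mul (hb x)]
    _ = ENNReal.ofReal (lowMean μ k m r ^ 2) := by
        simp_rw [lintegral_const_mul' _ _ ENNReal.ofReal_ne_top]
        rw [lintegral_mul_const', ← ofReal_lowMean hμ, sq, ENNReal.ofReal_mul hΦ]
        rw [← ofReal_lowMean hμ]
        exact ENNReal.ofReal_ne_top

end PairBounds

section SecondMoment

lemma cnt_removeNth_removeNth_le {E : Type*} {m : ℕ} (D : Set E) (X : Fin (m + 2) → E)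
    (i : Fin (m + 2)) (j : Fin (m + 1)) :
    cnt D (j.removeNth (i.removeNth X)) ≤ cnt D ((i.succAbove j).removeNth X) := by
  rw [cnt_removeNth_eq, cnt_removeNth_eq]
  refine Set.ncard_le_ncard_of_injOn i.succAbove ?_ Fin.succAbove_right_injective.injOn
    (Set.toFinite _)
  rintro l ⟨h1, h2⟩
  exact ⟨fun h => h1 (Fin.succAbove_right_injective h), h2⟩

lemma ae_forall_mem {Ω : Set E3} (hΩ : MeasurableSet Ω) [IsProbabilityMeasure (volume.restrict Ω)]
    (n : ℕ) : ∀ᵐ X ∂(Measure.pi fun _ : Fin n => volume.restrict Ω), ∀ i, X i ∈ Ω := by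
  rw [ae_all_iff]
  intro i
  exact (Measure.tendsto_eval_ae_ae (μ := fun _ : Fin n => volume.restrict Ω) (i := i)).eventually
    (ae_restrict_mem hΩ)

lemma restrict_real {Ω : Set E3} (hΩ : MeasurableSet Ω) (T : Set E3) :
    (volume.restrict Ω).real T = volume.real (T ∩ Ω) := measureReal_restrict_apply' hΩ

lemma mem_farEv_or_pairEv {m k : ℕ} {μ : Measure E3} {e η r : ℝ} {X : Fin (m + 2) → E3}
    {i : Fin (m + 2)} {j : Fin (m + 1)}
    (hdich : ∀ i j, dist (X i) (X j) ≤ 2 * r → (X i, X j) ∈ pairSet μ e r ∨ (X j, X i) ∈ pairSet μ e r)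
    (hi : X ∈ lowDeg k r i) (hj : X ∈ lowDeg k r (i.succAbove j)) {j' : Fin (m + 1)}
    (hj' : (i.succAbove j).succAbove j' = i) :
    X ∈ farEv k r i j ∨ X ∈ pairEv μ k e η r i j ∨ X ∈ pairEv μ k e η r (i.succAbove j) j' := by
  have hpair : ∀ i j, X ∈ lowDeg k r i → X ∈ lowDeg k r (i.succAbove j) →
      (X i, X (i.succAbove j)) ∈ pairSet μ e r → X ∈ pairEv μ k e η r i j := by
    intro i j hi hj hmem
    refine ⟨hmem, lt_of_le_of_lt ?_ hi, lt_of_le_of_lt ?_ hj⟩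
    · exact (cnt_removeNth_le _ _ _).trans (cnt_mono (fun z hz => hz.1) _)
    · exact (cnt_removeNth_removeNth_le _ _ _ _).trans (cnt_mono (fun z hz => hz.1) _)
  by_cases hd : dist (X i) (X (i.succAbove j)) ≤ 2 * r
  · right
    rcases hdich i _ hd with h | h
    · exact Or.inl (hpair i j hi hj h)
    · exact Or.inr (hpair _ j' hj (by rwa [hj']) (by rwa [hj']))
  · left
    refine ⟨hd, lt_of_le_of_lt ?_ hi, lt_of_le_of_lt ?_ hj⟩
    · exact (cnt_removeNth_le _ _ _).trans (cnt_mono (fun z hz => hz) _)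
    · exact (cnt_removeNth_removeNth_le _ _ _ _).trans (cnt_mono (fun z hz => hz) _)

lemma pi_lowDeg_inter_le {Ω : Set E3} (hΩ : MeasurableSet Ω)
    [IsProbabilityMeasure (volume.restrict Ω)] {m k : ℕ} {e η r B : ℝ}
    (hdich : LuneDich Ω e r)
    (hB : ∀ i j, (Measure.pi fun _ : Fin (m + 2) => volume.restrict Ω).real
      (pairEv (volume.restrict Ω) k e η r i j) ≤ B) (i : Fin (m + 2)) (j : Fin (m + 1)) :
    (Measure.pi fun _ : Fin (m + 2) => volume.restrict Ω).real
      (lowDeg k r i ∩ lowDeg k r (i.succAbove j)) ≤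
      lowMean (volume.restrict Ω) k m r ^ 2 + 2 * B := by
  obtain ⟨j', hj'⟩ := Fin.exists_succAbove_eq (Fin.ne_succAbove i j)
  set P := Measure.pi fun _ : Fin (m + 2) => volume.restrict Ω with hP
  have hae : (lowDeg k r i ∩ lowDeg k r (i.succAbove j) : Set _) ≤ᵐ[P]
      (farEv k r i j ∪ (pairEv (volume.restrict Ω) k e η r i j ∪
        pairEv (volume.restrict Ω) k e η r (i.succAbove j) j') : Set _) := by
    filter_upwards [ae_forall_mem hΩ (m + 2)] with X hX
    rintro ⟨h1, h2⟩
    exact mem_farEv_or_pairEv (fun i j hd => hdich _ (hX i) _ (hX j) hd) h1 h2 hj'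
  have h1 : P.real (lowDeg k r i ∩ lowDeg k r (i.succAbove j)) ≤
      P.real (farEv k r i j ∪ (pairEv (volume.restrict Ω) k e η r i j ∪
        pairEv (volume.restrict Ω) k e η r (i.succAbove j) j')) :=
    ENNReal.toReal_mono (measure_ne_top _ _) (measure_mono_ae hae)
  have h2 := measureReal_union_le (μ := P) (farEv k r i j) (pairEv (volume.restrict Ω) k e η r i j ∪
        pairEv (volume.restrict Ω) k e η r (i.succAbove j) j')
  have h3 := measureReal_union_le (μ := P) (pairEv (volume.restrict Ω) k e η r i j)
        (pairEv (volume.restrict Ω) k e η r (i.succAbove j) j')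
  have h4 := pi_farEv_le (k := k) (r := r) (Measure.restrict_le_self : volume.restrict Ω ≤ volume) i j
  have h5 := hB i j
  have h6 := hB (i.succAbove j) j'
  linarith

lemma pi_forall_notMem_lowDeg_le {Ω : Set E3} (hΩ : MeasurableSet Ω)
    [IsProbabilityMeasure (volume.restrict Ω)] {m k : ℕ} {e η r B T q : ℝ} (hr : 0 ≤ r)
    (hdich : LuneDich Ω e r)
    (hB : ∀ i j, (Measure.pi fun _ : Fin (m + 2) => volume.restrict Ω).real
      (pairEv (volume.restrict Ω) k e η r i j) ≤ B) (hB0 : 0 ≤ B)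
    (hT : 0 < T) (hmean : (m + 2) * lowMean (volume.restrict Ω) k (m + 1) r = T)
    (hq : r ^ 3 * β ≤ q) (hq1 : q < 1) :
    (Measure.pi fun _ : Fin (m + 2) => volume.restrict Ω).real (⋂ i, (lowDeg k r i)ᶜ) ≤
      1 / T + ((1 / (1 - q)) ^ 2 - 1) + 2 * (m + 2) ^ 2 * B / T ^ 2 := by
  have hμ : volume.restrict Ω ≤ (volume : Measure E3) := Measure.restrict_le_self
  set μ := volume.restrict Ω with hμdef
  set Φ := lowMean μ k (m + 1) r with hΦ
  set Φ' := lowMean μ k m r with hΦ'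
  have hΦ'0 : 0 ≤ Φ' := lowMean_nonneg _ _ _
  have hstep : (1 - q) * Φ' ≤ Φ := lowMean_le_succ hμ hr hq
  have hq' : 0 < 1 - q := by linarith
  have hsum : ∑ i : Fin (m + 2), (Measure.pi fun _ : Fin (m + 2) => μ).real (lowDeg k r i) = T := by
    simp only [pi_lowDeg hμ, Finset.sum_const, Finset.card_univ, Fintype.card_fin, nsmul_eq_mul]
    rw [← hmean]; push_cast; rfl
  have hΦ'le : (m + 2) * Φ' ≤ T * (1 / (1 - q)) := by
    rw [mul_one_div, le_div_iff₀ hq', ← hmean, mul_assoc]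
    refine mul_le_mul_of_nonneg_left ?_ (by positivity)
    linarith
  have hbound : ∑ i : Fin (m + 2), ∑ j : Fin (m + 2),
      (Measure.pi fun _ : Fin (m + 2) => μ).real (lowDeg k r i ∩ lowDeg k r j) ≤
      T + (T * (1 / (1 - q))) ^ 2 + 2 * (m + 2) ^ 2 * B := by
    have h1 : ∀ i : Fin (m + 2), ∑ j : Fin (m + 2),
        (Measure.pi fun _ : Fin (m + 2) => μ).real (lowDeg k r i ∩ lowDeg k r j) ≤
        Φ + (m + 1) * (Φ' ^ 2 + 2 * B) := by
      intro i
      rw [Fin.sum_univ_succAbove _ i, Set.inter_self, pi_lowDeg hμ]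
      gcongr
      refine (Finset.sum_le_card_nsmul _ _ _ fun j _ => pi_lowDeg_inter_le hΩ hdich hB i j).trans ?_
      simp only [Finset.card_univ, Fintype.card_fin, nsmul_eq_mul, hΦ', hμdef]
      push_cast
      exact le_rfl
    refine (Finset.sum_le_sum fun i _ => h1 i).trans ?_
    simp only [Finset.sum_const, Finset.card_univ, Fintype.card_fin, nsmul_eq_mul]
    push_cast
    have h2 : ((m + 2) * Φ') ^ 2 ≤ (T * (1 / (1 - q))) ^ 2 := by gcongr
    have h3 : (0 : ℝ) ≤ (m + 2) * (Φ' ^ 2 + 2 * B) := by positivity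
    nlinarith
  refine (pi_inter_compl_le _ (fun i => measurableSet_lowDeg r i) hT hsum hbound).trans (le_of_eq ?_)
  field_simp
  ring

end SecondMoment

section LowMean

lemma Body.exists_far_mem {Ω : Set E3} {p : E3} {ρ D : ℝ} (h : Body Ω p ρ D 1) (x : E3) :
    ∃ z ∈ Ω, ρ ≤ dist z x := by
  have hρ := h.ρ_pos
  set v : E3 := EuclideanSpace.single 0 ρ with hv
  have hvn : ‖v‖ = ρ := by rw [hv, PiLp.norm_single, Real.norm_of_nonneg hρ.le]
  have h1 : p + v ∈ Ω := h.ball_subset (by rw [mem_closedBall, dist_eq_norm]; simp [hvn])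
  have h2 : p - v ∈ Ω := h.ball_subset (by rw [mem_closedBall, dist_eq_norm]; simp [hvn])
  by_contra! hcon
  have h3 := hcon _ h1
  have h4 := hcon _ h2
  have h5 := dist_triangle_right (p + v) (p - v) x
  have h6 : dist (p + v) (p - v) = 2 * ρ := by
    rw [dist_eq_norm, show p + v - (p - v) = (2 : ℝ) • v by module, norm_smul, hvn]
    simp
  linarith

lemma Body.exists_mem_dist_eq {Ω : Set E3} {p : E3} {ρ D : ℝ} (h : Body Ω p ρ D 1) {x : E3}
    (hx : x ∈ Ω) {t : ℝ} (ht0 : 0 ≤ t) (ht : t ≤ ρ) : ∃ y ∈ Ω, dist y x = t := by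
  obtain ⟨z, hz, hzx⟩ := h.exists_far_mem x
  obtain ⟨y, hy, hyt⟩ := h.conv.isPreconnected.intermediate_value hx hz
    (by fun_prop : ContinuousOn (fun y => dist y x) Ω) (show t ∈ Set.Icc _ _ by
      constructor
      · rwa [dist_self]
      · exact ht.trans hzx)
  exact ⟨y, hy, hyt⟩

lemma Body.exists_ball_ge {Ω : Set E3} {p : E3} {ρ D : ℝ} (h : Body Ω p ρ D 1) :
    ∃ c > 0, ∃ r₁ > 0, ∀ r : ℝ, 0 < r → r ≤ r₁ → ∀ x ∈ Ω,
      c * r ^ 3 ≤ (volume.restrict Ω).real (closedBall x r) ∧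
      (volume.restrict Ω).real (closedBall x r) + c * r ^ 3 ≤
        (volume.restrict Ω).real (closedBall x (2 * r)) := by
  have hβ := β_pos
  have hρ := h.ρ_pos
  have hρ1 := h.ρ_le
  have hD := h.D_ge
  have hΩ := h.comp.measurableSet
  refine ⟨(1 / 4 * ρ / (2 * D)) ^ 3 * β, by positivity, ρ / 2, by positivity, fun r hr hr1 x hx => ?_⟩
  obtain ⟨y, hy, hyx⟩ := h.exists_mem_dist_eq hx (t := 3 / 2 * r) (by positivity) (by linarith)
  have hz : ∀ z ∈ Ω, (1 / 4 * ρ / (2 * D)) ^ 3 * β * r ^ 3 ≤ volume.real (closedBall z (r / 4) ∩ Ω) := by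
    intro z hz
    have := h.vol_ball_ge hz (L := r / 4) (by positivity) (by nlinarith)
    refine le_trans (le_of_eq ?_) this
    ring
  have hfin : ∀ T : Set E3, volume (T ∩ Ω) ≠ ⊤ := fun T =>
    measure_ne_top_of_subset Set.inter_subset_right h.comp.measure_ne_top
  simp only [restrict_real hΩ]
  constructor
  · refine (hz x hx).trans (measureReal_mono ?_ (hfin _))
    gcongr
    linarith
  · have hdisj : Disjoint (closedBall x r ∩ Ω) (closedBall y (r / 4) ∩ Ω) := by
      refine Set.disjoint_left.2 fun w hw1 hw2 => ?_
      have h1 : dist w x ≤ r := hw1.1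
      have h2 : dist w y ≤ r / 4 := hw2.1
      have := dist_triangle_left y x w
      linarith
    have := measureReal_union (μ := volume) hdisj (measurableSet_closedBall.inter hΩ) (hfin _) (hfin _)
    calc _ ≤ volume.real (closedBall x r ∩ Ω) + volume.real (closedBall y (r / 4) ∩ Ω) := by
          gcongr
          exact hz y hy
      _ = volume.real (closedBall x r ∩ Ω ∪ closedBall y (r / 4) ∩ Ω) := this.symm
      _ ≤ _ := by
          refine measureReal_mono ?_ (hfin _)
          rw [← Set.union_inter_distrib_right]
          gcongr
          refine Set.union_subset (closedBall_subset_closedBall (by linarith)) fun w hw => ?_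
          have h2 : dist w y ≤ r / 4 := hw
          have := dist_triangle w y x
          rw [mem_closedBall]
          linarith

lemma restrict_closedBall_zero (Ω : Set E3) (x : E3) :
    (volume.restrict Ω).real (closedBall x 0) = 0 := by
  have := measureReal_closedBall_le (Measure.restrict_le_self : volume.restrict Ω ≤ volume) x le_rfl
  exact le_antisymm (this.trans_eq (by norm_num)) measureReal_nonneg

variable {Ω : Set E3} (hΩ : MeasurableSet Ω) [IsProbabilityMeasure (volume.restrict Ω)]

include hΩ in
lemma lowMean_le_of_forall {k m : ℕ} {r s t : ℝ} (ht : 0 ≤ t)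
    (h : ∀ x ∈ Ω, (volume.restrict Ω).real (closedBall x r) + t ≤
      (volume.restrict Ω).real (closedBall x s)) :
    lowMean (volume.restrict Ω) k m s ≤
      2 ^ (k + 1) * exp (-(m * t / 2)) * lowMean (volume.restrict Ω) k m r := by
  have hμ : volume.restrict Ω ≤ (volume : Measure E3) := Measure.restrict_le_self
  unfold lowMean
  rw [← integral_const_mul]
  refine integral_mono_ae (integrable_btail_ball hμ _ _ _)
    ((integrable_btail_ball hμ _ _ _).const_mul _) ?_
  filter_upwards [ae_restrict_mem hΩ] with x hx
  have hx' := h x hx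
  have h1 : (volume.restrict Ω).real (closedBall x s) ≤ 1 := measureReal_le_one
  have hb : (0 : ℝ) ≤ (volume.restrict Ω).real (closedBall x r) := measureReal_nonneg
  calc _ ≤ btail ((volume.restrict Ω).real (closedBall x r) + t) m (k + 1) :=
        btail_anti (by positivity) hx' h1 _ _
    _ ≤ btail ((volume.restrict Ω).real (closedBall x r)) m (k + 1) * btail t m (k + 1) :=
        btail_add_le_mul hb ht (hx'.trans h1) _ _
    _ ≤ btail ((volume.restrict Ω).real (closedBall x r)) m (k + 1) *
        (2 ^ (k + 1) * exp (-(m * t / 2))) := by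
        gcongr
        · exact btail_nonneg hb (by linarith) _ _
        · exact btail_le_exp ht (by linarith) _ _
    _ = _ := by ring

lemma exp_le_lowMean {k m : ℕ} {r : ℝ} (hr : 0 ≤ r) (hr3 : r ^ 3 * β ≤ 1 / 2) :
    exp (-(2 * (r ^ 3 * β) * m)) ≤ lowMean (volume.restrict Ω) k m r := by
  have hμ : volume.restrict Ω ≤ (volume : Measure E3) := Measure.restrict_le_self
  have hβ := β_pos
  have : ∀ x, exp (-(2 * (r ^ 3 * β) * m)) ≤
      btail ((volume.restrict Ω).real (closedBall x r)) m (k + 1) := by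
    intro x
    have h1 := measureReal_closedBall_le hμ x hr
    have h2 : exp (-(2 * (r ^ 3 * β))) ≤ 1 - r ^ 3 * β := by
      set q := r ^ 3 * β with hq
      have hq0 : 0 ≤ q := by positivity
      have h3 := add_one_le_exp (2 * q)
      rw [exp_neg, inv_le_iff_one_le_mul₀ (exp_pos _)]
      nlinarith
    refine le_trans ?_ (pow_le_btail measureReal_nonneg measureReal_le_one m k)
    rw [← neg_mul, mul_comm _ (m : ℝ), exp_nat_mul]
    gcongr
    linarith
  calc exp (-(2 * (r ^ 3 * β) * m)) = ∫ x, exp (-(2 * (r ^ 3 * β) * m)) ∂(volume.restrict Ω) := by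
        rw [integral_const]; simp
    _ ≤ _ := integral_mono (integrable_const _) (integrable_btail_ball hμ _ _ _) this

lemma lowMean_zero (k m : ℕ) : lowMean (volume.restrict Ω) k m 0 = 1 := by
  unfold lowMean
  simp only [restrict_closedBall_zero, btail_zero_prob]
  simp

include hΩ in
lemma lowMean_le_exp {k m : ℕ} {r s : ℝ}
    (h : ∀ x ∈ Ω, s ≤ (volume.restrict Ω).real (closedBall x r)) (hs : 0 ≤ s) :
    lowMean (volume.restrict Ω) k m r ≤ 2 ^ (k + 1) * exp (-(m * s / 2)) := by
  have := lowMean_le_of_forall (k := k) (m := m) hΩ (r := 0) (s := r) hs fun x hx =>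
    (by rw [restrict_closedBall_zero, zero_add]; exact h x hx)
  rwa [lowMean_zero, mul_one] at this

end LowMean

section UnionBound

lemma measureReal_iUnion_le_card_mul {α ι : Type*} [MeasurableSpace α] {P : Measure α}
    [Fintype ι] {S : ι → Set α} {b : ℝ} (h : ∀ i, P.real (S i) ≤ b) :
    P.real (⋃ i, S i) ≤ Fintype.card ι * b := by
  refine (measureReal_iUnion_fintype_le S).trans ((Finset.sum_le_sum fun i _ => h i).trans ?_)
  simp

/-- The union bound for the event that the critical radii differ, before any optimization. -/
lemma pi_badEv_le {Ω : Set E3} (hΩ : MeasurableSet Ω) [IsProbabilityMeasure (volume.restrict Ω)]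
    {m k L : ℕ} {e η c τ C r b₀ b₁ b₂ b₃ b₄ : ℝ} {F : Finset E3}
    (hcov : ∀ X : Fin (m + 2) → E3, (∀ i, X i ∈ Ω) → X ∈ badEv (m + 2) k →
        (∀ i, X ∉ lowDeg k r i) ∨ (∃ i, X ∈ lowDeg k (2 * r) i) ∨
        (∃ i j, X ∈ pairEv (volume.restrict Ω) k e η r i j) ∨
        (∃ i, ∃ 𝒞 ⊆ cellBox L,
          X ∈ sparseEv k (τ * r) 𝒞 (heavy (volume.restrict Ω) r (τ * r) (c * r ^ 3) 𝒞) i ∨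
          X ∈ sparseEv k (τ * r) 𝒞
            (heavyNear (volume.restrict Ω) F (C * r) (τ * r) (c * r ^ 3) 𝒞) i))
    (h₀ : (Measure.pi fun _ : Fin (m + 2) => volume.restrict Ω).real (⋂ i, (lowDeg k r i)ᶜ) ≤ b₀)
    (h₁ : ∀ i, (Measure.pi fun _ : Fin (m + 2) => volume.restrict Ω).real
      (lowDeg k (2 * r) i) ≤ b₁)
    (h₂ : ∀ i j, (Measure.pi fun _ : Fin (m + 2) => volume.restrict Ω).real
      (pairEv (volume.restrict Ω) k e η r i j) ≤ b₂)
    (h₃ : ∀ 𝒞 i, (Measure.pi fun _ : Fin (m + 2) => volume.restrict Ω).real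
      (sparseEv k (τ * r) 𝒞 (heavy (volume.restrict Ω) r (τ * r) (c * r ^ 3) 𝒞) i) ≤ b₃)
    (h₄ : ∀ 𝒞 i, (Measure.pi fun _ : Fin (m + 2) => volume.restrict Ω).real
      (sparseEv k (τ * r) 𝒞 (heavyNear (volume.restrict Ω) F (C * r) (τ * r) (c * r ^ 3) 𝒞) i)
        ≤ b₄) :
    (Measure.pi fun _ : Fin (m + 2) => volume.restrict Ω).real (badEv (m + 2) k) ≤
      b₀ + ((m + 2) * b₁ + ((m + 2) * ((m + 1) * b₂) +
        (m + 2) * ((cellBox L).powerset.card * (b₃ + b₄)))) := by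
  set P := Measure.pi fun _ : Fin (m + 2) => volume.restrict Ω with hP
  set S₃ : Finset (Fin 3 → ℤ) → Fin (m + 2) → Set (Fin (m + 2) → E3) := fun 𝒞 i =>
    sparseEv k (τ * r) 𝒞 (heavy (volume.restrict Ω) r (τ * r) (c * r ^ 3) 𝒞) i with hS₃
  set S₄ : Finset (Fin 3 → ℤ) → Fin (m + 2) → Set (Fin (m + 2) → E3) := fun 𝒞 i =>
    sparseEv k (τ * r) 𝒞 (heavyNear (volume.restrict Ω) F (C * r) (τ * r) (c * r ^ 3) 𝒞) i with hS₄
  set U₁ : Set (Fin (m + 2) → E3) := ⋃ i, lowDeg k (2 * r) i with hU₁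
  set U₂ : Set (Fin (m + 2) → E3) := ⋃ i, ⋃ j, pairEv (volume.restrict Ω) k e η r i j with hU₂
  set U₃ : Set (Fin (m + 2) → E3) := ⋃ i, ⋃ 𝒞 ∈ (cellBox L).powerset, (S₃ 𝒞 i ∪ S₄ 𝒞 i) with hU₃
  have hsub : (badEv (m + 2) k : Set (Fin (m + 2) → E3)) ≤ᵐ[P]
      ((⋂ i, (lowDeg k r i)ᶜ) ∪ (U₁ ∪ (U₂ ∪ U₃)) : Set _) := by
    filter_upwards [ae_forall_mem hΩ (m + 2)] with X hX hbad
    rcases hcov X hX hbad with h | ⟨i, h⟩ | ⟨i, j, h⟩ | ⟨i, 𝒞, h𝒞, h⟩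
    · exact Or.inl (Set.mem_iInter.2 h)
    · exact Or.inr (Or.inl (Set.mem_iUnion.2 ⟨i, h⟩))
    · exact Or.inr (Or.inr (Or.inl (Set.mem_iUnion.2 ⟨i, Set.mem_iUnion.2 ⟨j, h⟩⟩)))
    · exact Or.inr (Or.inr (Or.inr (Set.mem_iUnion.2
        ⟨i, Set.mem_iUnion₂.2 ⟨𝒞, Finset.mem_powerset.2 h𝒞, h⟩⟩)))
  have hle : P.real (badEv (m + 2) k) ≤ P.real ((⋂ i, (lowDeg k r i)ᶜ) ∪ (U₁ ∪ (U₂ ∪ U₃))) :=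
    ENNReal.toReal_mono (measure_ne_top _ _) (measure_mono_ae hsub)
  have e₁ : P.real U₁ ≤ (m + 2) * b₁ := by
    have := measureReal_iUnion_le_card_mul h₁
    refine this.trans_eq ?_
    rw [Fintype.card_fin]
    push_cast
    ring
  have e₂ : P.real U₂ ≤ (m + 2) * ((m + 1) * b₂) := by
    have := measureReal_iUnion_le_card_mul (P := P) (b := (m + 1) * b₂) fun i : Fin (m + 2) =>
      (by simpa using measureReal_iUnion_le_card_mul (h₂ i) :
        P.real (⋃ j, pairEv (volume.restrict Ω) k e η r i j) ≤ (m + 1) * b₂)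
    refine this.trans_eq ?_
    rw [Fintype.card_fin]
    push_cast
    ring
  have e₃ : P.real U₃ ≤ (m + 2) * ((cellBox L).powerset.card * (b₃ + b₄)) := by
    have := measureReal_iUnion_le_card_mul (P := P) (b := (cellBox L).powerset.card * (b₃ + b₄))
      fun i : Fin (m + 2) => (show
        P.real (⋃ 𝒞 ∈ (cellBox L).powerset, (S₃ 𝒞 i ∪ S₄ 𝒞 i)) ≤ _ by
        refine (measureReal_biUnion_finset_le _ _).trans
          ((Finset.sum_le_card_nsmul _ _ (b₃ + b₄) fun 𝒞 _ => ?_).trans_eq (nsmul_eq_mul _ _))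
        exact (measureReal_union_le _ _).trans (add_le_add (h₃ 𝒞 i) (h₄ 𝒞 i)))
    refine this.trans_eq ?_
    rw [Fintype.card_fin]
    push_cast
    ring
  have u₁ := measureReal_union_le (μ := P) (⋂ i, (lowDeg k r i)ᶜ) (U₁ ∪ (U₂ ∪ U₃))
  have u₂ := measureReal_union_le (μ := P) U₁ (U₂ ∪ U₃)
  have u₃ := measureReal_union_le (μ := P) U₂ U₃
  linarith

end UnionBound

section Threshold

lemma tendsto_pow_mul_exp_neg_mul {a : ℝ} (ha : 0 < a) (n : ℕ) :
    Tendsto (fun x : ℝ => x ^ n * exp (-(a * x))) atTop (𝓝 0) := by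
  have h := (tendsto_pow_mul_exp_neg_atTop_nhds_zero n).comp (tendsto_id.const_mul_atTop ha)
  have h2 := h.const_mul ((a ^ n)⁻¹)
  rw [mul_zero] at h2
  refine h2.congr fun x => ?_
  simp only [Function.comp, id, mul_pow]
  field_simp

lemma exists_pos_le_one_mul_sq_le {a e : ℝ} (ha : 0 < a) (he : 0 < e) :
    ∃ η : ℝ, 0 < η ∧ η ≤ 1 ∧ a * η ^ 2 ≤ e := by
  have h1 : min 1 (e / a) ≤ 1 := min_le_left _ _
  have h2 : min 1 (e / a) ≤ e / a := min_le_right _ _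
  have h0 : 0 < min 1 (e / a) := lt_min one_pos (by positivity)
  refine ⟨_, h0, h1, ?_⟩
  rw [le_div_iff₀ ha] at h2
  have h3 : min 1 (e / a) ^ 2 ≤ min 1 (e / a) := pow_le_of_le_one h0.le h1 (by norm_num)
  nlinarith

lemma exists_pos_forall_pow_mul_le {a e : ℝ} (ha : 0 < a) (he : 0 < e) :
    ∃ r₁ : ℝ, 0 < r₁ ∧ ∀ r, 0 < r → r ≤ r₁ → r ^ 3 * a ≤ e := by
  obtain ⟨η, hη, hη1, h⟩ := exists_pos_le_one_mul_sq_le ha he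
  refine ⟨η, hη, fun r hr hrη => ?_⟩
  have h1 : r ^ 3 ≤ r ^ 2 := pow_le_pow_of_le_one hr.le (hrη.trans hη1) (by norm_num)
  have h2 : r ^ 2 ≤ η ^ 2 := by gcongr
  nlinarith

set_option maxHeartbeats 1000000 in
lemma Body.exists_pi_badEv_le {Ω : Set E3} {p : E3} {ρ D : ℝ} (h : Body Ω p ρ D 1)
    [IsProbabilityMeasure (volume.restrict Ω)] (k : ℕ) {T : ℝ} (hT : 0 < T) :
    ∃ r₁ > 0, ∃ g : ℝ → ℝ, Tendsto g atTop (𝓝 0) ∧ ∀ (r : ℝ) (m : ℕ), 0 < r → r ≤ r₁ → k ≤ m →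
      1 ≤ m → (m + 2) * lowMean (volume.restrict Ω) k (m + 1) r = T →
      (Measure.pi fun _ : Fin (m + 2) => volume.restrict Ω).real (badEv (m + 2) k) ≤
        1 / T + ((1 / (1 - r ^ 3 * β)) ^ 2 - 1) + g (m * r ^ 3) := by
  have hβ := β_pos
  have hΩ := h.comp.measurableSet
  have hμ : volume.restrict Ω ≤ (volume : Measure E3) := Measure.restrict_le_self
  obtain ⟨e, ra, he, hra, hlune⟩ := h.exists_luneDich
  obtain ⟨η, hη, hη1, hηe⟩ :=
    exists_pos_le_one_mul_sq_le (show 0 < 16 * β by positivity) he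
  obtain ⟨c, τ, C, rb, L, F, hc, hτ, hC, hrb, hcov⟩ := h.exists_badEv_subset η hη hη1
  obtain ⟨c₁, hc₁, rc, hrc, hball⟩ := h.exists_ball_ge
  obtain ⟨rd, hrd, hrd1⟩ := exists_pos_forall_pow_mul_le hβ (show (0 : ℝ) < 1 / 4 by norm_num)
  set N : ℝ := ((cellBox L).powerset.card : ℝ) with hN
  set G : ℝ → ℝ := fun M => 2 ^ (k + 2) * T * (3 * β) *
    ((√M)⁻¹ + 8 * ((√M) ^ 2 * exp (-(e / 4 * √M)))) with hG
  refine ⟨min (min ra rb) (min rc rd), lt_min (lt_min hra hrb) (lt_min hrc hrd),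
    fun M => (2 / T ^ 2 + 1) * G M + 2 ^ (k + 1) * T * (M ^ 0 * exp (-(c₁ / 2 * M))) +
      N * (2 ^ (k + 1) * T * (M ^ 0 * exp (-(c / 2 * M))) +
        2 ^ (k + 1) * (F.card * (C ^ 3 * β)) * 3 * (M ^ 1 * exp (-(c / 2 * M)))), ?_, ?_⟩
  · have hsq : Tendsto (fun M : ℝ => √M) atTop atTop := tendsto_sqrt_atTop
    have hG0 : Tendsto G atTop (𝓝 0) := by
      have h1 := tendsto_inv_atTop_zero.comp hsq
      have h2 := (tendsto_pow_mul_exp_neg_mul (a := e / 4) (by positivity) 2).comp hsq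
      simpa using (h1.add (h2.const_mul 8)).const_mul (2 ^ (k + 2) * T * (3 * β))
    have h1 := tendsto_pow_mul_exp_neg_mul (a := c₁ / 2) (by positivity) 0
    have h2 := tendsto_pow_mul_exp_neg_mul (a := c / 2) (by positivity) 0
    have h3 := tendsto_pow_mul_exp_neg_mul (a := c / 2) (by positivity) 1
    have := ((hG0.const_mul (2 / T ^ 2 + 1)).add (h1.const_mul (2 ^ (k + 1) * T))).add
      (((h2.const_mul (2 ^ (k + 1) * T)).add
        (h3.const_mul (2 ^ (k + 1) * (F.card * (C ^ 3 * β)) * 3))).const_mul N)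
    simpa only [mul_zero, add_zero] using this
  intro r m hr hrle hkm hm hmean
  have hra' : r ≤ ra := hrle.trans ((min_le_left _ _).trans (min_le_left _ _))
  have hrb' : r ≤ rb := hrle.trans ((min_le_left _ _).trans (min_le_right _ _))
  have hrc' : r ≤ rc := hrle.trans ((min_le_right _ _).trans (min_le_left _ _))
  have hrd' : r ≤ rd := hrle.trans ((min_le_right _ _).trans (min_le_right _ _))
  have hq : r ^ 3 * β ≤ 1 / 4 := hrd1 r hr hrd'
  have hm1 : (1 : ℝ) ≤ m := by exact_mod_cast hm
  set M : ℝ := m * r ^ 3 with hM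
  have hM0 : 0 < M := by positivity
  have hsM : 0 < √M := sqrt_pos.2 hM0
  set Φ := lowMean (volume.restrict Ω) k (m + 1) r with hΦ
  set Φ' := lowMean (volume.restrict Ω) k m r with hΦ'
  have hΦ0 : 0 ≤ Φ := lowMean_nonneg _ _ _
  have hΦ'0 : 0 ≤ Φ' := lowMean_nonneg _ _ _
  have hΦ'2 : (m + 2) * Φ' ≤ 2 * T := by
    have h1 : (1 - r ^ 3 * β) * Φ' ≤ Φ := lowMean_le_succ hμ hr.le le_rfl
    have h2 : Φ' ≤ 2 * Φ := by nlinarith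
    calc (m + 2) * Φ' ≤ (m + 2) * (2 * Φ) := by gcongr
      _ = 2 * T := by rw [← hmean]; ring
  -- the pair events
  set s : ℝ := r / √M with hs
  have hs0 : 0 < s := by positivity
  set b₂ : ℝ := 2 ^ (k + 1) * (s ^ 3 * β + (2 * r) ^ 3 * β * exp (-(e / 4 * m * r ^ 2 * s))) * Φ'
    with hb₂
  have hb₂0 : 0 ≤ b₂ := by positivity
  have hpair : ∀ i j, (Measure.pi fun _ : Fin (m + 2) => volume.restrict Ω).real
      (pairEv (volume.restrict Ω) k e η r i j) ≤ b₂ := fun i j =>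
    pi_pairEv_le hμ he.le hη.le hηe hr.le hq hs0.le i j
  have hsqM : √M ^ 2 = M := sq_sqrt hM0.le
  have hmr : m * r ^ 2 * s = √M := by
    rw [hs, mul_div_assoc', div_eq_iff hsM.ne', ← sq, hsqM, hM]; ring
  have hms : (m + 2) * s ^ 3 ≤ 3 * (√M)⁻¹ := by
    have : (m : ℝ) * s ^ 3 = (√M)⁻¹ := by
      rw [hs, div_pow, mul_div_assoc', ← hM, pow_succ, hsqM]
      field_simp
    nlinarith [pow_pos hs0 3]
  have hmr3 : (m + 2) * r ^ 3 ≤ 3 * M := by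
    rw [hM]; nlinarith [pow_pos hr 3]
  have hb₂G : (m + 2) ^ 2 * b₂ ≤ G M := by
    have hexp : exp (-(e / 4 * m * r ^ 2 * s)) = exp (-(e / 4 * √M)) := by
      rw [← hmr]; congr 1; ring
    calc (m + 2) ^ 2 * b₂ = 2 ^ (k + 1) * β * ((m + 2) * s ^ 3 + 8 * ((m + 2) * r ^ 3 *
          exp (-(e / 4 * √M)))) * ((m + 2) * Φ') := by rw [hb₂, hexp]; ring
      _ ≤ 2 ^ (k + 1) * β * (3 * (√M)⁻¹ + 8 * (3 * M * exp (-(e / 4 * √M)))) * (2 * T) := by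
          gcongr
      _ = G M := by simp only [hG, hsqM]; ring
  have h₀ := pi_forall_notMem_lowDeg_le hΩ hr.le (hlune r hr hra') hpair hb₂0 hT hmean le_rfl
    (by linarith)
  have hexp₁ : ∀ a : ℝ, 0 < a → a / 2 * M ≤ (m + 1 : ℕ) * (a * r ^ 3) / 2 := by
    intro a ha
    rw [hM]
    push_cast
    nlinarith [mul_pos ha (pow_pos hr 3)]
  have hkey := pi_badEv_le hΩ (hcov e r hr hrb' (hlune r hr hra') k m hkm) h₀
    (b₁ := 2 ^ (k + 1) * exp (-(c₁ / 2 * M)) * Φ) (b₃ := 2 ^ (k + 1) * exp (-(c / 2 * M)) * Φ)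
    (b₄ := 2 ^ (k + 1) * exp (-(c / 2 * M)) * (F.card * ((C * r) ^ 3 * β)))
    (fun i => by
      rw [pi_lowDeg hμ]
      refine (lowMean_le_of_forall hΩ (t := c₁ * r ^ 3) (by positivity)
        fun x hx => (hball r hr hrc' x hx).2).trans ?_
      gcongr
      exact hexp₁ c₁ hc₁)
    hpair
    (fun 𝒞 i => by
      refine (pi_sparseEv_heavy_le hμ (by positivity) 𝒞 i).trans ?_
      gcongr
      exact hexp₁ c hc)
    (fun 𝒞 i => by
      refine (pi_sparseEv_heavyNear_le hμ (by positivity) (by positivity) F 𝒞 i).trans ?_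
      gcongr
      exact hexp₁ c hc)
  refine hkey.trans ?_
  have t₁ : (m + 2) * (2 ^ (k + 1) * exp (-(c₁ / 2 * M)) * Φ) =
      2 ^ (k + 1) * T * (M ^ 0 * exp (-(c₁ / 2 * M))) := by rw [← hmean]; ring
  have t₀ : 2 * (m + 2) ^ 2 * b₂ / T ^ 2 ≤ 2 / T ^ 2 * G M := by
    calc _ = 2 / T ^ 2 * ((m + 2) ^ 2 * b₂) := by ring
      _ ≤ _ := by gcongr
  have t₂ : (m + 2) * ((m + 1) * b₂) ≤ G M := by
    refine le_trans ?_ hb₂G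
    nlinarith
  have t₃ : (m + 2) * (N * (2 ^ (k + 1) * exp (-(c / 2 * M)) * Φ +
      2 ^ (k + 1) * exp (-(c / 2 * M)) * (F.card * ((C * r) ^ 3 * β)))) ≤
      N * (2 ^ (k + 1) * T * (M ^ 0 * exp (-(c / 2 * M))) +
        2 ^ (k + 1) * (F.card * (C ^ 3 * β)) * 3 * (M ^ 1 * exp (-(c / 2 * M)))) := by
    calc _ = N * (2 ^ (k + 1) * ((m + 2) * Φ) * exp (-(c / 2 * M)) +
          2 ^ (k + 1) * (F.card * (C ^ 3 * β)) * ((m + 2) * r ^ 3) * exp (-(c / 2 * M))) := by ring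
      _ ≤ N * (2 ^ (k + 1) * T * exp (-(c / 2 * M)) +
          2 ^ (k + 1) * (F.card * (C ^ 3 * β)) * (3 * M) * exp (-(c / 2 * M))) := by
          rw [hmean]
          gcongr
      _ = _ := by ring
  linarith

end Threshold

section Conclusion

lemma exists_pos_forall_inv_sq_sub_one_le {ε : ℝ} (hε : 0 < ε) :
    ∃ r₁ : ℝ, 0 < r₁ ∧ ∀ r, 0 < r → r ≤ r₁ → (1 / (1 - r ^ 3 * β)) ^ 2 - 1 ≤ ε := by
  have hβ := β_pos
  obtain ⟨r₁, hr₁, h⟩ := exists_pos_forall_pow_mul_le hβ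
    (show 0 < min (1 / 2) (ε / 8) from lt_min (by norm_num) (by positivity))
  refine ⟨r₁, hr₁, fun r hr hr1 => ?_⟩
  have h1 := h r hr hr1
  have h2 := h1.trans (min_le_left _ _)
  have h3 := h1.trans (min_le_right _ _)
  have h0 : 0 < r ^ 3 * β := by positivity
  set q := r ^ 3 * β
  rw [sub_le_iff_le_add, div_pow, one_pow, div_le_iff₀ (by nlinarith)]
  nlinarith [mul_nonneg hε.le (sq_nonneg (1 / 2 - q)), mul_nonneg hε.le (by linarith : 0 ≤ 1 / 2 - q)]

lemma Body.eventually_exists_threshold {Ω : Set E3} {p : E3} {ρ D : ℝ} (h : Body Ω p ρ D 1)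
    [IsProbabilityMeasure (volume.restrict Ω)] (k : ℕ) {T r₁ M₀ : ℝ} (hT : 0 < T) (hr₁ : 0 < r₁)
    (hM₀ : 0 < M₀) :
    ∀ᶠ m : ℕ in atTop, ∃ r, 0 < r ∧ r ≤ r₁ ∧ M₀ ≤ m * r ^ 3 ∧
      (m + 2) * lowMean (volume.restrict Ω) k (m + 1) r = T := by
  have hβ := β_pos
  have hΩ := h.comp.measurableSet
  have hμ : volume.restrict Ω ≤ (volume : Measure E3) := Measure.restrict_le_self
  obtain ⟨c, hc, r₂, hr₂, hball⟩ := h.exists_ball_ge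
  obtain ⟨r₃, hr₃, hsmall⟩ := exists_pos_forall_pow_mul_le hβ (show (0 : ℝ) < 1 / 2 by norm_num)
  set R := min r₁ (min r₂ r₃) with hR
  have hR0 : 0 < R := lt_min hr₁ (lt_min hr₂ hr₃)
  have hcast : Tendsto (fun m : ℕ => (m : ℝ)) atTop atTop := tendsto_natCast_atTop_atTop
  have hup : ∀ᶠ m : ℕ in atTop,
      3 * 2 ^ (k + 1) * ((m : ℝ) ^ 1 * exp (-(c * R ^ 3 / 2 * m))) ≤ T := by
    have h1 := ((tendsto_pow_mul_exp_neg_mul (a := c * R ^ 3 / 2) (by positivity) 1).comp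
      hcast).const_mul (3 * 2 ^ (k + 1))
    rw [mul_zero] at h1
    exact h1.eventually (ge_mem_nhds hT)
  filter_upwards [hup, hcast.eventually_ge_atTop 1, hcast.eventually_ge_atTop (M₀ / R ^ 3),
    hcast.eventually_ge_atTop (T * exp (4 * β * M₀))] with m hm1 hm2 hm3 hm4
  have hm0 : (0 : ℝ) < m := by linarith
  set r₀ : ℝ := (M₀ / m) ^ ((3 : ℕ) : ℝ)⁻¹ with hr₀
  have hr₀0 : 0 < r₀ := rpow_pos_of_pos (by positivity) _
  have hr₀3 : r₀ ^ 3 = M₀ / m := rpow_inv_natCast_pow (by positivity) (by norm_num)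
  have hr₀R : r₀ ≤ R := by
    rw [← pow_le_pow_iff_left₀ hr₀0.le hR0.le (show 3 ≠ 0 by norm_num), hr₀3,
      div_le_iff₀ hm0]
    rw [div_le_iff₀ (by positivity)] at hm3
    linarith
  have hlow : T ≤ (m + 2) * lowMean (volume.restrict Ω) k (m + 1) r₀ := by
    have h1 : exp (-(2 * (r₀ ^ 3 * β) * (m + 1 : ℕ))) ≤
        lowMean (volume.restrict Ω) k (m + 1) r₀ :=
      exp_le_lowMean hr₀0.le
        (hsmall _ hr₀0 (hr₀R.trans ((min_le_right _ _).trans (min_le_right _ _))))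
    have h2 : exp (-(4 * β * M₀)) ≤ exp (-(2 * (r₀ ^ 3 * β) * (m + 1 : ℕ))) := by
      rw [exp_le_exp, hr₀3, neg_le_neg_iff]
      push_cast
      rw [show 2 * (M₀ / m * β) * ((m : ℝ) + 1) = 2 * β * M₀ * ((m + 1) / m) by ring]
      have : ((m : ℝ) + 1) / m ≤ 2 := by rw [div_le_iff₀ hm0]; linarith
      calc 2 * β * M₀ * ((m + 1) / m) ≤ 2 * β * M₀ * 2 := by gcongr
        _ = _ := by ring
    calc T = T * exp (4 * β * M₀) * exp (-(4 * β * M₀)) := by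
          rw [mul_assoc, ← exp_add, add_neg_cancel, exp_zero, mul_one]
      _ ≤ (m + 2) * exp (-(4 * β * M₀)) := by gcongr; linarith
      _ ≤ _ := by gcongr; exact h2.trans h1
  have hhigh : (m + 2) * lowMean (volume.restrict Ω) k (m + 1) R ≤ T := by
    have h1 := lowMean_le_exp (k := k) (m := m + 1) hΩ (r := R) (s := c * R ^ 3) (fun x hx =>
      (hball R hR0 ((min_le_right _ _).trans (min_le_left _ _)) x hx).1) (by positivity)
    have h2 : exp (-((m + 1 : ℕ) * (c * R ^ 3) / 2)) ≤ exp (-(c * R ^ 3 / 2 * m)) := by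
      rw [exp_le_exp]
      push_cast
      nlinarith [mul_pos hc (pow_pos hR0 3)]
    calc _ ≤ (3 * m) * (2 ^ (k + 1) * exp (-(c * R ^ 3 / 2 * m))) := by
          gcongr
          · exact lowMean_nonneg _ _ _
          · linarith
          · exact h1.trans (by gcongr)
      _ = 3 * 2 ^ (k + 1) * ((m : ℝ) ^ 1 * exp (-(c * R ^ 3 / 2 * m))) := by ring
      _ ≤ T := hm1
  obtain ⟨r, ⟨hra, hrb⟩, hr⟩ := intermediate_value_Icc' hr₀R
    (((continuous_lowMean hμ k (m + 1)).const_mul ((m : ℝ) + 2)).continuousOn) ⟨hhigh, hlow⟩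
  refine ⟨r, hr₀0.trans_le hra, hrb.trans (min_le_left _ _), ?_, hr⟩
  calc M₀ = m * r₀ ^ 3 := by rw [hr₀3]; field_simp
    _ ≤ m * r ^ 3 := by gcongr

lemma Body.tendsto_pi_badEv {Ω : Set E3} {p : E3} {ρ D : ℝ} (h : Body Ω p ρ D 1)
    [IsProbabilityMeasure (volume.restrict Ω)] (k : ℕ) :
    Tendsto (fun n : ℕ => (Measure.pi fun _ : Fin n => volume.restrict Ω).real (badEv n k))
      atTop (𝓝 0) := by
  rw [← tendsto_add_atTop_iff_nat 2]
  refine (tendsto_order.2 ⟨fun a ha => Eventually.of_forall fun n => ha.trans_le measureReal_nonneg,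
    fun ε hε => ?_⟩)
  obtain ⟨ra, hra, g, hg, hbound⟩ := h.exists_pi_badEv_le k (show 0 < 4 / ε by positivity)
  obtain ⟨rb, hrb, hsq⟩ := exists_pos_forall_inv_sq_sub_one_le (show 0 < ε / 4 by positivity)
  obtain ⟨M₀, hM₀⟩ := eventually_atTop.1 (hg.eventually (ge_mem_nhds (show 0 < ε / 4 by positivity)))
  filter_upwards [h.eventually_exists_threshold k (T := 4 / ε) (r₁ := min ra rb) (M₀ := max M₀ 1)
    (by positivity) (lt_min hra hrb) (by positivity), eventually_ge_atTop k,
    eventually_ge_atTop 1] with m ⟨r, hr, hrle, hM, hmean⟩ hkm hm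
  have h1 := hbound r m hr (hrle.trans (min_le_left _ _)) hkm hm hmean
  have h2 := hsq r hr (hrle.trans (min_le_right _ _))
  have h3 := hM₀ _ ((le_max_left _ _).trans hM)
  rw [one_div_div] at h1
  linarith

lemma exists_body {Ω : Set E3} (hconv : Convex ℝ Ω) (hcomp : IsCompact Ω)
    (hint : (interior Ω).Nonempty) : ∃ p ρ D, Body Ω p ρ D 1 := by
  obtain ⟨p, hp⟩ := hint
  obtain ⟨ρ, hρ, hball⟩ := nhds_basis_closedBall.mem_iff.1 (mem_interior_iff_mem_nhds.1 hp)
  obtain ⟨D, hD⟩ := isBounded_iff.1 hcomp.isBounded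
  refine ⟨p, min ρ 1, max D 1, hconv, hcomp, lt_min hρ one_pos, min_le_right _ _, le_max_right _ _,
    one_pos, ?_, fun x hx y hy => ?_⟩
  · rw [one_mul]
    exact (closedBall_subset_closedBall (min_le_left _ _)).trans hball
  · rw [one_mul]
    exact (hD hx hy).trans (le_max_left _ _)

end Conclusion

theorem critical_radii_coincide_3d
    (Ω : Set (EuclideanSpace ℝ (Fin 3)))
    (hconv : Convex ℝ Ω) (hcomp : IsCompact Ω) (hint : (interior Ω).Nonempty)
    (hvol : volume Ω = 1)
    (k : ℕ) (hk : 1 ≤ k) :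
    Tendsto (fun n : ℕ =>
        ((Measure.pi fun _ : Fin n => volume.restrict Ω)
          {X : Fin n → EuclideanSpace ℝ (Fin 3) |
            sInf {r : ℝ | 0 < r ∧ ∀ i : Fin n,
                k + 1 ≤ {j : Fin n | j ≠ i ∧ dist (X i) (X j) ≤ r}.ncard}
            = sInf {r : ℝ | 0 < r ∧ k + 2 ≤ n ∧
                ∀ S : Finset (Fin n), S.card ≤ k →
                  ((SimpleGraph.fromRel fun i j : Fin n => dist (X i) (X j) ≤ r).induce
                    ((↑S : Set (Fin n))ᶜ)).Connected}}).toReal)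
      atTop (𝓝 1) := by
  have : IsProbabilityMeasure (volume.restrict Ω) :=
    ⟨by rw [Measure.restrict_apply_univ, hvol]⟩
  obtain ⟨p, ρ, D, h⟩ := exists_body hconv hcomp hint
  refine tendsto_of_tendsto_of_tendsto_of_le_of_le
    (by simpa using (h.tendsto_pi_badEv k).const_sub 1) tendsto_const_nhds (fun n => ?_)
    (fun n => measureReal_le_one)
  set P := Measure.pi fun _ : Fin n => volume.restrict Ω
  have h1 := measureReal_union_le (μ := P) (badEv n k)ᶜ (badEv n k)
  rw [Set.compl_union_self, probReal_univ] at h1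
  have h2 : P.real (badEv n k)ᶜ ≤ P.real {X | sInf (degRadii X k) = sInf (connRadii X k)} :=
    measureReal_mono (fun X hX => not_not.1 hX) (measure_ne_top _ _)
  exact sub_le_iff_le_add.2 (h1.trans (by gcongr; exact h2))
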